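/- Let p > 2, n = 1 and Ω = (−1,1). Suppose u₀ ∈ X is such that: (a) there is no classical solution of u_t − u_xx = |u_x|^p with zero Dirichlet data and initial data u₀ on [−1,1] × [0,∞) (i.e., T*(u₀) < ∞); and (b) for every family (u_j)_{j≥1} of classical solutions of the regularized problems with data u₀, for every t > 0, sup_{j≥1} u_j(x,t) → 0 as x → −1⁺ and as x → 1⁻ (no loss of boundary conditions for the global viscosity solution with data u₀). Let v₀ ∈ X with v₀ ≤ u₀ on [−1,1] and v₀ ≢ u₀. Then there exists a (global) classical solution of u_t − u_xx = |u_x|^p with zero Dirichlet data and initial data v₀ on [−1,1] × [0,∞), i.e., T*(v₀) = ∞. -/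

import Mathlib

open Set Filter Metric MeasureTheory Topology

noncomputable section

/-- Membership in the class `X` for `Ω = (-1,1) ⊂ ℝ`: `v ∈ C¹([-1,1])`, `v ≥ 0`,
`v(-1) = v(1) = 0`. -/
def MemX1 (v : ℝ → ℝ) : Prop :=
  ContDiffOn ℝ 1 v (Icc (-1:ℝ) 1) ∧ (∀ x ∈ Icc (-1:ℝ) 1, 0 ≤ v x) ∧ v (-1) = 0 ∧ v 1 = 0

/-- The regularized Hamiltonian `F_j(ξ) = min(|ξ|^p, j^{p-2}ξ²)`. -/
def Fj1 (p : ℝ) (j : ℕ) (ξ : ℝ) : ℝ :=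
  min (|ξ| ^ p) ((j : ℝ) ^ (p - 2) * ξ ^ 2)

/-- `u` is a classical solution of the `j`-th regularized problem on `[-1,1] × [0,∞)`:
`∂ₜu = ∂ₓₓu + F_j(∂ₓu)` in `(-1,1) × (0,∞)`, `u(±1,t) = 0` for `t > 0`, `u(·,0) = u₀`. -/
structure IsRegSol1 (p : ℝ) (j : ℕ) (u0 : ℝ → ℝ) (u : ℝ → ℝ → ℝ) : Prop where
  cont : ContinuousOn (fun q : ℝ × ℝ => u q.1 q.2) (Icc (-1:ℝ) 1 ×ˢ Ici (0:ℝ))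
  nonneg : ∀ x ∈ Icc (-1:ℝ) 1, ∀ t ∈ Ici (0:ℝ), 0 ≤ u x t
  time_reg : ∀ x ∈ Ioo (-1:ℝ) 1, ContDiffOn ℝ 1 (fun s => u x s) (Ioi (0:ℝ))
  space_reg : ∀ t ∈ Ioi (0:ℝ), ContDiffOn ℝ 2 (fun y => u y t) (Ioo (-1:ℝ) 1)
  eqn : ∀ x ∈ Ioo (-1:ℝ) 1, ∀ t ∈ Ioi (0:ℝ),
    deriv (fun s => u x s) t
      = deriv (deriv (fun y => u y t)) x + Fj1 p j (deriv (fun y => u y t) x)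
  bc : ∀ t ∈ Ioi (0:ℝ), u (-1) t = 0 ∧ u 1 t = 0
  ic : ∀ x ∈ Icc (-1:ℝ) 1, u x 0 = u0 x

/-- `u` is a global classical solution of the Dirichlet problem
`∂ₜu = ∂ₓₓu + |∂ₓu|^p` in `(-1,1) × (0,∞)`, `u(±1,·) = 0`, `u(·,0) = u₀`, with `u` and `∂ₓu`
extending continuously to `[-1,1] × [0,∞)`. Its existence means `T*(u₀) = ∞`. -/
structure IsClassicalSol1Global (p : ℝ) (u0 : ℝ → ℝ) (u : ℝ → ℝ → ℝ) : Prop where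
  cont : ContinuousOn (fun q : ℝ × ℝ => u q.1 q.2) (Icc (-1:ℝ) 1 ×ˢ Ici (0:ℝ))
  deriv_cont : ∃ G : ℝ × ℝ → ℝ, ContinuousOn G (Icc (-1:ℝ) 1 ×ˢ Ici (0:ℝ)) ∧
    ∀ x ∈ Ioo (-1:ℝ) 1, ∀ t ∈ Ioi (0:ℝ), G (x, t) = deriv (fun y => u y t) x
  time_reg : ∀ x ∈ Ioo (-1:ℝ) 1, ContDiffOn ℝ 1 (fun s => u x s) (Ioi (0:ℝ))
  space_reg : ∀ t ∈ Ioi (0:ℝ), ContDiffOn ℝ 2 (fun y => u y t) (Ioo (-1:ℝ) 1)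
  eqn : ∀ x ∈ Ioo (-1:ℝ) 1, ∀ t ∈ Ioi (0:ℝ),
    deriv (fun s => u x s) t
      = deriv (deriv (fun y => u y t)) x + |deriv (fun y => u y t) x| ^ p
  bc : ∀ t ∈ Ici (0:ℝ), u (-1) t = 0 ∧ u 1 t = 0
  ic : ∀ x ∈ Icc (-1:ℝ) 1, u x 0 = u0 x

/-- The pointwise supremum `U(x,t) = sup_{j ≥ 1} u_j(x,t)` of a family of approximating
solutions; on `(-1,1) × (0,∞)` this coincides with the global viscosity solution. -/
def Usup1 (u : ℕ → ℝ → ℝ → ℝ) (x t : ℝ) : ℝ :=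
  ⨆ j : {j : ℕ // 1 ≤ j}, u j.1 x t

/-- The one-dimensional heat kernel `(4πτ)^{-1/2} exp(-y²/4τ)`. -/
def heatK0 (τ y : ℝ) : ℝ := (√(4 * Real.pi))⁻¹ * (√τ)⁻¹ * Real.exp (-y ^ 2 / (4 * τ))

/-- First spatial derivative of the heat kernel. -/
def heatK1 (τ y : ℝ) : ℝ := -y / (2 * τ) * heatK0 τ y

/-- Second spatial derivative of the heat kernel, which is also its time derivative. -/
def heatK2 (τ y : ℝ) : ℝ := (y ^ 2 / (4 * τ ^ 2) - 1 / (2 * τ)) * heatK0 τ y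

/-- The average `∫ η(z) g(x - r z) dz` of `g` around `x` at scale `r` with profile `η`. -/
def scaleAvg (η : ℝ → ℝ) (r : ℝ) (g : ℝ → ℝ) (x : ℝ) : ℝ := ∫ z, η z * g (x - r * z)

lemma hasDerivAt_heatK0 {τ : ℝ} (hτ : 0 < τ) (y : ℝ) :
    HasDerivAt (heatK0 τ) (heatK1 τ y) y := by
  have h : HasDerivAt (fun y : ℝ => -y ^ 2 / (4 * τ)) (-(2 * y) / (4 * τ)) y := by
    simpa using ((hasDerivAt_pow 2 y).neg.div_const (4 * τ))
  refine (h.exp.const_mul ((√(4 * Real.pi))⁻¹ * (√τ)⁻¹)).congr_deriv ?_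
  unfold heatK1 heatK0
  field_simp
  ring

lemma hasDerivAt_heatK1 {τ : ℝ} (hτ : 0 < τ) (y : ℝ) :
    HasDerivAt (heatK1 τ) (heatK2 τ y) y := by
  have h : HasDerivAt (fun y : ℝ => -y / (2 * τ)) (-1 / (2 * τ)) y := by
    simpa using ((hasDerivAt_id y).neg.div_const (2 * τ))
  refine (h.mul (hasDerivAt_heatK0 hτ y)).congr_deriv ?_
  unfold heatK2 heatK1
  field_simp
  ring

lemma hasDerivAt_heatK0_time {τ : ℝ} (hτ : 0 < τ) (y : ℝ) :
    HasDerivAt (fun τ => heatK0 τ y) (heatK2 τ y) τ := by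
  have h : HasDerivAt (fun τ : ℝ => -y ^ 2 / (4 * τ)) (y ^ 2 / (4 * τ ^ 2)) τ := by
    have := ((hasDerivAt_id τ).const_mul 4).inv (by simp; positivity)
    refine (this.const_mul (-y ^ 2)).congr_deriv ?_ |>.congr_of_eventuallyEq ?_
    · simp; field_simp; 
    · exact .of_forall fun s => by simp [div_eq_mul_inv]
  have h2 : HasDerivAt (fun τ : ℝ => (√τ)⁻¹) (-(1 / (2 * √τ)) / (√τ) ^ 2) τ :=
    ((Real.hasDerivAt_sqrt hτ.ne').inv (by positivity))
  refine ((h2.const_mul (√(4 * Real.pi))⁻¹).mul h.exp).congr_deriv ?_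
  unfold heatK2 heatK0
  have : 0 < √τ := by positivity
  have e : √τ ^ 2 = τ := Real.sq_sqrt hτ.le
  have hpi : 0 < √(4 * Real.pi) := by positivity
  generalize √(4 * Real.pi) = c at *
  rw [e]
  field_simp
  ring

lemma continuous_heatK0 (τ : ℝ) : Continuous (heatK0 τ) := by
  unfold heatK0; fun_prop

lemma continuous_heatK1 (τ : ℝ) : Continuous (heatK1 τ) := by
  unfold heatK1; have := continuous_heatK0 τ; fun_prop

lemma continuous_heatK2 (τ : ℝ) : Continuous (heatK2 τ) := by
  unfold heatK2; have := continuous_heatK0 τ; fun_prop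

lemma heatK0_scale {τ : ℝ} (hτ : 0 < τ) (y : ℝ) :
    heatK0 τ y = (√τ)⁻¹ * heatK0 1 (y / √τ) := by
  unfold heatK0
  rw [div_pow, Real.sq_sqrt hτ.le]
  have : -(y ^ 2 / τ) / (4 * 1) = -y ^ 2 / (4 * τ) := by field_simp
  rw [this]; simp; ring

lemma heatK1_scale {τ : ℝ} (hτ : 0 < τ) (y : ℝ) :
    heatK1 τ y = (√τ)⁻¹ * ((√τ)⁻¹ * heatK1 1 (y / √τ)) := by
  unfold heatK1
  rw [heatK0_scale hτ]
  have h : 0 < √τ := by positivity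
  have e : τ = √τ ^ 2 := (Real.sq_sqrt hτ.le).symm
  generalize √τ = r at *
  subst e
  field_simp

lemma heatK2_scale {τ : ℝ} (hτ : 0 < τ) (y : ℝ) :
    heatK2 τ y = τ⁻¹ * ((√τ)⁻¹ * heatK2 1 (y / √τ)) := by
  unfold heatK2
  rw [heatK0_scale hτ]
  have h : 0 < √τ := by positivity
  have e : τ = √τ ^ 2 := (Real.sq_sqrt hτ.le).symm
  generalize √τ = r at *
  subst e
  field_simp

/-- A Gaussian bound for a profile. -/
def GaussBdd (η : ℝ → ℝ) : Prop := Continuous η ∧ ∃ C, ∀ z, |η z| ≤ C * Real.exp (-(1 / 8) * z ^ 2)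

lemma heatK0_one (z : ℝ) :
    heatK0 1 z = (√(4 * Real.pi))⁻¹ * Real.exp (-(1 / 4) * z ^ 2) := by
  unfold heatK0; simp; left; ring

lemma sqrt_four_pi_ge_one : 1 ≤ √(4 * Real.pi) := by
  rw [Real.one_le_sqrt]; nlinarith [Real.pi_gt_three]

lemma exp_quarter_le (z : ℝ) :
    Real.exp (-(1 / 4) * z ^ 2) * (1 + z ^ 2 / 8) ≤ Real.exp (-(1 / 8) * z ^ 2) := by
  have h1 : 1 + z ^ 2 / 8 ≤ Real.exp (z ^ 2 / 8) := by linarith [Real.add_one_le_exp (z ^ 2 / 8)]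
  calc _ ≤ Real.exp (-(1 / 4) * z ^ 2) * Real.exp (z ^ 2 / 8) := by gcongr
    _ = _ := by rw [← Real.exp_add]; ring_nf

lemma gaussBdd_poly {P : ℝ → ℝ} (hP : Continuous P) {A : ℝ} (hA : ∀ z, |P z| ≤ A * (1 + z ^ 2 / 8)) :
    GaussBdd (fun z => P z * heatK0 1 z) := by
  refine ⟨hP.mul (continuous_heatK0 1), A, fun z => ?_⟩
  have hA0 : 0 ≤ A := by have := (abs_nonneg _).trans (hA 0); simpa using this
  have h0 : |heatK0 1 z| ≤ Real.exp (-(1 / 4) * z ^ 2) := by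
    rw [heatK0_one, abs_of_nonneg (by positivity)]
    have := inv_le_one_of_one_le₀ sqrt_four_pi_ge_one
    nlinarith [Real.exp_pos (-(1 / 4) * z ^ 2)]
  rw [abs_mul]
  calc _ ≤ (A * (1 + z ^ 2 / 8)) * Real.exp (-(1 / 4) * z ^ 2) :=
        mul_le_mul (hA z) h0 (abs_nonneg _) (by positivity)
    _ ≤ A * Real.exp (-(1 / 8) * z ^ 2) := by
        have := mul_le_mul_of_nonneg_left (exp_quarter_le z) hA0
        linarith

lemma gaussBdd_heatK0 : GaussBdd (heatK0 1) := by
  have := gaussBdd_poly (P := fun _ => 1) continuous_const (A := 1) (fun z => by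
    rw [abs_one]; nlinarith [sq_nonneg z])
  simpa using this

lemma gaussBdd_heatK1 : GaussBdd (heatK1 1) := by
  refine gaussBdd_poly (P := fun z => -z / (2 * 1)) (by fun_prop) (A := 2) (fun z => ?_)
  rw [abs_le]; constructor <;> nlinarith [sq_nonneg (z - 1), sq_nonneg (z + 1)]

lemma gaussBdd_heatK2 : GaussBdd (heatK2 1) := by
  refine gaussBdd_poly (P := fun z => z ^ 2 / (4 * 1 ^ 2) - 1 / (2 * 1)) (by fun_prop) (A := 2)
    (fun z => ?_)
  rw [abs_le]; constructor <;> nlinarith [sq_nonneg z]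

lemma integrable_exp_eighth : Integrable fun z : ℝ => Real.exp (-(1 / 8) * z ^ 2) :=
  integrable_exp_neg_mul_sq (by norm_num)

lemma GaussBdd.integrable {η : ℝ → ℝ} (h : GaussBdd η) : Integrable η := by
  obtain ⟨hc, C, hC⟩ := h
  exact (integrable_exp_eighth.const_mul C).mono' hc.aestronglyMeasurable (.of_forall hC)

lemma GaussBdd.integrable_mul_sqrt {η : ℝ → ℝ} (h : GaussBdd η) :
    Integrable fun z => |η z| * √|z| := by
  obtain ⟨hc, C, hC⟩ := h
  have hC0 : 0 ≤ C := by simpa using (abs_nonneg _).trans (hC 0)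
  have h1 : Integrable fun z : ℝ => Real.exp (-(1 / 16) * z ^ 2) :=
    integrable_exp_neg_mul_sq (by norm_num)
  refine (h1.const_mul (C * 17)).mono' (by fun_prop) (.of_forall fun z => ?_)
  rw [Real.norm_of_nonneg (by positivity)]
  have hs : √|z| ≤ 1 + z ^ 2 := by
    rw [Real.sqrt_le_left (by positivity)]
    have := sq_abs z
    nlinarith [sq_nonneg (|z| - 1), abs_nonneg z, sq_nonneg (z^2)]
  have h2 : 1 + z ^ 2 ≤ 17 * Real.exp ((1 / 16) * z ^ 2) := by
    nlinarith [Real.add_one_le_exp ((1 / 16) * z ^ 2), sq_nonneg z,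
      Real.one_le_exp (show 0 ≤ (1 / 16) * z ^ 2 by positivity)]
  calc |η z| * √|z| ≤ (C * Real.exp (-(1 / 8) * z ^ 2)) * (17 * Real.exp ((1 / 16) * z ^ 2)) :=
        mul_le_mul (hC z) (hs.trans h2) (by positivity) (by positivity)
    _ = C * 17 * (Real.exp (-(1 / 8) * z ^ 2) * Real.exp ((1 / 16) * z ^ 2)) := by ring
    _ = _ := by rw [← Real.exp_add]; ring_nf

lemma integral_heatK0 : ∫ z, heatK0 1 z = 1 := by
  simp_rw [heatK0_one]
  rw [integral_const_mul, integral_gaussian]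
  have : Real.pi / (1 / 4) = 4 * Real.pi := by ring
  rw [this]
  exact inv_mul_cancel₀ (by positivity)

lemma integral_heatK2 : ∫ z, heatK2 1 z = 0 :=
  integral_eq_zero_of_hasDerivAt_of_integrable (fun z => hasDerivAt_heatK1 one_pos z)
    gaussBdd_heatK2.integrable gaussBdd_heatK1.integrable

/-- Change of variables `y = x - r z`. -/
lemma scaleAvg_eq {η g : ℝ → ℝ} {r : ℝ} (hr : 0 < r) (x : ℝ) :
    scaleAvg η r g x = ∫ y, (r⁻¹ * η ((x - y) / r)) * g y := by
  unfold scaleAvg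
  rw [← integral_sub_left_eq_self (fun y => r⁻¹ * η ((x - y) / r) * g y) volume x]
  have := Measure.integral_comp_mul_left
    (fun y => r⁻¹ * η ((x - (x - y)) / r) * g (x - y)) r
  rw [abs_of_pos (inv_pos.2 hr), smul_eq_mul, eq_comm, inv_mul_eq_iff_eq_mul₀ hr.ne'] at this
  rw [this, ← integral_const_mul]
  congr 1; ext z
  have : (x - (x - r * z)) / r = z := by field_simp; ring
  rw [this]; field_simp

lemma GaussBdd.scaleAvg_bound {η g : ℝ → ℝ} (h : GaussBdd η) {M : ℝ} (hM : ∀ y, |g y| ≤ M)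
    (r x : ℝ) : |scaleAvg η r g x| ≤ (∫ z, |η z|) * M := by
  rw [← integral_mul_const, ← Real.norm_eq_abs]
  refine norm_integral_le_of_norm_le (h.integrable.abs.mul_const M) (.of_forall fun z => ?_)
  rw [norm_mul]; exact mul_le_mul_of_nonneg_left (hM _) (abs_nonneg _)

lemma scaleAvg_heatK2_bound {g : ℝ → ℝ} (hg : Measurable g) {M H x : ℝ} (hM : ∀ y, |g y| ≤ M)
    (hH : ∀ y, |g y - g x| ≤ H * √|x - y|) {r : ℝ} (hr : 0 ≤ r) :
    |scaleAvg (heatK2 1) r g x| ≤ H * √r * ∫ z, |heatK2 1 z| * √|z| := by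
  have hi : Integrable fun z => heatK2 1 z * g (x - r * z) :=
    gaussBdd_heatK2.integrable.mul_bdd (c := M) (hg.comp (by fun_prop)).aestronglyMeasurable
      (.of_forall fun z => hM _)
  have : scaleAvg (heatK2 1) r g x = ∫ z, heatK2 1 z * (g (x - r * z) - g x) := by
    simp_rw [mul_sub]
    rw [integral_sub hi (gaussBdd_heatK2.integrable.mul_const _), integral_mul_const,
      integral_heatK2]
    simp [scaleAvg]
  rw [this, ← integral_const_mul, ← Real.norm_eq_abs]
  refine norm_integral_le_of_norm_le ((gaussBdd_heatK2.integrable_mul_sqrt).const_mul _)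
    (.of_forall fun z => ?_)
  rw [norm_mul, Real.norm_eq_abs, Real.norm_eq_abs]
  have := hH (x - r * z)
  rw [sub_sub_cancel, abs_mul, abs_of_nonneg hr, Real.sqrt_mul hr] at this
  calc _ ≤ |heatK2 1 z| * (H * (√r * √|z|)) := by gcongr
    _ = _ := by ring

lemma scaleAvg_heatK0 {τ : ℝ} (hτ : 0 < τ) (g : ℝ → ℝ) (x : ℝ) :
    scaleAvg (heatK0 1) √τ g x = ∫ y, heatK0 τ (x - y) * g y := by
  rw [scaleAvg_eq (Real.sqrt_pos.2 hτ)]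
  simp_rw [heatK0_scale hτ]

lemma scaleAvg_heatK1 {τ : ℝ} (hτ : 0 < τ) (g : ℝ → ℝ) (x : ℝ) :
    (√τ)⁻¹ * scaleAvg (heatK1 1) √τ g x = ∫ y, heatK1 τ (x - y) * g y := by
  rw [scaleAvg_eq (Real.sqrt_pos.2 hτ), ← integral_const_mul]
  simp_rw [heatK1_scale hτ, mul_assoc]

lemma scaleAvg_heatK2 {τ : ℝ} (hτ : 0 < τ) (g : ℝ → ℝ) (x : ℝ) :
    τ⁻¹ * scaleAvg (heatK2 1) √τ g x = ∫ y, heatK2 τ (x - y) * g y := by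
  rw [scaleAvg_eq (Real.sqrt_pos.2 hτ), ← integral_const_mul]
  simp_rw [heatK2_scale hτ, mul_assoc]

lemma GaussBdd.scaled {η : ℝ → ℝ} (h : GaussBdd η) :
    ∃ C, 0 ≤ C ∧ ∀ τ > 0, ∀ y, |η (y / √τ)| ≤ C * Real.exp (-y ^ 2 / (8 * τ)) := by
  obtain ⟨-, C, hC⟩ := h
  refine ⟨C, by simpa using (abs_nonneg _).trans (hC 0), fun τ hτ y => (hC _).trans_eq ?_⟩
  rw [div_pow, Real.sq_sqrt hτ.le]
  congr 2; field_simp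

lemma exp_window {a b τ y : ℝ} (ha : 0 < a) (h1 : a ≤ τ) (h2 : τ ≤ b) :
    Real.exp (-y ^ 2 / (8 * τ)) ≤ Real.exp (-y ^ 2 / (8 * b)) := by
  have hτ : 0 < τ := ha.trans_le h1
  rw [Real.exp_le_exp, neg_div, neg_div, neg_le_neg_iff]
  gcongr

lemma heatK1_window {a b : ℝ} (ha : 0 < a) :
    ∃ B, ∀ τ ∈ Icc a b, ∀ y, |heatK1 τ y| ≤ B * Real.exp (-y ^ 2 / (8 * b)) := by
  obtain ⟨C, hC0, hC⟩ := gaussBdd_heatK1.scaled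
  refine ⟨(√a)⁻¹ * ((√a)⁻¹ * C), fun τ hτ y => ?_⟩
  have hτ0 : 0 < τ := ha.trans_le hτ.1
  have hs : (√τ)⁻¹ ≤ (√a)⁻¹ := by
    have := Real.sqrt_le_sqrt hτ.1
    have := Real.sqrt_pos.2 ha
    gcongr
  rw [heatK1_scale hτ0, abs_mul, abs_mul, abs_of_nonneg (by positivity : 0 ≤ (√τ)⁻¹), mul_assoc,
    mul_assoc]
  have := (hC τ hτ0 y).trans (mul_le_mul_of_nonneg_left (exp_window ha hτ.1 hτ.2) hC0)
  gcongr

lemma heatK2_window {a b : ℝ} (ha : 0 < a) :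
    ∃ B, ∀ τ ∈ Icc a b, ∀ y, |heatK2 τ y| ≤ B * Real.exp (-y ^ 2 / (8 * b)) := by
  obtain ⟨C, hC0, hC⟩ := gaussBdd_heatK2.scaled
  refine ⟨a⁻¹ * ((√a)⁻¹ * C), fun τ hτ y => ?_⟩
  have hτ0 : 0 < τ := ha.trans_le hτ.1
  have hs : (√τ)⁻¹ ≤ (√a)⁻¹ := by
    have := Real.sqrt_le_sqrt hτ.1
    have := Real.sqrt_pos.2 ha
    gcongr
  have hs' : τ⁻¹ ≤ a⁻¹ := by have := hτ.1; gcongr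
  rw [heatK2_scale hτ0, abs_mul, abs_mul, abs_of_nonneg (by positivity : 0 ≤ (√τ)⁻¹),
    abs_of_nonneg (by positivity : 0 ≤ τ⁻¹), mul_assoc, mul_assoc]
  have := (hC τ hτ0 y).trans (mul_le_mul_of_nonneg_left (exp_window ha hτ.1 hτ.2) hC0)
  gcongr

lemma exp_shift {b x x' y : ℝ} (hb : 0 < b) (h : |x' - x| ≤ 1) :
    Real.exp (-(x' - y) ^ 2 / (8 * b)) ≤
      Real.exp (1 / (8 * b)) * Real.exp (-(1 / (16 * b)) * (x - y) ^ 2) := by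
  rw [← Real.exp_add, Real.exp_le_exp]
  have h1 : (x' - x) ^ 2 ≤ 1 := by rw [sq_le_one_iff_abs_le_one]; exact h
  have h2 : (x - y) ^ 2 ≤ 2 * (x' - y) ^ 2 + 2 := by nlinarith [sq_nonneg ((x' - y) + (x' - x))]
  have : 1 / (8 * b) + -(1 / (16 * b)) * (x - y) ^ 2 - (-(x' - y) ^ 2 / (8 * b))
      = (2 + 2 * (x' - y) ^ 2 - (x - y) ^ 2) / (16 * b) := by field_simp; ring
  have h3 : 0 ≤ (2 + 2 * (x' - y) ^ 2 - (x - y) ^ 2) / (16 * b) :=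
    div_nonneg (by linarith) (by positivity)
  linarith

lemma integrable_exp_center {b : ℝ} (hb : 0 < b) (x c : ℝ) :
    Integrable fun y : ℝ => c * Real.exp (-(1 / (16 * b)) * (x - y) ^ 2) := by
  have : Integrable fun z : ℝ => Real.exp (-(1 / (16 * b)) * z ^ 2) :=
    integrable_exp_neg_mul_sq (by positivity)
  exact (this.comp_sub_left x).const_mul c

/-- Differentiation in `x` of a convolution with a Gaussian-bounded kernel. -/
lemma hasDerivAt_convolution {k k' : ℝ → ℝ} {b B : ℝ} (hb : 0 < b)
    (hk : ∀ y, HasDerivAt k (k' y) y) (hk'c : Continuous k')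
    (hB : ∀ y, |k' y| ≤ B * Real.exp (-y ^ 2 / (8 * b))) {B₀ : ℝ}
    (hB₀ : ∀ y, |k y| ≤ B₀ * Real.exp (-y ^ 2 / (8 * b)))
    {g : ℝ → ℝ} (hg : Measurable g) {M : ℝ} (hM : ∀ y, |g y| ≤ M) (x : ℝ) :
    HasDerivAt (fun x => ∫ y, k (x - y) * g y) (∫ y, k' (x - y) * g y) x := by
  have hM0 : 0 ≤ M := (abs_nonneg _).trans (hM 0)
  have hB0 : 0 ≤ B := by simpa using (abs_nonneg _).trans (hB 0)
  have hB00 : 0 ≤ B₀ := by simpa using (abs_nonneg _).trans (hB₀ 0)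
  have hkc : Continuous k := continuous_iff_continuousAt.2 fun y => (hk y).continuousAt
  have key : ∀ (l : ℝ → ℝ) (B : ℝ), 0 ≤ B → (∀ y, |l y| ≤ B * Real.exp (-y ^ 2 / (8 * b))) →
      ∀ x' ∈ closedBall x 1, ∀ y, ‖l (x' - y) * g y‖ ≤
        B * Real.exp (1 / (8 * b)) * M * Real.exp (-(1 / (16 * b)) * (x - y) ^ 2) := by
    intro l B hB0 hl x' hx' y
    rw [norm_mul]
    have h1 := (hl (x' - y)).trans (mul_le_mul_of_nonneg_left
      (exp_shift (y := y) hb (by simpa [Real.dist_eq] using hx')) hB0)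
    calc _ ≤ (B * (Real.exp (1 / (8 * b)) * Real.exp (-(1 / (16 * b)) * (x - y) ^ 2))) * M :=
          mul_le_mul h1 (hM y) (abs_nonneg _) (by positivity)
      _ = _ := by ring
  refine (hasDerivAt_integral_of_dominated_loc_of_deriv_le (𝕜 := ℝ) (E := ℝ) (μ := volume)
    (F := fun x y => k (x - y) * g y) (F' := fun x y => k' (x - y) * g y) (s := closedBall x 1)
    (bound := fun y => B * Real.exp (1 / (8 * b)) * M * Real.exp (-(1 / (16 * b)) * (x - y) ^ 2))
    (closedBall_mem_nhds x one_pos) ?_ ?_ ?_ ?_ ?_ ?_).2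
  · exact .of_forall fun x => (Measurable.mul (by fun_prop) hg).aestronglyMeasurable
  · exact (integrable_exp_center hb x _).mono'
      (Measurable.mul (by fun_prop) hg).aestronglyMeasurable
      (.of_forall (key k B₀ hB00 hB₀ x (mem_closedBall_self zero_le_one)))
  · exact (Measurable.mul (by fun_prop) hg).aestronglyMeasurable
  · exact .of_forall fun y x' hx' => key k' B hB0 hB x' hx' y
  · exact integrable_exp_center hb x _
  · refine .of_forall fun y x' _ => HasDerivAt.mul_const ?_ _
    simpa [Function.comp_def] using (hk (x' - y)).comp x' ((hasDerivAt_id x').sub_const y)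

lemma heatK0_window {a b : ℝ} (ha : 0 < a) :
    ∃ B, ∀ τ ∈ Icc a b, ∀ y, |heatK0 τ y| ≤ B * Real.exp (-y ^ 2 / (8 * b)) := by
  obtain ⟨C, hC0, hC⟩ := gaussBdd_heatK0.scaled
  refine ⟨(√a)⁻¹ * C, fun τ hτ y => ?_⟩
  have hτ0 : 0 < τ := ha.trans_le hτ.1
  have hs : (√τ)⁻¹ ≤ (√a)⁻¹ := by
    have := Real.sqrt_le_sqrt hτ.1
    have := Real.sqrt_pos.2 ha
    gcongr
  rw [heatK0_scale hτ0, abs_mul, abs_of_nonneg (by positivity : 0 ≤ (√τ)⁻¹), mul_assoc]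
  have := (hC τ hτ0 y).trans (mul_le_mul_of_nonneg_left (exp_window ha hτ.1 hτ.2) hC0)
  gcongr

section
variable {g : ℝ → ℝ} {M τ : ℝ}

lemma hasDerivAt_heat_space (hg : Measurable g) (hM : ∀ y, |g y| ≤ M) (hτ : 0 < τ) (x : ℝ) :
    HasDerivAt (fun x => scaleAvg (heatK0 1) √τ g x) ((√τ)⁻¹ * scaleAvg (heatK1 1) √τ g x) x := by
  simp_rw [scaleAvg_heatK0 hτ, scaleAvg_heatK1 hτ]
  obtain ⟨B, hB⟩ := heatK1_window (b := τ) hτ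
  obtain ⟨B', hB'⟩ := heatK0_window (b := τ) hτ
  exact hasDerivAt_convolution hτ (hasDerivAt_heatK0 hτ) (continuous_heatK1 τ)
    (hB τ ⟨le_rfl, le_rfl⟩) (hB' τ ⟨le_rfl, le_rfl⟩) hg hM x

lemma hasDerivAt_heat_space' (hg : Measurable g) (hM : ∀ y, |g y| ≤ M) (hτ : 0 < τ) (x : ℝ) :
    HasDerivAt (fun x => (√τ)⁻¹ * scaleAvg (heatK1 1) √τ g x)
      (τ⁻¹ * scaleAvg (heatK2 1) √τ g x) x := by
  simp_rw [scaleAvg_heatK2 hτ, scaleAvg_heatK1 hτ]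
  obtain ⟨B, hB⟩ := heatK2_window (b := τ) hτ
  obtain ⟨B', hB'⟩ := heatK1_window (b := τ) hτ
  exact hasDerivAt_convolution hτ (hasDerivAt_heatK1 hτ) (continuous_heatK2 τ)
    (hB τ ⟨le_rfl, le_rfl⟩) (hB' τ ⟨le_rfl, le_rfl⟩) hg hM x

lemma hasDerivAt_heat_time (hg : Measurable g) (hM : ∀ y, |g y| ≤ M) (hτ : 0 < τ) (x : ℝ) :
    HasDerivAt (fun τ => scaleAvg (heatK0 1) √τ g x) (τ⁻¹ * scaleAvg (heatK2 1) √τ g x) τ := by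
  rw [scaleAvg_heatK2 hτ]
  have hev : (fun τ => scaleAvg (heatK0 1) √τ g x) =ᶠ[𝓝 τ]
      fun τ => ∫ y, heatK0 τ (x - y) * g y := by
    filter_upwards [lt_mem_nhds hτ] with s hs using scaleAvg_heatK0 hs g x
  refine HasDerivAt.congr_of_eventuallyEq ?_ hev
  have hM0 : 0 ≤ M := (abs_nonneg _).trans (hM 0)
  obtain ⟨B, hB⟩ := heatK2_window (a := τ / 2) (b := 2 * τ) (by positivity)
  obtain ⟨B', hB'⟩ := heatK0_window (a := τ / 2) (b := 2 * τ) (by positivity)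
  have hmem : Icc (τ / 2) (2 * τ) ∈ 𝓝 τ := Icc_mem_nhds (by linarith) (by linarith)
  have hτm : τ ∈ Icc (τ / 2) (2 * τ) := ⟨by linarith, by linarith⟩
  have hB0 : 0 ≤ B := by simpa using (abs_nonneg _).trans (hB τ hτm 0)
  have hB0' : 0 ≤ B' := by simpa using (abs_nonneg _).trans (hB' τ hτm 0)
  have key : ∀ (l : ℝ → ℝ) (B : ℝ), 0 ≤ B →
      (∀ y, |l y| ≤ B * Real.exp (-y ^ 2 / (8 * (2 * τ)))) →
      ∀ y, ‖l (x - y) * g y‖ ≤ B * M * Real.exp (-(1 / (16 * τ)) * (x - y) ^ 2) := by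
    intro l B hB0 hl y
    rw [norm_mul]
    have e : -(x - y) ^ 2 / (8 * (2 * τ)) = -(1 / (16 * τ)) * (x - y) ^ 2 := by
      field_simp; ring
    have h1 := hl (x - y)
    rw [e] at h1
    calc _ ≤ (B * Real.exp (-(1 / (16 * τ)) * (x - y) ^ 2)) * M :=
          mul_le_mul h1 (hM y) (abs_nonneg _) (by positivity)
      _ = _ := by ring
  have hc0 := continuous_heatK0
  have hc2 := continuous_heatK2
  refine (hasDerivAt_integral_of_dominated_loc_of_deriv_le (𝕜 := ℝ) (E := ℝ) (μ := volume)
    (F := fun s y => heatK0 s (x - y) * g y) (F' := fun s y => heatK2 s (x - y) * g y)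
    (s := Icc (τ / 2) (2 * τ))
    (bound := fun y => B * M * Real.exp (-(1 / (16 * τ)) * (x - y) ^ 2))
    hmem ?_ ?_ ?_ ?_ ?_ ?_).2
  · exact .of_forall fun s => (Measurable.mul
      ((hc0 s).measurable.comp (by fun_prop)) hg).aestronglyMeasurable
  · exact (integrable_exp_center hτ x _).mono'
      (Measurable.mul ((hc0 τ).measurable.comp (by fun_prop)) hg).aestronglyMeasurable
      (.of_forall (key _ B' hB0' (hB' τ hτm)))
  · exact (Measurable.mul ((hc2 τ).measurable.comp (by fun_prop)) hg).aestronglyMeasurable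
  · exact .of_forall fun y s hs => key _ B hB0 (hB s hs) y
  · exact integrable_exp_center hτ x _
  · exact .of_forall fun y s hs =>
      (hasDerivAt_heatK0_time (lt_of_lt_of_le (by positivity) hs.1) _).mul_const _

end

/-- A bounded source term, continuous off a countable set of spatial positions. -/
structure IsSource (f : ℝ → ℝ → ℝ) (M : ℝ) : Prop where
  meas : ∀ s, Measurable fun y => f y s
  bdd : ∀ y s, |f y s| ≤ M
  cont : ∃ S : Set ℝ, S.Countable ∧ ∀ y ∉ S, ∀ s,
    ContinuousAt (fun q : ℝ × ℝ => f q.1 q.2) (y, s)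

lemma IsSource.continuousAt_scaleAvg {f : ℝ → ℝ → ℝ} {M : ℝ} (hf : IsSource f M) {η : ℝ → ℝ}
    (hη : GaussBdd η) {α : Type*} [TopologicalSpace α] [FirstCountableTopology α]
    {r x s : α → ℝ} {a : α} (hr : ContinuousAt r a) (hx : ContinuousAt x a)
    (hs : ContinuousAt s a) (ha : r a ≠ 0) :
    ContinuousAt (fun b => scaleAvg η (r b) (fun y => f y (s b)) (x b)) a := by
  obtain ⟨S, hS, hc⟩ := hf.cont
  refine continuousAt_of_dominated (bound := fun z => |η z| * M) ?_ ?_ ?_ ?_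
  · exact .of_forall fun b => (hη.1.measurable.mul
      ((hf.meas (s b)).comp (by fun_prop))).aestronglyMeasurable
  · refine .of_forall fun b => .of_forall fun z => ?_
    rw [norm_mul]
    exact mul_le_mul_of_nonneg_left (hf.bdd _ _) (abs_nonneg _)
  · exact hη.integrable.abs.mul_const M
  · have hn : {z | x a - r a * z ∈ S}.Countable :=
      hS.preimage fun z z' h => by simpa [ha] using h
    filter_upwards [hn.ae_notMem volume] with z hz
    have h1 : ContinuousAt (fun b => (x b - r b * z, s b)) a :=
      (hx.sub (hr.mul_const z)).prodMk hs
    exact continuousAt_const.mul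
      (ContinuousAt.comp (f := fun b => (x b - r b * z, s b))
        (g := fun q : ℝ × ℝ => f q.1 q.2) (hc _ hz _) h1)

lemma IsSource.abs_scaleAvg_le {f : ℝ → ℝ → ℝ} {M : ℝ} (hf : IsSource f M) {η : ℝ → ℝ}
    (hη : GaussBdd η) (r s x : ℝ) :
    |scaleAvg η r (fun y => f y s) x| ≤ (∫ z, |η z|) * M :=
  hη.scaleAvg_bound (fun y => hf.bdd y s) r x

/-- Joint continuity of integrals of Duhamel type. -/
lemma continuousAt_duhamel {α : Type*} [TopologicalSpace α] [FirstCountableTopology α]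
    {q : ℝ → α → ℝ} {t : α → ℝ} {a : α} {T : ℝ} {b : ℝ → ℝ}
    (ht : ContinuousAt t a) (h0 : 0 < t a) (hT : t a < T)
    (hb : IntegrableOn b (Ioo 0 T))
    (hq : ∀ᶠ c in 𝓝 a, ∀ τ ∈ Ioo 0 (t c), ‖q τ c‖ ≤ b τ)
    (hb0 : ∀ τ ∈ Ioo 0 T, 0 ≤ b τ)
    (hm : ∀ᶠ c in 𝓝 a, AEStronglyMeasurable (fun τ => q τ c) (volume.restrict (Ioo 0 (t c))))
    (hc : ∀ τ ∈ Ioo 0 (t a), ContinuousAt (q τ) a) :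
    ContinuousAt (fun c => ∫ τ in (0 : ℝ)..t c, q τ c) a := by
  have hpos : ∀ᶠ c in 𝓝 a, 0 < t c := ht.eventually (lt_mem_nhds h0)
  have hlt : ∀ᶠ c in 𝓝 a, t c < T := ht.eventually (gt_mem_nhds hT)
  have hev : (fun c => ∫ τ in (0 : ℝ)..t c, q τ c) =ᶠ[𝓝 a]
      fun c => ∫ τ in Ioo 0 T, (Ioo 0 (t c)).indicator (fun τ => q τ c) τ := by
    filter_upwards [hpos, hlt] with c h1 h2
    rw [intervalIntegral.integral_of_le h1.le, integral_Ioc_eq_integral_Ioo,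
      setIntegral_indicator measurableSet_Ioo,
      inter_eq_right.2 (Ioo_subset_Ioo_right h2.le)]
  refine ContinuousAt.congr ?_ hev.symm
  refine continuousAt_of_dominated (bound := b) ?_ ?_ hb ?_
  · filter_upwards [hm, hlt] with c h1 h2
    rw [aestronglyMeasurable_indicator_iff measurableSet_Ioo, Measure.restrict_restrict
      measurableSet_Ioo, inter_eq_left.2 (Ioo_subset_Ioo_right h2.le)]
    exact h1
  · filter_upwards [hq] with c h1
    refine (ae_restrict_iff' measurableSet_Ioo).2 (.of_forall fun τ hτ => ?_)
    by_cases h : τ ∈ Ioo 0 (t c)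
    · rw [indicator_of_mem h]; exact h1 τ h
    · rw [indicator_of_notMem h, norm_zero]; exact hb0 τ hτ
  · have : ∀ᵐ τ ∂volume.restrict (Ioo 0 T), τ ≠ t a :=
      (countable_singleton (t a)).ae_notMem _ |>.mono fun τ h => h
    filter_upwards [this, ae_restrict_mem measurableSet_Ioo] with τ h1 h2
    rcases lt_or_gt_of_ne h1 with h | h
    · have : q τ =ᶠ[𝓝 a] fun c => (Ioo 0 (t c)).indicator (fun τ => q τ c) τ := by
        filter_upwards [ht.eventually (lt_mem_nhds h)] with c h3
        rw [indicator_of_mem (show τ ∈ Ioo 0 (t c) from ⟨h2.1, h3⟩)]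
      exact (hc τ ⟨h2.1, h⟩).congr this
    · have : (fun _ => (0:ℝ)) =ᶠ[𝓝 a] fun c => (Ioo 0 (t c)).indicator (fun τ => q τ c) τ := by
        filter_upwards [ht.eventually (gt_mem_nhds h)] with c h3
        rw [indicator_of_notMem (fun h4 => absurd h4.2 (not_lt.2 (le_of_lt h3)))]
      exact continuousAt_const.congr this

/-- The folding map: the identity on `[-1,1]`, extended by reflection across odd integers. -/
def foldMap (x : ℝ) : ℝ := 2 / Real.pi * Real.arcsin (Real.sin (Real.pi * x / 2))

/-- The sign by which odd reflection across the odd integers multiplies a function. -/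
def foldSign (x : ℝ) : ℝ :=
  if 0 < Real.cos (Real.pi * x / 2) then 1 else if Real.cos (Real.pi * x / 2) < 0 then -1 else 0

lemma continuous_foldMap : Continuous foldMap := by
  unfold foldMap
  exact continuous_const.mul (Real.continuous_arcsin.comp (by fun_prop))

lemma foldMap_mem (x : ℝ) : foldMap x ∈ Icc (-1 : ℝ) 1 := by
  unfold foldMap
  have h1 := Real.neg_pi_div_two_le_arcsin (Real.sin (Real.pi * x / 2))
  have h2 := Real.arcsin_le_pi_div_two (Real.sin (Real.pi * x / 2))
  have := Real.pi_pos
  constructor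
  · rw [div_mul_eq_mul_div, le_div_iff₀ this]; linarith
  · rw [div_mul_eq_mul_div, div_le_iff₀ this]; linarith

lemma foldMap_of_mem {x : ℝ} (hx : x ∈ Icc (-1 : ℝ) 1) : foldMap x = x := by
  unfold foldMap
  have := Real.pi_pos
  rw [Real.arcsin_sin]
  · field_simp
  · nlinarith [hx.1]
  · nlinarith [hx.2]

lemma foldMap_two_sub (x : ℝ) : foldMap (2 - x) = foldMap x := by
  unfold foldMap
  rw [show Real.pi * (2 - x) / 2 = Real.pi - Real.pi * x / 2 by ring, Real.sin_pi_sub]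

lemma foldMap_neg_two_sub (x : ℝ) : foldMap (-2 - x) = foldMap x := by
  unfold foldMap
  rw [show Real.pi * (-2 - x) / 2 = -(Real.pi + Real.pi * x / 2) by ring, Real.sin_neg,
    add_comm, Real.sin_add_pi, neg_neg]

lemma foldSign_two_sub (x : ℝ) : foldSign (2 - x) = -foldSign x := by
  unfold foldSign
  rw [show Real.pi * (2 - x) / 2 = Real.pi - Real.pi * x / 2 by ring, Real.cos_pi_sub]
  rcases lt_trichotomy (Real.cos (Real.pi * x / 2)) 0 with h | h | h
  · simp [h, h.not_gt]
  · simp [h]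
  · simp [h, h.not_gt]

lemma foldSign_neg_two_sub (x : ℝ) : foldSign (-2 - x) = -foldSign x := by
  unfold foldSign
  rw [show Real.pi * (-2 - x) / 2 = -(Real.pi * x / 2 + Real.pi) by ring, Real.cos_neg,
    Real.cos_add_pi]
  rcases lt_trichotomy (Real.cos (Real.pi * x / 2)) 0 with h | h | h
  · simp [h, h.not_gt]
  · simp [h]
  · simp [h, h.not_gt]

lemma foldSign_of_mem {x : ℝ} (hx : x ∈ Ioo (-1 : ℝ) 1) : foldSign x = 1 := by
  unfold foldSign
  have := Real.pi_pos
  rw [if_pos (Real.cos_pos_of_mem_Ioo ⟨by nlinarith [hx.1], by nlinarith [hx.2]⟩)]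

lemma abs_foldSign_le (x : ℝ) : |foldSign x| ≤ 1 := by
  unfold foldSign; split_ifs <;> simp

lemma measurable_foldSign : Measurable foldSign := by
  have h : Measurable fun x : ℝ => Real.cos (Real.pi * x / 2) := by fun_prop
  exact Measurable.ite (measurableSet_lt measurable_const h) measurable_const
    (Measurable.ite (measurableSet_lt h measurable_const) measurable_const measurable_const)

lemma continuousAt_foldSign {x : ℝ} (hx : Real.cos (Real.pi * x / 2) ≠ 0) :
    ContinuousAt foldSign x := by
  have hc : ContinuousAt (fun x : ℝ => Real.cos (Real.pi * x / 2)) x := by fun_prop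
  rcases lt_or_gt_of_ne hx with h | h
  · refine (continuousAt_const (y := (-1 : ℝ))).congr ?_
    filter_upwards [hc.eventually (gt_mem_nhds h)] with y hy
    simp [foldSign, hy, hy.not_gt]
  · refine (continuousAt_const (y := (1 : ℝ))).congr ?_
    filter_upwards [hc.eventually (lt_mem_nhds h)] with y hy
    simp [foldSign, hy]

lemma countable_cos_zero : {x : ℝ | Real.cos (Real.pi * x / 2) = 0}.Countable := by
  refine (countable_range fun k : ℤ => (2 * k + 1 : ℝ)).mono fun x hx => ?_
  obtain ⟨k, hk⟩ := Real.cos_eq_zero_iff.1 hx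
  refine ⟨k, ?_⟩
  have := Real.pi_pos.ne'
  have h : Real.pi * x = Real.pi * (2 * k + 1) := by linarith
  exact (mul_left_cancel₀ this h).symm

/-- The oddly reflected source term `F(w)`. -/
def oddSource (F : ℝ → ℝ) (w : ℝ → ℝ → ℝ) (y s : ℝ) : ℝ := foldSign y * F (w (foldMap y) s)

lemma isSource_oddSource {F : ℝ → ℝ} (hF : Continuous F) {M : ℝ} (hM : ∀ a, |F a| ≤ M)
    {w : ℝ → ℝ → ℝ} (hw : Continuous fun q : ℝ × ℝ => w q.1 q.2) : IsSource (oddSource F w) M := by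
  have hc : Continuous fun q : ℝ × ℝ => F (w (foldMap q.1) q.2) :=
    hF.comp (hw.comp ((continuous_foldMap.comp continuous_fst).prodMk continuous_snd))
  refine ⟨fun s => ?_, fun y s => ?_, _, countable_cos_zero, fun y hy s => ?_⟩
  · exact measurable_foldSign.mul
      (hc.comp (continuous_id.prodMk continuous_const : Continuous fun y : ℝ => (y, s))).measurable
  · unfold oddSource
    rw [abs_mul]
    calc _ ≤ 1 * M := mul_le_mul (abs_foldSign_le y) (hM _) (abs_nonneg _) zero_le_one
      _ = M := one_mul M
  · exact ContinuousAt.mul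
      (ContinuousAt.comp (f := Prod.fst) (g := foldSign) (x := (y, s)) (continuousAt_foldSign hy)
        continuousAt_fst) hc.continuousAt

/-- Duhamel integral with weight `ω` and profile `η`. -/
def duhamel (ω η : ℝ → ℝ) (f : ℝ → ℝ → ℝ) (x t : ℝ) : ℝ :=
  ∫ τ in (0 : ℝ)..t, ω τ * scaleAvg η √τ (fun y => f y (t - τ)) x

section
variable {ω η : ℝ → ℝ} {f : ℝ → ℝ → ℝ} {M : ℝ}

lemma IsSource.continuousOn_duhamel_integrand (hf : IsSource f M) (hη : GaussBdd η)
    (hω : ContinuousOn ω (Ioi 0)) (x t : ℝ) :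
    ContinuousOn (fun τ => ω τ * scaleAvg η √τ (fun y => f y (t - τ)) x) (Ioi 0) := by
  intro τ hτ
  refine (hω τ hτ).mul (ContinuousAt.continuousWithinAt ?_)
  exact hf.continuousAt_scaleAvg hη (r := fun τ => √τ) (x := fun _ => x) (s := fun τ => t - τ)
    (by fun_prop) continuousAt_const (by fun_prop) (Real.sqrt_pos.2 hτ).ne'

lemma IsSource.nonneg (hf : IsSource f M) : 0 ≤ M := (abs_nonneg _).trans (hf.bdd 0 0)

lemma IsSource.norm_duhamel_integrand_le (hf : IsSource f M) (hη : GaussBdd η) (x t τ : ℝ) :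
    ‖ω τ * scaleAvg η √τ (fun y => f y (t - τ)) x‖ ≤ |ω τ| * ((∫ z, |η z|) * M) := by
  rw [norm_mul]
  exact mul_le_mul_of_nonneg_left (hf.abs_scaleAvg_le hη _ _ _) (abs_nonneg _)

lemma IsSource.continuousAt_duhamel' (hf : IsSource f M) (hη : GaussBdd η)
    (hω : ContinuousOn ω (Ioi 0)) (hi : ∀ T, IntegrableOn ω (Ioo 0 T)) {a : ℝ × ℝ}
    (ha : 0 < a.2) : ContinuousAt (fun c : ℝ × ℝ => duhamel ω η f c.1 c.2) a := by
  have hM := hf.nonneg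
  refine continuousAt_duhamel (T := a.2 + 1) (b := fun τ => |ω τ| * ((∫ z, |η z|) * M))
    (q := fun τ c => ω τ * scaleAvg η √τ (fun y => f y (c.2 - τ)) c.1)
    continuousAt_snd ha (by linarith)
    ((hi _).abs.mul_const _) (.of_forall fun c τ _ => hf.norm_duhamel_integrand_le hη _ _ _)
    (fun τ _ => by positivity) (.of_forall fun c => ?_) fun τ hτ => ?_
  · exact ((hf.continuousOn_duhamel_integrand hη hω _ _).mono Ioo_subset_Ioi_self
      ).aestronglyMeasurable measurableSet_Ioo
  · exact continuousAt_const.mul (hf.continuousAt_scaleAvg hη (r := fun _ => √τ)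
      continuousAt_const continuousAt_fst (by fun_prop) (Real.sqrt_pos.2 hτ.1).ne')

lemma IsSource.intervalIntegrable_duhamel (hf : IsSource f M) (hη : GaussBdd η)
    (hω : ContinuousOn ω (Ioi 0)) (hi : ∀ T, IntegrableOn ω (Ioo 0 T)) (x s t : ℝ) (ht : 0 ≤ t) :
    IntervalIntegrable (fun τ => ω τ * scaleAvg η √τ (fun y => f y (s - τ)) x) volume 0 t := by
  rw [intervalIntegrable_iff_integrableOn_Ioo_of_le ht]
  exact ((hi t).abs.mul_const _).mono'
    (((hf.continuousOn_duhamel_integrand hη hω _ _).mono Ioo_subset_Ioi_self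
      ).aestronglyMeasurable measurableSet_Ioo)
    (.of_forall fun τ => hf.norm_duhamel_integrand_le hη _ _ _)

lemma IsSource.abs_duhamel_le (hf : IsSource f M) (hη : GaussBdd η)
    (hi : ∀ T, IntegrableOn ω (Ioo 0 T)) (x t : ℝ) (ht : 0 ≤ t) :
    |duhamel ω η f x t| ≤ (∫ τ in (0 : ℝ)..t, |ω τ|) * ((∫ z, |η z|) * M) := by
  rw [← intervalIntegral.integral_mul_const]
  refine intervalIntegral.norm_integral_le_of_norm_le ht
    (.of_forall fun τ _ => hf.norm_duhamel_integrand_le hη _ _ _) ?_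
  rw [intervalIntegrable_iff_integrableOn_Ioo_of_le ht]
  exact (hi t).abs.mul_const _

end

lemma inv_sqrt_eq_rpow {τ : ℝ} (hτ : 0 ≤ τ) : (√τ)⁻¹ = τ ^ (-(1 / 2) : ℝ) := by
  rw [Real.sqrt_eq_rpow, Real.rpow_neg hτ]

lemma continuousOn_inv_sqrt : ContinuousOn (fun τ : ℝ => (√τ)⁻¹) (Ioi 0) :=
  Real.continuous_sqrt.continuousOn.inv₀ fun _ h => (Real.sqrt_pos.2 h).ne'

lemma integrableOn_rpow_Ioo {e : ℝ} (he : -1 < e) (T : ℝ) :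
    IntegrableOn (fun τ : ℝ => τ ^ e) (Ioo 0 T) := by
  rcases le_or_gt T 0 with h | h
  · simp [Ioo_eq_empty (not_lt.2 h)]
  · exact (intervalIntegrable_iff_integrableOn_Ioo_of_le h.le).1
      (intervalIntegral.intervalIntegrable_rpow' he)

lemma integrableOn_inv_sqrt (T : ℝ) : IntegrableOn (fun τ : ℝ => (√τ)⁻¹) (Ioo 0 T) :=
  (integrableOn_rpow_Ioo (by norm_num) T).congr_fun
    (fun _ h => (inv_sqrt_eq_rpow (le_of_lt h.1)).symm) measurableSet_Ioo

lemma integral_inv_sqrt {t : ℝ} (ht : 0 ≤ t) : ∫ τ in (0 : ℝ)..t, |(√τ)⁻¹| = 2 * √t := by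
  have : ∫ τ in (0 : ℝ)..t, |(√τ)⁻¹| = ∫ τ in (0 : ℝ)..t, τ ^ (-(1 / 2) : ℝ) := by
    refine intervalIntegral.integral_congr fun τ hτ => ?_
    rw [uIcc_of_le ht] at hτ
    rw [abs_of_nonneg (by positivity), inv_sqrt_eq_rpow hτ.1]
  rw [this, integral_rpow (Or.inl (by norm_num)), Real.sqrt_eq_rpow]
  norm_num
  ring

lemma continuous_scaleAvg {η g : ℝ → ℝ} (hη : GaussBdd η) (hg : Continuous g) {M : ℝ}
    (hM : ∀ y, |g y| ≤ M) : Continuous fun q : ℝ × ℝ => scaleAvg η q.1 g q.2 := by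
  refine continuous_of_dominated (bound := fun z => |η z| * M) ?_ ?_ ?_ ?_
  · exact fun b => (hη.1.mul (hg.comp (by fun_prop))).aestronglyMeasurable
  · refine fun b => .of_forall fun z => ?_
    rw [norm_mul]
    exact mul_le_mul_of_nonneg_left (hM _) (abs_nonneg _)
  · exact hη.integrable.abs.mul_const M
  · exact .of_forall fun z => continuous_const.mul (hg.comp (by fun_prop))

section

open scoped BoundedContinuousFunction

lemma continuous_duhamel_inv_sqrt {η : ℝ → ℝ} {f : ℝ → ℝ → ℝ} {M : ℝ} (hf : IsSource f M)
    (hη : GaussBdd η) :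
    Continuous fun c : ℝ × ℝ => duhamel (fun τ => (√τ)⁻¹) η f c.1 (max c.2 0) := by
  refine continuous_iff_continuousAt.2 fun a => ?_
  rcases lt_or_ge 0 a.2 with h | h
  · have h1 := hf.continuousAt_duhamel' (a := (a.1, max a.2 0)) hη continuousOn_inv_sqrt
      integrableOn_inv_sqrt (by simpa using h)
    exact ContinuousAt.comp (f := fun c : ℝ × ℝ => (c.1, max c.2 0)) h1 (by fun_prop)
  · have h0 : duhamel (fun τ => (√τ)⁻¹) η f a.1 (max a.2 0) = 0 := by
      rw [max_eq_right h]; simp [duhamel]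
    rw [ContinuousAt, h0]
    have hlim : Tendsto (fun c : ℝ × ℝ => 2 * √(max c.2 0) * ((∫ z, |η z|) * M)) (𝓝 a) (𝓝 0) := by
      have : Continuous fun c : ℝ × ℝ => 2 * √(max c.2 0) * ((∫ z, |η z|) * M) := by fun_prop
      have := this.tendsto a
      rwa [max_eq_right h, Real.sqrt_zero, mul_zero, zero_mul] at this
    refine squeeze_zero_norm (fun c => ?_) hlim
    have := hf.abs_duhamel_le hη integrableOn_inv_sqrt c.1 (max c.2 0) (le_max_right _ _)
    rwa [integral_inv_sqrt (le_max_right _ _)] at this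

lemma integral_inv_sqrt_exp_le {K t : ℝ} (hK : 0 < K) (ht : 0 ≤ t) :
    ∫ τ in (0 : ℝ)..t, (√τ)⁻¹ * Real.exp (-K * τ) ≤ √Real.pi / √K := by
  have hI := Real.integral_rpow_mul_exp_neg_mul_Ioi (a := 1 / 2) (by norm_num) hK
  have hint : IntegrableOn (fun τ : ℝ => τ ^ (1 / 2 - 1 : ℝ) * Real.exp (-(K * τ))) (Ioi 0) := by
    refine Integrable.of_integral_ne_zero ?_
    rw [hI]
    have := Real.Gamma_pos_of_pos (s := 1 / 2) (by norm_num)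
    positivity
  rw [intervalIntegral.integral_of_le ht]
  calc ∫ τ in Ioc 0 t, (√τ)⁻¹ * Real.exp (-K * τ)
      = ∫ τ in Ioc 0 t, τ ^ (1 / 2 - 1 : ℝ) * Real.exp (-(K * τ)) := by
        refine setIntegral_congr_fun measurableSet_Ioc fun τ hτ => ?_
        simp only [inv_sqrt_eq_rpow hτ.1.le]
        norm_num
    _ ≤ ∫ τ in Ioi 0, τ ^ (1 / 2 - 1 : ℝ) * Real.exp (-(K * τ)) := by
        refine setIntegral_mono_set hint ?_ (Ioc_subset_Ioi_self.eventuallyLE)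
        filter_upwards [ae_restrict_mem measurableSet_Ioi] with τ hτ
        have : (0:ℝ) < τ := hτ
        positivity
    _ = √Real.pi / √K := by
        rw [hI, Real.Gamma_one_half_eq, ← Real.sqrt_eq_rpow, one_div, Real.sqrt_inv]
        ring

/-- The mild formulation of `w_t = w_xx + (F(w))_x` under Neumann-type reflection. -/
lemma exists_mild {F : ℝ → ℝ} {L M : ℝ} (hL : ∀ a b, |F a - F b| ≤ L * |a - b|)
    (hM : ∀ a, |F a| ≤ M) {g : ℝ → ℝ} (hg : Continuous g) {G : ℝ} (hG : ∀ y, |g y| ≤ G) :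
    ∃ w : ℝ → ℝ → ℝ, (Continuous fun q : ℝ × ℝ => w q.1 q.2) ∧ ∀ x t, 0 ≤ t →
      w x t = scaleAvg (heatK0 1) √t g x +
        duhamel (fun τ => (√τ)⁻¹) (heatK1 1) (oddSource F w) x t := by
  have hL0 : 0 ≤ L := by have := (abs_nonneg _).trans (hL 1 0); simpa using this
  have hFc : Continuous F := by
    refine (LipschitzWith.of_dist_le_mul (K := ⟨L, hL0⟩) fun a b => ?_).continuous
    simp only [Real.dist_eq]; exact hL a b
  have hM0 : 0 ≤ M := (abs_nonneg _).trans (hM 0)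
  have hG0 : 0 ≤ G := (abs_nonneg _).trans (hG 0)
  set c0 : ℝ := ∫ z, |heatK0 1 z|
  set c1 : ℝ := ∫ z, |heatK1 1 z|
  have hc0 : 0 ≤ c0 := integral_nonneg fun z => abs_nonneg _
  have hc1 : 0 ≤ c1 := integral_nonneg fun z => abs_nonneg _
  set k : ℝ := 2 * (c1 * L * √Real.pi) + 1
  have hk : 0 < k := by positivity
  have hk1 : 1 ≤ k := by simp only [k]; linarith [show 0 ≤ c1 * L * √Real.pi by positivity]
  set K : ℝ := k ^ 2
  have hK : 0 < K := by positivity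
  have hK1 : 1 ≤ K := one_le_pow₀ hk1
  let un : ((ℝ × ℝ) →ᵇ ℝ) → ℝ → ℝ → ℝ := fun W x t => Real.exp (K * max t 0) * W (x, t)
  have hun : ∀ W, Continuous fun q : ℝ × ℝ => un W q.1 q.2 := fun W => by
    have := W.continuous
    simp only [un]; fun_prop
  have hs : ∀ W, IsSource (oddSource F (un W)) M := fun W => isSource_oddSource hFc hM (hun W)
  have hsq : ∀ t : ℝ, 0 ≤ t → Real.exp (-K * t) * √t ≤ 1 := fun t ht => by
    have h1 : √t ≤ 1 + t := by
      rw [Real.sqrt_le_left (by positivity)]; nlinarith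
    have h2 : √t ≤ Real.exp (K * t) := by
      have := Real.add_one_le_exp (K * t)
      nlinarith
    calc _ ≤ Real.exp (-K * t) * Real.exp (K * t) := by gcongr
      _ = 1 := by rw [← Real.exp_add]; simp
  let Φf : ((ℝ × ℝ) →ᵇ ℝ) → ℝ × ℝ → ℝ := fun W c =>
    Real.exp (-K * max c.2 0) * (scaleAvg (heatK0 1) √(max c.2 0) g c.1 +
      duhamel (fun τ => (√τ)⁻¹) (heatK1 1) (oddSource F (un W)) c.1 (max c.2 0))
  have hΦc : ∀ W, Continuous (Φf W) := fun W => by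
    have h1 : Continuous fun c : ℝ × ℝ => scaleAvg (heatK0 1) √(max c.2 0) g c.1 :=
      (continuous_scaleAvg gaussBdd_heatK0 hg hG).comp
        (f := fun c : ℝ × ℝ => (√(max c.2 0), c.1)) (by fun_prop)
    have h2 := continuous_duhamel_inv_sqrt (hs W) gaussBdd_heatK1
    exact Continuous.mul (by fun_prop) (h1.add h2)
  have hΦb : ∀ W c, ‖Φf W c‖ ≤ c0 * G + 2 * (c1 * M) := fun W c => by
    simp only [Φf]
    set t := max c.2 0
    have ht : 0 ≤ t := le_max_right _ _
    have h1 := gaussBdd_heatK0.scaleAvg_bound hG √t c.1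
    have h2 := (hs W).abs_duhamel_le gaussBdd_heatK1 integrableOn_inv_sqrt c.1 t ht
    rw [integral_inv_sqrt ht] at h2
    rw [norm_mul, Real.norm_of_nonneg (Real.exp_pos _).le]
    have h3 : Real.exp (-K * t) ≤ 1 := Real.exp_le_one_iff.2 (by nlinarith)
    calc _ ≤ Real.exp (-K * t) * (c0 * G + 2 * √t * (c1 * M)) := by
          gcongr
          exact (abs_add_le _ _).trans (add_le_add h1 h2)
      _ = Real.exp (-K * t) * (c0 * G) + 2 * (Real.exp (-K * t) * √t) * (c1 * M) := by ring
      _ ≤ 1 * (c0 * G) + 2 * 1 * (c1 * M) := by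
          have := hsq t ht
          gcongr
      _ = _ := by ring
  let Φ : ((ℝ × ℝ) →ᵇ ℝ) → ((ℝ × ℝ) →ᵇ ℝ) := fun W =>
    BoundedContinuousFunction.ofNormedAddCommGroup (Φf W) (hΦc W) _ (hΦb W)
  have hcon : ContractingWith (1 / 2) Φ := by
    refine ⟨by
      rw [← NNReal.coe_lt_coe]; norm_num, LipschitzWith.of_dist_le_mul fun W V => ?_⟩
    rw [BoundedContinuousFunction.dist_le (by positivity)]
    intro c
    change dist (Φf W c) (Φf V c) ≤ _
    simp only [Φf]
    set t := max c.2 0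
    have ht : 0 ≤ t := le_max_right _ _
    set d := dist W V
    have hd : 0 ≤ d := dist_nonneg
    have hdiff : ∀ s, 0 ≤ s → ∀ y,
        |oddSource F (un W) y s - oddSource F (un V) y s| ≤ L * (Real.exp (K * s) * d) := by
      intro s hs y
      unfold oddSource
      rw [← mul_sub, abs_mul]
      have h1 : |un W (foldMap y) s - un V (foldMap y) s| ≤ Real.exp (K * s) * d := by
        simp only [un]
        rw [max_eq_left hs, ← mul_sub, abs_mul, abs_of_pos (Real.exp_pos _)]
        gcongr
        exact BoundedContinuousFunction.dist_coe_le_dist (f := W) (g := V) (foldMap y, s)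
      calc _ ≤ 1 * (L * |un W (foldMap y) s - un V (foldMap y) s|) :=
            mul_le_mul (abs_foldSign_le y) (hL _ _) (abs_nonneg _) zero_le_one
        _ ≤ _ := by rw [one_mul]; gcongr
    have hsub : ∀ s, 0 ≤ s → ∀ r x,
        |scaleAvg (heatK1 1) r (fun y => oddSource F (un W) y s) x -
          scaleAvg (heatK1 1) r (fun y => oddSource F (un V) y s) x| ≤
          c1 * (L * (Real.exp (K * s) * d)) := by
      intro s hs' r x
      have e : scaleAvg (heatK1 1) r (fun y => oddSource F (un W) y s) x -
          scaleAvg (heatK1 1) r (fun y => oddSource F (un V) y s) x =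
          scaleAvg (heatK1 1) r
            (fun y => oddSource F (un W) y s - oddSource F (un V) y s) x := by
        unfold scaleAvg
        rw [← integral_sub]
        · simp_rw [mul_sub]
        · exact gaussBdd_heatK1.integrable.mul_bdd (c := M)
            (((hs W).meas s).comp (by fun_prop)).aestronglyMeasurable
            (.of_forall fun z => (hs W).bdd _ _)
        · exact gaussBdd_heatK1.integrable.mul_bdd (c := M)
            (((hs V).meas s).comp (by fun_prop)).aestronglyMeasurable
            (.of_forall fun z => (hs V).bdd _ _)
      rw [e]
      exact gaussBdd_heatK1.scaleAvg_bound (hdiff s hs') r x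
    have hD : |duhamel (fun τ => (√τ)⁻¹) (heatK1 1) (oddSource F (un W)) c.1 t -
        duhamel (fun τ => (√τ)⁻¹) (heatK1 1) (oddSource F (un V)) c.1 t| ≤
        Real.exp (K * t) * (c1 * L * d * (√Real.pi / √K)) := by
      unfold duhamel
      rw [← intervalIntegral.integral_sub
        ((hs W).intervalIntegrable_duhamel gaussBdd_heatK1 continuousOn_inv_sqrt
          integrableOn_inv_sqrt _ _ _ ht)
        ((hs V).intervalIntegrable_duhamel gaussBdd_heatK1 continuousOn_inv_sqrt
          integrableOn_inv_sqrt _ _ _ ht)]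
      have hbi : IntervalIntegrable (fun τ : ℝ => (√τ)⁻¹ * Real.exp (-K * τ)) volume 0 t := by
        have : IntervalIntegrable (fun τ : ℝ => (√τ)⁻¹) volume 0 t := by
          rw [intervalIntegrable_iff_integrableOn_Ioo_of_le ht]
          exact integrableOn_inv_sqrt t
        exact this.mul_continuousOn (by fun_prop)
      calc _ ≤ ∫ τ in (0 : ℝ)..t,
            (c1 * L * d * Real.exp (K * t)) * ((√τ)⁻¹ * Real.exp (-K * τ)) := by
            rw [← Real.norm_eq_abs]
            refine intervalIntegral.norm_integral_le_of_norm_le ht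
              (.of_forall fun τ hτ => ?_) (hbi.const_mul _)
            rw [← mul_sub, norm_mul, Real.norm_of_nonneg (by positivity : (0:ℝ) ≤ (√τ)⁻¹)]
            calc _ ≤ (√τ)⁻¹ * (c1 * (L * (Real.exp (K * (t - τ)) * d))) := by
                  gcongr
                  exact hsub (t - τ) (by linarith [hτ.2]) _ _
              _ = _ := by
                  rw [show K * (t - τ) = K * t + -K * τ by ring, Real.exp_add]; ring
        _ ≤ _ := by
            rw [intervalIntegral.integral_const_mul]
            calc _ ≤ c1 * L * d * Real.exp (K * t) * (√Real.pi / √K) := by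
                  gcongr
                  exact integral_inv_sqrt_exp_le hK ht
              _ = _ := by ring
    rw [Real.dist_eq, ← mul_sub, add_sub_add_left_eq_sub, abs_mul, abs_of_pos (Real.exp_pos _)]
    calc _ ≤ Real.exp (-K * t) * (Real.exp (K * t) * (c1 * L * d * (√Real.pi / √K))) := by
          gcongr
      _ = c1 * L * d * (√Real.pi / √K) := by
          rw [← mul_assoc, ← Real.exp_add]; simp
      _ = (c1 * L * √Real.pi) / k * d := by
          rw [Real.sqrt_sq hk.le]; ring
      _ ≤ 1 / 2 * d := by
          refine mul_le_mul_of_nonneg_right ?_ hd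
          rw [div_le_iff₀ hk]
          simp only [k]; linarith
      _ = _ := by simp
  set W := hcon.fixedPoint
  have hW : Φ W = W := hcon.fixedPoint_isFixedPt
  refine ⟨un W, hun W, fun x t ht => ?_⟩
  have h1 : W (x, t) = Φf W (x, t) := by
    conv_lhs => rw [← hW]
    rfl
  simp only [Φf, max_eq_left ht] at h1
  change Real.exp (K * max t 0) * W (x, t) = _
  rw [h1, max_eq_left ht, ← mul_assoc, ← Real.exp_add]
  simp

end

lemma holder_half_of_bounds {φ φ' : ℝ → ℝ} {A B : ℝ} (hφ : ∀ x, HasDerivAt φ (φ' x) x)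
    (hA : ∀ x, |φ x| ≤ A) (hB : ∀ x, |φ' x| ≤ B) (x y : ℝ) :
    |φ x - φ y| ≤ √(2 * A * B) * √|x - y| := by
  have hA0 : 0 ≤ A := (abs_nonneg _).trans (hA 0)
  have hB0 : 0 ≤ B := (abs_nonneg _).trans (hB 0)
  have h1 : |φ x - φ y| ≤ 2 * A := by
    have := abs_sub (φ x) (φ y)
    linarith [hA x, hA y]
  have h2 : |φ x - φ y| ≤ B * |x - y| := by
    have := convex_univ.norm_image_sub_le_of_norm_hasDerivWithin_le (f := φ) (f' := φ') (C := B)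
      (fun z _ => (hφ z).hasDerivWithinAt) (fun z _ => hB z) (mem_univ y) (mem_univ x)
    simpa using this
  rw [← Real.sqrt_mul (by positivity)]
  apply Real.le_sqrt_of_sq_le
  calc |φ x - φ y| ^ 2 = |φ x - φ y| * |φ x - φ y| := sq _
    _ ≤ 2 * A * (B * |x - y|) := mul_le_mul h1 h2 (abs_nonneg _) (by positivity)
    _ = _ := by ring

lemma inv_sqrt_mul_inv_sqrt {τ : ℝ} (hτ : 0 < τ) : √((√τ)⁻¹ * τ⁻¹) = τ ^ (-(3 / 4) : ℝ) := by
  rw [inv_sqrt_eq_rpow hτ.le, ← Real.rpow_neg_one, ← Real.rpow_add hτ, Real.sqrt_eq_rpow,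
    ← Real.rpow_mul hτ.le]
  norm_num

section
variable {g : ℝ → ℝ} {M τ : ℝ}

lemma heatK1_holder (hg : Measurable g) (hM : ∀ y, |g y| ≤ M) (hτ : 0 < τ) (x y : ℝ) :
    |(√τ)⁻¹ * scaleAvg (heatK1 1) √τ g x - (√τ)⁻¹ * scaleAvg (heatK1 1) √τ g y| ≤
      √(2 * ((∫ z, |heatK1 1 z|) * M) * ((∫ z, |heatK2 1 z|) * M)) * τ ^ (-(3 / 4) : ℝ)
        * √|x - y| := by
  have h := holder_half_of_bounds (A := (√τ)⁻¹ * ((∫ z, |heatK1 1 z|) * M))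
    (B := τ⁻¹ * ((∫ z, |heatK2 1 z|) * M)) (hasDerivAt_heat_space' hg hM hτ)
    (fun x => by
      rw [abs_mul, abs_of_nonneg (by positivity : 0 ≤ (√τ)⁻¹)]
      gcongr
      exact gaussBdd_heatK1.scaleAvg_bound hM _ _)
    (fun x => by
      rw [abs_mul, abs_of_nonneg (by positivity : 0 ≤ τ⁻¹)]
      gcongr
      exact gaussBdd_heatK2.scaleAvg_bound hM _ _) x y
  refine h.trans_eq ?_
  congr 1
  rw [← inv_sqrt_mul_inv_sqrt hτ, ← Real.sqrt_mul' _ (by positivity)]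
  congr 1; ring

lemma heatK0_holder (hg : Measurable g) (hM : ∀ y, |g y| ≤ M) (hτ : 0 < τ) (x y : ℝ) :
    |scaleAvg (heatK0 1) √τ g x - scaleAvg (heatK0 1) √τ g y| ≤
      √(2 * ((∫ z, |heatK0 1 z|) * M) * ((√τ)⁻¹ * ((∫ z, |heatK1 1 z|) * M))) * √|x - y| :=
  holder_half_of_bounds (hasDerivAt_heat_space hg hM hτ)
    (fun x => gaussBdd_heatK0.scaleAvg_bound hM _ _)
    (fun x => by
      rw [abs_mul, abs_of_nonneg (by positivity : 0 ≤ (√τ)⁻¹)]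
      gcongr
      exact gaussBdd_heatK1.scaleAvg_bound hM _ _) x y

/-- The heat evolution commutes with differentiation of the data. -/
lemma hasDerivAt_scaleAvg_data {η g g' : ℝ → ℝ} (hη : GaussBdd η)
    (hg : ∀ x, HasDerivAt g (g' x) x) {M M' : ℝ} (hM : ∀ x, |g x| ≤ M) (hg' : Continuous g')
    (hM' : ∀ x, |g' x| ≤ M') (r x : ℝ) :
    HasDerivAt (fun x => scaleAvg η r g x) (scaleAvg η r g' x) x := by
  have hgc : Continuous g := continuous_iff_continuousAt.2 fun y => (hg y).continuousAt
  unfold scaleAvg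
  refine (hasDerivAt_integral_of_dominated_loc_of_deriv_le (𝕜 := ℝ) (E := ℝ) (μ := volume)
    (F := fun x z => η z * g (x - r * z)) (F' := fun x z => η z * g' (x - r * z)) (s := univ)
    (bound := fun z => |η z| * M') univ_mem ?_ ?_ ?_ ?_ ?_ ?_).2
  · exact .of_forall fun x => (hη.1.mul (hgc.comp (by fun_prop))).aestronglyMeasurable
  · exact hη.integrable.mul_bdd (c := M) (hgc.comp (by fun_prop)).aestronglyMeasurable
      (.of_forall fun z => hM _)
  · exact (hη.1.mul (hg'.comp (by fun_prop))).aestronglyMeasurable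
  · refine .of_forall fun z y _ => ?_
    rw [norm_mul]
    exact mul_le_mul_of_nonneg_left (hM' _) (abs_nonneg _)
  · exact hη.integrable.abs.mul_const M'
  · refine .of_forall fun z y _ => HasDerivAt.const_mul _ ?_
    simpa [Function.comp_def] using
      (hg (y - r * z)).comp y ((hasDerivAt_id y).sub_const (r * z))

lemma heat_second_deriv_eq {g g' : ℝ → ℝ}
    (hg : ∀ x, HasDerivAt g (g' x) x) {M M' : ℝ} (hM : ∀ x, |g x| ≤ M) (hg' : Continuous g')
    (hM' : ∀ x, |g' x| ≤ M') (hτ : 0 < τ) (x : ℝ) :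
    τ⁻¹ * scaleAvg (heatK2 1) √τ g x = (√τ)⁻¹ * scaleAvg (heatK1 1) √τ g' x := by
  have hgc : Continuous g := continuous_iff_continuousAt.2 fun y => (hg y).continuousAt
  have h1 : (fun x => (√τ)⁻¹ * scaleAvg (heatK1 1) √τ g x) =
      fun x => scaleAvg (heatK0 1) √τ g' x := funext fun x =>
    (hasDerivAt_heat_space hgc.measurable hM hτ x).unique
      (hasDerivAt_scaleAvg_data gaussBdd_heatK0 hg hM hg' hM' √τ x)
  have h2 := hasDerivAt_heat_space' hgc.measurable hM hτ x
  rw [h1] at h2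
  exact h2.unique (hasDerivAt_heat_space hg'.measurable hM' hτ x)

/-- Approximate identity property. -/
lemma tendsto_scaleAvg_heatK0 (hg : Measurable g) (hM : ∀ y, |g y| ≤ M) {x : ℝ}
    (hc : ContinuousAt g x) : Tendsto (fun r => scaleAvg (heatK0 1) r g x) (𝓝 0) (𝓝 (g x)) := by
  have h0 : scaleAvg (heatK0 1) 0 g x = g x := by
    unfold scaleAvg; simp [integral_mul_const, integral_heatK0]
  rw [← h0]
  have : ContinuousAt (fun r => scaleAvg (heatK0 1) r g x) 0 := by
    refine continuousAt_of_dominated (bound := fun z => |heatK0 1 z| * M) ?_ ?_ ?_ ?_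
    · exact .of_forall fun r => ((continuous_heatK0 1).measurable.mul
        (hg.comp (by fun_prop))).aestronglyMeasurable
    · refine .of_forall fun b => .of_forall fun z => ?_
      rw [norm_mul]
      exact mul_le_mul_of_nonneg_left (hM _) (abs_nonneg _)
    · exact gaussBdd_heatK0.integrable.abs.mul_const M
    · refine .of_forall fun z => continuousAt_const.mul ?_
      refine ContinuousAt.comp (g := g) (f := fun r => x - r * z) ?_ (by fun_prop)
      simpa using hc
  exact this

lemma scaleAvg_heatK0_zero (g : ℝ → ℝ) (x : ℝ) : scaleAvg (heatK0 1) 0 g x = g x := by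
  unfold scaleAvg; simp [integral_mul_const, integral_heatK0]

end

lemma integral_rpow_three_quarters (t : ℝ) :
    ∫ τ in (0 : ℝ)..t, τ ^ (-(3 / 4) : ℝ) = 4 * t ^ (1 / 4 : ℝ) := by
  rw [integral_rpow (Or.inl (by norm_num))]
  norm_num
  ring

section
variable {f : ℝ → ℝ → ℝ} {M : ℝ}

/-- Hölder continuity in space of the first derivative of the Duhamel term. -/
lemma IsSource.duhamel_holder (hf : IsSource f M) :
    ∃ A, 0 ≤ A ∧ ∀ t, 0 ≤ t → ∀ x y,
      |duhamel (fun τ => (√τ)⁻¹) (heatK1 1) f x t - duhamel (fun τ => (√τ)⁻¹) (heatK1 1) f y t| ≤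
        A * t ^ (1 / 4 : ℝ) * √|x - y| := by
  set A : ℝ := √(2 * ((∫ z, |heatK1 1 z|) * M) * ((∫ z, |heatK2 1 z|) * M))
  refine ⟨4 * A, by positivity, fun t ht x y => ?_⟩
  have hi := fun x => hf.intervalIntegrable_duhamel gaussBdd_heatK1 continuousOn_inv_sqrt
    integrableOn_inv_sqrt x t t ht
  unfold duhamel
  rw [← intervalIntegral.integral_sub (hi x) (hi y), ← Real.norm_eq_abs]
  have hI : IntervalIntegrable (fun τ : ℝ => τ ^ (-(3 / 4) : ℝ)) volume 0 t :=
    intervalIntegral.intervalIntegrable_rpow' (by norm_num)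
  calc _ ≤ ∫ τ in (0 : ℝ)..t, (A * √|x - y|) * τ ^ (-(3 / 4) : ℝ) := by
        refine intervalIntegral.norm_integral_le_of_norm_le ht (.of_forall fun τ hτ => ?_)
          (hI.const_mul _)
        refine (heatK1_holder (hf.meas _) (fun y => hf.bdd y _) hτ.1 x y).trans_eq ?_
        ring
    _ = _ := by
        rw [intervalIntegral.integral_const_mul, integral_rpow_three_quarters t]; ring

lemma IsSource.continuousOn_T2 (hf : IsSource f M) (x t : ℝ) :
    ContinuousOn (fun τ => τ⁻¹ * scaleAvg (heatK2 1) √τ (fun y => f y (t - τ)) x) (Ioi 0) :=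
  hf.continuousOn_duhamel_integrand gaussBdd_heatK2
    (continuousOn_id.inv₀ fun _ h => ne_of_gt h) x t

/-- The spatial derivative of the plain Duhamel term. -/
lemma IsSource.hasDerivAt_duhamel (hf : IsSource f M) (x : ℝ) {t : ℝ} (ht : 0 ≤ t) :
    HasDerivAt (fun x => duhamel (fun _ => 1) (heatK0 1) f x t)
      (duhamel (fun τ => (√τ)⁻¹) (heatK1 1) f x t) x := by
  have hi1 : ∀ T, IntegrableOn (fun _ : ℝ => (1 : ℝ)) (Ioo 0 T) := fun T => by simp
  unfold duhamel
  refine (intervalIntegral.hasDerivAt_integral_of_dominated_loc_of_deriv_le (𝕜 := ℝ) (E := ℝ)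
    (F := fun x τ => 1 * scaleAvg (heatK0 1) √τ (fun y => f y (t - τ)) x)
    (F' := fun x τ => (√τ)⁻¹ * scaleAvg (heatK1 1) √τ (fun y => f y (t - τ)) x)
    (s := univ) (bound := fun τ => (√τ)⁻¹ * ((∫ z, |heatK1 1 z|) * M)) univ_mem
    ?_ ?_ ?_ ?_ ?_ ?_).2
  · refine .of_forall fun y => ?_
    rw [uIoc_of_le ht]
    exact ((hf.continuousOn_duhamel_integrand gaussBdd_heatK0 continuousOn_const y t).mono
      Ioc_subset_Ioi_self).aestronglyMeasurable measurableSet_Ioc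
  · exact hf.intervalIntegrable_duhamel gaussBdd_heatK0 continuousOn_const hi1 _ _ _ ht
  · rw [uIoc_of_le ht]
    exact ((hf.continuousOn_duhamel_integrand gaussBdd_heatK1 continuousOn_inv_sqrt x t).mono
      Ioc_subset_Ioi_self).aestronglyMeasurable measurableSet_Ioc
  · refine .of_forall fun τ _ y _ => ?_
    refine (hf.norm_duhamel_integrand_le (ω := fun τ => (√τ)⁻¹) gaussBdd_heatK1 y t τ).trans_eq ?_
    rw [abs_of_nonneg (by positivity)]
  · rw [intervalIntegrable_iff_integrableOn_Ioo_of_le ht]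
    exact (integrableOn_inv_sqrt t).mul_const _
  · refine .of_forall fun τ hτ y _ => ?_
    rw [uIoc_of_le ht] at hτ
    simp only [one_mul]
    exact hasDerivAt_heat_space (hf.meas _) (fun y => hf.bdd y _) hτ.1 y

/-- Under a local bound on second derivatives of the heat flow of the source, the Duhamel term is
twice differentiable in space. -/
lemma IsSource.hasDerivAt_duhamel' (hf : IsSource f M) {x t B : ℝ} (ht : 0 ≤ t) {s : Set ℝ}
    (hs : s ∈ 𝓝 x) (hB : ∀ y ∈ s, ∀ τ ∈ Ioo 0 t,
      |τ⁻¹ * scaleAvg (heatK2 1) √τ (fun y => f y (t - τ)) y| ≤ B * τ ^ (-(3 / 4) : ℝ)) :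
    HasDerivAt (fun x => duhamel (fun τ => (√τ)⁻¹) (heatK1 1) f x t)
      (duhamel (fun τ => τ⁻¹) (heatK2 1) f x t) x := by
  have hI : IntervalIntegrable (fun τ : ℝ => τ ^ (-(3 / 4) : ℝ)) volume 0 t :=
    intervalIntegral.intervalIntegrable_rpow' (by norm_num)
  unfold duhamel
  refine (intervalIntegral.hasDerivAt_integral_of_dominated_loc_of_deriv_le (𝕜 := ℝ) (E := ℝ)
    (F := fun x τ => (√τ)⁻¹ * scaleAvg (heatK1 1) √τ (fun y => f y (t - τ)) x)
    (F' := fun x τ => τ⁻¹ * scaleAvg (heatK2 1) √τ (fun y => f y (t - τ)) x)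
    (s := s) (bound := fun τ => B * τ ^ (-(3 / 4) : ℝ)) hs
    ?_ ?_ ?_ ?_ (hI.const_mul B) ?_).2
  · refine .of_forall fun y => ?_
    rw [uIoc_of_le ht]
    exact ((hf.continuousOn_duhamel_integrand gaussBdd_heatK1 continuousOn_inv_sqrt y t).mono
      Ioc_subset_Ioi_self).aestronglyMeasurable measurableSet_Ioc
  · exact hf.intervalIntegrable_duhamel gaussBdd_heatK1 continuousOn_inv_sqrt
      integrableOn_inv_sqrt _ _ _ ht
  · rw [uIoc_of_le ht]
    exact ((hf.continuousOn_T2 x t).mono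
      Ioc_subset_Ioi_self).aestronglyMeasurable measurableSet_Ioc
  · have : ∀ᵐ τ ∂volume, τ ≠ t := (countable_singleton t).ae_notMem _ |>.mono fun τ h => h
    filter_upwards [this] with τ h1 h2 y hy
    rw [uIoc_of_le ht] at h2
    exact hB y hy τ ⟨h2.1, lt_of_le_of_ne h2.2 h1⟩
  · refine .of_forall fun τ hτ y _ => ?_
    rw [uIoc_of_le ht] at hτ
    exact hasDerivAt_heat_space' (hf.meas _) (fun y => hf.bdd y _) hτ.1 y

end

/-- Spatial Hölder continuity of exponent `1/2`, locally uniform in `(-1,1) × (0,∞)`. -/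
def LocHolder (f : ℝ → ℝ → ℝ) : Prop :=
  ∀ δ > 0, ∀ T, ∃ H, 0 ≤ H ∧ ∀ s ∈ Icc δ T, ∀ x ∈ Icc (-1 + δ) (1 - δ), ∀ y,
    |f y s - f x s| ≤ H * √|x - y|

section
variable {f : ℝ → ℝ → ℝ} {M : ℝ}

lemma IsSource.local_bound (hf : IsSource f M) (hH : LocHolder f) {x₀ t₀ : ℝ}
    (hx : x₀ ∈ Ioo (-1 : ℝ) 1) (ht : 0 < t₀) :
    ∃ B, ∃ s ∈ 𝓝 x₀, 0 ≤ B ∧ ∀ x ∈ s, ∀ t ∈ Icc (t₀ / 2) (2 * t₀), ∀ τ ∈ Ioo 0 t,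
      |τ⁻¹ * scaleAvg (heatK2 1) √τ (fun y => f y (t - τ)) x| ≤ B * τ ^ (-(3 / 4) : ℝ) := by
  have hM := hf.nonneg
  set δ : ℝ := min (t₀ / 4) (min (x₀ + 1) (1 - x₀) / 2)
  have hm : 0 < min (x₀ + 1) (1 - x₀) := lt_min (by linarith [hx.1]) (by linarith [hx.2])
  have hδ : 0 < δ := lt_min (by positivity) (by positivity)
  have hδ1 : δ ≤ t₀ / 4 := min_le_left _ _
  have hδ2 : δ ≤ (x₀ + 1) / 2 := (min_le_right _ _).trans (by linarith [min_le_left (x₀ + 1) (1 - x₀)])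
  have hδ3 : δ ≤ (1 - x₀) / 2 := (min_le_right _ _).trans (by linarith [min_le_right (x₀ + 1) (1 - x₀)])
  obtain ⟨H, hH0, hH⟩ := hH δ hδ (2 * t₀)
  set c : ℝ := ∫ z, |heatK2 1 z| * √|z|
  have hc : 0 ≤ c := integral_nonneg fun z => by positivity
  set c2 : ℝ := ∫ z, |heatK2 1 z|
  have hc2 : 0 ≤ c2 := integral_nonneg fun z => by positivity
  refine ⟨H * c + c2 * M * (t₀ / 4) ^ (-(1 / 4) : ℝ), Icc (-1 + δ) (1 - δ),
    Icc_mem_nhds (by linarith) (by linarith), by positivity, fun x hx t ht' τ hτ => ?_⟩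
  have hτ0 : 0 < τ := hτ.1
  rw [abs_mul, abs_of_nonneg (by positivity : 0 ≤ τ⁻¹)]
  have hp : 0 ≤ τ ^ (-(3 / 4) : ℝ) := by positivity
  rcases lt_or_ge τ (t₀ / 4) with h | h
  · have h1 := scaleAvg_heatK2_bound (hf.meas (t - τ)) (fun y => hf.bdd y _)
      (hH (t - τ) ⟨by linarith [ht'.1], by linarith [ht'.2]⟩ x hx) (Real.sqrt_nonneg τ)
    have e : τ⁻¹ * √√τ = τ ^ (-(3 / 4) : ℝ) := by
      rw [Real.sqrt_eq_rpow, Real.sqrt_eq_rpow, ← Real.rpow_mul hτ0.le, ← Real.rpow_neg_one,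
        ← Real.rpow_add hτ0]
      norm_num
    calc _ ≤ τ⁻¹ * (H * √√τ * c) := by gcongr
      _ = H * c * (τ⁻¹ * √√τ) := by ring
      _ = H * c * τ ^ (-(3 / 4) : ℝ) := by rw [e]
      _ ≤ _ := by
        gcongr
        exact le_add_of_nonneg_right (by positivity)
  · have h1 := hf.abs_scaleAvg_le gaussBdd_heatK2 √τ (t - τ) x
    have e : τ⁻¹ = τ ^ (-(1 / 4) : ℝ) * τ ^ (-(3 / 4) : ℝ) := by
      rw [← Real.rpow_add hτ0, ← Real.rpow_neg_one]; norm_num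
    have h2 : τ ^ (-(1 / 4) : ℝ) ≤ (t₀ / 4) ^ (-(1 / 4) : ℝ) :=
      Real.rpow_le_rpow_of_nonpos (by positivity) h (by norm_num)
    calc _ ≤ τ⁻¹ * (c2 * M) := by gcongr
      _ = c2 * M * τ ^ (-(1 / 4) : ℝ) * τ ^ (-(3 / 4) : ℝ) := by rw [e]; ring
      _ ≤ c2 * M * (t₀ / 4) ^ (-(1 / 4) : ℝ) * τ ^ (-(3 / 4) : ℝ) := by gcongr
      _ ≤ _ := by
        gcongr
        exact le_add_of_nonneg_left (by positivity)

lemma IsSource.continuousAt_duhamel2 (hf : IsSource f M) (hH : LocHolder f) {x₀ t₀ : ℝ}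
    (hx : x₀ ∈ Ioo (-1 : ℝ) 1) (ht : 0 < t₀) :
    ContinuousAt (fun c : ℝ × ℝ => duhamel (fun τ => τ⁻¹) (heatK2 1) f c.1 c.2) (x₀, t₀) := by
  obtain ⟨B, s, hs, hB0, hB⟩ := hf.local_bound hH hx ht
  have h1 : ∀ᶠ c : ℝ × ℝ in 𝓝 (x₀, t₀), c.1 ∈ s := continuousAt_fst.eventually hs
  have h2 : ∀ᶠ c : ℝ × ℝ in 𝓝 (x₀, t₀), c.2 ∈ Icc (t₀ / 2) (2 * t₀) :=
    continuousAt_snd.eventually (Icc_mem_nhds (by simp; linarith) (by simp; linarith))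
  refine continuousAt_duhamel (a := (x₀, t₀)) (t := Prod.snd) (T := t₀ + 1)
    (b := fun τ => B * τ ^ (-(3 / 4) : ℝ))
    (q := fun τ c => τ⁻¹ * scaleAvg (heatK2 1) √τ (fun y => f y (c.2 - τ)) c.1)
    continuousAt_snd ht (lt_add_one t₀)
    ((integrableOn_rpow_Ioo (by norm_num) _).const_mul B) ?_
    (fun τ hτ => by have := hτ.1; positivity) (.of_forall fun c => ?_) fun τ hτ => ?_
  · filter_upwards [h1, h2] with c hc1 hc2 τ hτ
    exact hB c.1 hc1 c.2 hc2 τ hτ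
  · exact ((hf.continuousOn_T2 c.1 c.2).mono Ioo_subset_Ioi_self).aestronglyMeasurable
      measurableSet_Ioo
  · exact continuousAt_const.mul (hf.continuousAt_scaleAvg gaussBdd_heatK2 (r := fun _ => √τ)
      continuousAt_const continuousAt_fst (by fun_prop) (Real.sqrt_pos.2 hτ.1).ne')

/-- Time increments of the Duhamel term. -/
lemma IsSource.duhamel_increment (hf : IsSource f M) {x t₁ t B : ℝ} (ht₁ : 0 < t₁) (ht : t₁ ≤ t)
    (hB : ∀ σ ∈ Icc t₁ t, ∀ τ ∈ Ioo 0 σ,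
      |τ⁻¹ * scaleAvg (heatK2 1) √τ (fun y => f y (σ - τ)) x| ≤ B * τ ^ (-(3 / 4) : ℝ))
    (hB0 : 0 ≤ B) (hfx : ∀ s, ContinuousAt (fun q : ℝ × ℝ => f q.1 q.2) (x, s)) :
    duhamel (fun _ => 1) (heatK0 1) f x t = duhamel (fun _ => 1) (heatK0 1) f x t₁ +
      ∫ σ in t₁..t, f x σ + duhamel (fun τ => τ⁻¹) (heatK2 1) f x σ := by
  have ht0 : 0 ≤ t := ht₁.le.trans ht
  let S : ℝ → ℝ → ℝ := fun r s => scaleAvg (heatK0 1) √r (fun y => f y s) x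
  let k : ℝ → ℝ → ℝ := fun σ s => (σ - s)⁻¹ * scaleAvg (heatK2 1) √(σ - s) (fun y => f y s) x
  have hfs : Continuous fun s => f x s := continuous_iff_continuousAt.2 fun s =>
    ContinuousAt.comp (f := fun s => (x, s)) (g := fun q : ℝ × ℝ => f q.1 q.2) (hfx s)
      (by fun_prop)
  have hkB : ∀ σ ∈ Icc t₁ t, ∀ s ∈ Ioo 0 σ, |k σ s| ≤ B * (σ - s) ^ (-(3 / 4) : ℝ) := by
    intro σ hσ s hs
    have := hB σ hσ (σ - s) ⟨by linarith [hs.2], by linarith [hs.1]⟩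
    simpa only [sub_sub_cancel] using this
  have hkc : ∀ σ s, s < σ → ContinuousAt (fun q : ℝ × ℝ => k q.1 q.2) (σ, s) := by
    intro σ s h
    have hp : 0 < σ - s := sub_pos.2 h
    refine ContinuousAt.mul (ContinuousAt.inv₀ (by fun_prop) hp.ne') ?_
    exact hf.continuousAt_scaleAvg gaussBdd_heatK2 (r := fun q : ℝ × ℝ => √(q.1 - q.2))
      (x := fun _ => x) (s := fun q => q.2) (by fun_prop) continuousAt_const (by fun_prop)
      (Real.sqrt_pos.2 hp).ne'
  have hi1 : ∀ T, IntegrableOn (fun _ : ℝ => (1 : ℝ)) (Ioo 0 T) := fun T => by simp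
  -- the fundamental theorem of calculus for fixed source time
  have stepA : ∀ s ∈ Ioo 0 t, S (t - s) s - S (max s t₁ - s) s =
      ∫ σ in Ioo t₁ t, (Ioi s).indicator (fun σ => k σ s) σ := by
    intro s hs
    set l := max s t₁
    have hl : l ≤ t := max_le hs.2.le ht
    have hsl : s ≤ l := le_max_left _ _
    rw [setIntegral_indicator measurableSet_Ioi, Ioo_inter_Ioi, max_comm,
      ← integral_Ioc_eq_integral_Ioo, ← intervalIntegral.integral_of_le hl]
    have hcd : ∀ σ, s < σ → HasDerivAt (fun σ => S (σ - s) s) (k σ s) σ := by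
      intro σ hσ
      have h1 := hasDerivAt_heat_time (hf.meas s) (fun y => hf.bdd y s) (sub_pos.2 hσ) x
      simpa [Function.comp_def] using h1.comp σ ((hasDerivAt_id σ).sub_const s)
    have hcs : ContinuousAt (fun σ => S (σ - s) s) s := by
      have h1 : Tendsto (fun σ => √(σ - s)) (𝓝 s) (𝓝 0) := by
        have : Continuous fun σ => √(σ - s) := by fun_prop
        simpa using this.tendsto s
      have h2 := (tendsto_scaleAvg_heatK0 (hf.meas s) (fun y => hf.bdd y s) (x := x)
        (ContinuousAt.comp (f := fun y => (y, s)) (g := fun q : ℝ × ℝ => f q.1 q.2) (hfx s)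
          (by fun_prop))).comp h1
      simp only [ContinuousAt, S, sub_self, Real.sqrt_zero, scaleAvg_heatK0_zero]
      exact h2
    rw [intervalIntegral.integral_eq_sub_of_hasDerivAt_of_le hl (f := fun σ => S (σ - s) s)]
    · intro σ hσ
      rcases hsl.trans hσ.1 |>.eq_or_lt with h | h
      · exact h ▸ hcs.continuousWithinAt
      · exact (hcd σ h).continuousAt.continuousWithinAt
    · exact fun σ hσ => hcd σ (hsl.trans_lt hσ.1)
    · rw [intervalIntegrable_iff_integrableOn_Ioo_of_le hl]
      have hI : IntegrableOn (fun σ : ℝ => B * (σ - s) ^ (-(3 / 4) : ℝ)) (Ioo l t) := by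
        rw [← intervalIntegrable_iff_integrableOn_Ioo_of_le hl]
        refine IntervalIntegrable.const_mul ?_ B
        have : IntervalIntegrable (fun τ : ℝ => τ ^ (-(3 / 4) : ℝ)) volume (l - s) (t - s) :=
          intervalIntegral.intervalIntegrable_rpow' (by norm_num)
        simpa using this.comp_sub_right s
      refine hI.mono' (ContinuousOn.aestronglyMeasurable (fun σ hσ => ?_) measurableSet_Ioo) ?_
      · refine ContinuousAt.continuousWithinAt (ContinuousAt.comp (f := fun σ => (σ, s))
          (g := fun q : ℝ × ℝ => k q.1 q.2) (hkc σ s (hsl.trans_lt hσ.1)) (by fun_prop))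
      · filter_upwards [ae_restrict_mem measurableSet_Ioo] with σ hσ
        exact hkB σ ⟨(le_max_right _ _).trans hσ.1.le, hσ.2.le⟩ s ⟨hs.1, hsl.trans_lt hσ.1⟩
  have hdu : ∀ T, duhamel (fun _ => 1) (heatK0 1) f x T = ∫ s in (0 : ℝ)..T, S (T - s) s := by
    intro T
    have := intervalIntegral.integral_comp_sub_left (a := 0) (b := T) (fun s => S (T - s) s) T
    simp only [sub_self, sub_zero] at this
    rw [← this]
    simp [duhamel, S]
  have hdu2 : ∀ T, duhamel (fun τ => τ⁻¹) (heatK2 1) f x T = ∫ s in (0 : ℝ)..T, k T s := by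
    intro T
    have := intervalIntegral.integral_comp_sub_left (a := 0) (b := T) (fun s => k T s) T
    simp only [sub_self, sub_zero] at this
    rw [← this]
    simp [duhamel, k]
  have hSi : ∀ T, 0 ≤ T → IntervalIntegrable (fun s => S (T - s) s) volume 0 T := by
    intro T hT
    have := (hf.intervalIntegrable_duhamel gaussBdd_heatK0 continuousOn_const hi1 x T T hT
      ).comp_sub_left T
    simp only [sub_self, sub_zero, sub_sub_cancel, one_mul] at this
    exact this.symm
  have hmax1 : ∀ s ∈ Icc 0 t₁, S (max s t₁ - s) s = S (t₁ - s) s := fun s hs => by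
    rw [max_eq_right hs.2]
  have hmax2 : ∀ s ∈ Icc t₁ t, S (max s t₁ - s) s = f x s := fun s hs => by
    rw [max_eq_left hs.1]; simp only [S, sub_self, Real.sqrt_zero, scaleAvg_heatK0_zero]
  have hSm1 : IntervalIntegrable (fun s => S (max s t₁ - s) s) volume 0 t₁ :=
    (hSi t₁ ht₁.le).congr fun s hs => by
      rw [uIoc_of_le ht₁.le] at hs; exact (hmax1 s ⟨hs.1.le, hs.2⟩).symm
  have hSm2 : IntervalIntegrable (fun s => S (max s t₁ - s) s) volume t₁ t :=
    (hfs.intervalIntegrable t₁ t).congr fun s hs => by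
      rw [uIoc_of_le ht] at hs; exact (hmax2 s ⟨hs.1.le, hs.2⟩).symm
  have hsum : ∫ s in (0 : ℝ)..t, S (max s t₁ - s) s =
      duhamel (fun _ => 1) (heatK0 1) f x t₁ + ∫ σ in t₁..t, f x σ := by
    rw [← intervalIntegral.integral_add_adjacent_intervals hSm1 hSm2, hdu t₁]
    congr 1
    · refine intervalIntegral.integral_congr fun s hs => ?_
      rw [uIcc_of_le ht₁.le] at hs; exact hmax1 s hs
    · refine intervalIntegral.integral_congr fun s hs => ?_
      rw [uIcc_of_le ht] at hs; exact hmax2 s hs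
  -- Fubini
  have hint : Integrable (Function.uncurry fun σ s => (Ioi s).indicator (fun σ => k σ s) σ)
      ((volume.restrict (Ioo t₁ t)).prod (volume.restrict (Ioo 0 t))) := by
    have h1 : Integrable ((Ioo 0 t).indicator fun _ : ℝ => B) volume :=
      (integrable_indicator_iff measurableSet_Ioo).2 (by simp)
    have h2 : Integrable ((Ioo 0 t).indicator fun τ : ℝ => τ ^ (-(3 / 4) : ℝ)) volume :=
      (integrable_indicator_iff measurableSet_Ioo).2 (integrableOn_rpow_Ioo (by norm_num) t)
    have h3 := h1.convolution_integrand (ContinuousLinearMap.mul ℝ ℝ) h2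
    rw [Measure.prod_restrict]
    refine (h3.restrict (s := Ioo t₁ t ×ˢ Ioo 0 t)).mono' ?_ ?_
    · have hU : MeasurableSet {q : ℝ × ℝ | q.2 < q.1} :=
        measurableSet_lt measurable_snd measurable_fst
      have e : (Function.uncurry fun σ s => (Ioi s).indicator (fun σ => k σ s) σ) =
          {q : ℝ × ℝ | q.2 < q.1}.indicator fun q => k q.1 q.2 := by
        ext ⟨σ, s⟩
        simp [indicator, Function.uncurry]
      rw [e, aestronglyMeasurable_indicator_iff hU]
      rw [Measure.restrict_restrict hU]
      exact ContinuousOn.aestronglyMeasurable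
        (fun q hq => (hkc q.1 q.2 hq.1).continuousWithinAt)
        (hU.inter (measurableSet_Ioo.prod measurableSet_Ioo))
    · filter_upwards [ae_restrict_mem (measurableSet_Ioo.prod measurableSet_Ioo)] with q hq
      obtain ⟨hq1, hq2⟩ := hq
      simp only [Function.uncurry]
      rw [indicator_of_mem hq2, ContinuousLinearMap.mul_apply']
      by_cases h : q.2 < q.1
      · rw [indicator_of_mem (show q.1 ∈ Ioi q.2 from h), indicator_of_mem
          (show q.1 - q.2 ∈ Ioo 0 t from ⟨sub_pos.2 h, by linarith [hq1.2, hq2.1]⟩)]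
        exact hkB q.1 ⟨hq1.1.le, hq1.2.le⟩ q.2 ⟨hq2.1, h⟩
      · rw [indicator_of_notMem (show q.1 ∉ Ioi q.2 from h), norm_zero]
        exact mul_nonneg hB0 (indicator_nonneg (fun τ hτ => Real.rpow_nonneg hτ.1.le _) _)
  have hswap : ∫ s in Ioo 0 t, ∫ σ in Ioo t₁ t, (Ioi s).indicator (fun σ => k σ s) σ =
      ∫ σ in Ioo t₁ t, duhamel (fun τ => τ⁻¹) (heatK2 1) f x σ := by
    rw [← integral_integral_swap hint]
    refine setIntegral_congr_fun measurableSet_Ioo fun σ hσ => ?_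
    have hσ0 : 0 < σ := ht₁.trans hσ.1
    have e : (fun s => (Ioi s).indicator (fun σ => k σ s) σ) =
        (Iio σ).indicator fun s => k σ s := by
      ext s; simp [indicator]
    simp only [e]
    rw [setIntegral_indicator measurableSet_Iio, Ioo_inter_Iio, min_eq_right hσ.2.le, hdu2,
      intervalIntegral.integral_of_le hσ0.le, integral_Ioc_eq_integral_Ioo]
  have hDi : IntegrableOn (fun σ => duhamel (fun τ => τ⁻¹) (heatK2 1) f x σ) (Ioo t₁ t) := by
    have := hint.integral_prod_left
    refine IntegrableOn.congr_fun this (fun σ hσ => ?_) measurableSet_Ioo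
    have hσ0 : 0 < σ := ht₁.trans hσ.1
    have e : (fun s => (Ioi s).indicator (fun σ => k σ s) σ) =
        (Iio σ).indicator fun s => k σ s := by
      ext s; simp [indicator]
    simp only [Function.uncurry, e]
    rw [setIntegral_indicator measurableSet_Iio, Ioo_inter_Iio, min_eq_right hσ.2.le, hdu2,
      intervalIntegral.integral_of_le hσ0.le, integral_Ioc_eq_integral_Ioo]
  have hmain : (∫ s in (0 : ℝ)..t, S (t - s) s) - ∫ s in (0 : ℝ)..t, S (max s t₁ - s) s =
      ∫ σ in t₁..t, duhamel (fun τ => τ⁻¹) (heatK2 1) f x σ := by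
    rw [← intervalIntegral.integral_sub (hSi t ht0) (hSm1.trans hSm2),
      intervalIntegral.integral_of_le ht0, integral_Ioc_eq_integral_Ioo,
      setIntegral_congr_fun measurableSet_Ioo stepA, hswap, ← integral_Ioc_eq_integral_Ioo,
      intervalIntegral.integral_of_le ht]
  rw [intervalIntegral.integral_add (hfs.intervalIntegrable _ _)
    ((intervalIntegrable_iff_integrableOn_Ioo_of_le ht).2 hDi), hdu t, ← hmain, hsum]
  ring

lemma IsSource.hasDerivAt_duhamel_time (hf : IsSource f M) (hH : LocHolder f) {x t : ℝ}
    (hx : x ∈ Ioo (-1 : ℝ) 1) (ht : 0 < t)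
    (hfx : ∀ s, ContinuousAt (fun q : ℝ × ℝ => f q.1 q.2) (x, s)) :
    HasDerivAt (fun t => duhamel (fun _ => 1) (heatK0 1) f x t)
      (f x t + duhamel (fun τ => τ⁻¹) (heatK2 1) f x t) t := by
  obtain ⟨B, s, hs, hB0, hB⟩ := hf.local_bound hH hx ht
  have hxs := mem_of_mem_nhds hs
  have hcont : ∀ σ, 0 < σ →
      ContinuousAt (fun σ => f x σ + duhamel (fun τ => τ⁻¹) (heatK2 1) f x σ) σ := fun σ hσ =>
    (ContinuousAt.comp (f := fun s => (x, s)) (g := fun q : ℝ × ℝ => f q.1 q.2) (hfx σ)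
      (by fun_prop)).add (ContinuousAt.comp (f := fun s => (x, s))
        (g := fun c : ℝ × ℝ => duhamel (fun τ => τ⁻¹) (heatK2 1) f c.1 c.2)
        (hf.continuousAt_duhamel2 hH hx hσ) (by fun_prop))
  have hev : (fun t => duhamel (fun _ => 1) (heatK0 1) f x t) =ᶠ[𝓝 t] fun t' =>
      duhamel (fun _ => 1) (heatK0 1) f x (t / 2) +
      ∫ σ in (t / 2)..t', f x σ + duhamel (fun τ => τ⁻¹) (heatK2 1) f x σ := by
    filter_upwards [Icc_mem_nhds (show t / 2 < t by linarith) (show t < 2 * t by linarith)]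
      with t' ht'
    exact hf.duhamel_increment (by positivity) ht'.1
      (fun σ hσ τ hτ => hB x hxs σ ⟨hσ.1, hσ.2.trans ht'.2⟩ τ hτ) hB0 hfx
  refine HasDerivAt.congr_of_eventuallyEq ?_ hev
  refine HasDerivAt.const_add _ (intervalIntegral.integral_hasDerivAt_right ?_ ?_ (hcont t ht))
  · refine ContinuousOn.intervalIntegrable fun σ hσ => (hcont σ ?_).continuousWithinAt
    rw [uIcc_of_le (by linarith)] at hσ
    exact lt_of_lt_of_le (by positivity) hσ.1
  · refine ContinuousOn.stronglyMeasurableAtFilter isOpen_Ioi (fun σ hσ =>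
      (hcont σ hσ).continuousWithinAt) t (mem_Ioi.2 ht)

end

/-- `u` solves `u_t = u_xx + F(u_x)` on `[-1,1] × [0,∞)` with zero boundary values, with spatial
derivatives `w = u_x`, continuous up to the boundary, and `a = u_xx`. -/
structure Evol (F : ℝ → ℝ) (u w a : ℝ → ℝ → ℝ) : Prop where
  cont_u : ContinuousOn (fun q : ℝ × ℝ => u q.1 q.2) (Icc (-1 : ℝ) 1 ×ˢ Ici (0 : ℝ))
  cont_w : ContinuousOn (fun q : ℝ × ℝ => w q.1 q.2) (Icc (-1 : ℝ) 1 ×ˢ Ici (0 : ℝ))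
  cont_a : ContinuousOn (fun q : ℝ × ℝ => a q.1 q.2) (Ioo (-1 : ℝ) 1 ×ˢ Ioi (0 : ℝ))
  deriv_u : ∀ x ∈ Ioo (-1 : ℝ) 1, ∀ t, 0 ≤ t → HasDerivAt (fun y => u y t) (w x t) x
  deriv_w : ∀ x ∈ Ioo (-1 : ℝ) 1, ∀ t, 0 < t → HasDerivAt (fun y => w y t) (a x t) x
  deriv_t : ∀ x ∈ Ioo (-1 : ℝ) 1, ∀ t, 0 < t → HasDerivAt (fun s => u x s) (a x t + F (w x t)) t
  bc : ∀ t, 0 ≤ t → u (-1) t = 0 ∧ u 1 t = 0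

lemma scaleAvg_eq_zero_of_odd {η g : ℝ → ℝ} {c : ℝ} (hη : ∀ z, η (-z) = η z)
    (hg : ∀ y, g (2 * c - y) = -g y) (r : ℝ) : scaleAvg η r g c = 0 := by
  have h : scaleAvg η r g c = -scaleAvg η r g c := by
    unfold scaleAvg
    conv_lhs => rw [← integral_neg_eq_self]
    rw [← integral_neg]
    congr 1; ext z
    rw [hη, show c - r * -z = 2 * c - (c - r * z) by ring, hg]
    ring
  linarith

lemma heatK0_neg (z : ℝ) : heatK0 1 (-z) = heatK0 1 z := by unfold heatK0; simp

lemma continuousAt_oddSource {F : ℝ → ℝ} (hF : Continuous F)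
    {w : ℝ → ℝ → ℝ} (hw : Continuous fun q : ℝ × ℝ => w q.1 q.2) {x : ℝ}
    (hx : x ∈ Ioo (-1 : ℝ) 1) (s : ℝ) :
    ContinuousAt (fun q : ℝ × ℝ => oddSource F w q.1 q.2) (x, s) := by
  have hc : Continuous fun q : ℝ × ℝ => F (w (foldMap q.1) q.2) :=
    hF.comp (hw.comp ((continuous_foldMap.comp continuous_fst).prodMk continuous_snd))
  have := Real.pi_pos
  have hcos : Real.cos (Real.pi * x / 2) ≠ 0 :=
    (Real.cos_pos_of_mem_Ioo ⟨by nlinarith [hx.1], by nlinarith [hx.2]⟩).ne'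
  exact ContinuousAt.mul (ContinuousAt.comp (f := Prod.fst) (g := foldSign) (x := (x, s))
    (continuousAt_foldSign hcos) continuousAt_fst) hc.continuousAt

lemma oddSource_of_mem {F : ℝ → ℝ} {w : ℝ → ℝ → ℝ} {x : ℝ} (hx : x ∈ Ioo (-1 : ℝ) 1) (s : ℝ) :
    oddSource F w x s = F (w x s) := by
  rw [oddSource, foldSign_of_mem hx, foldMap_of_mem (Ioo_subset_Icc_self hx), one_mul]

lemma IsSource.continuousOn_duhamel_one {f : ℝ → ℝ → ℝ} {M : ℝ} (hf : IsSource f M) :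
    ContinuousOn (fun c : ℝ × ℝ => duhamel (fun _ => 1) (heatK0 1) f c.1 c.2)
      (univ ×ˢ Ici (0 : ℝ)) := by
  have hi1 : ∀ T, IntegrableOn (fun _ : ℝ => (1 : ℝ)) (Ioo 0 T) := fun T => by simp
  intro a ha
  rcases lt_or_eq_of_le (show (0 : ℝ) ≤ a.2 from ha.2) with h | h
  · exact (hf.continuousAt_duhamel' gaussBdd_heatK0 continuousOn_const hi1 h).continuousWithinAt
  · have h0 : duhamel (fun _ => 1) (heatK0 1) f a.1 a.2 = 0 := by
      rw [← h]; simp [duhamel]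
    rw [ContinuousWithinAt, h0]
    have hlim : Tendsto (fun c : ℝ × ℝ => c.2 * ((∫ z, |heatK0 1 z|) * M))
        (𝓝[univ ×ˢ Ici (0 : ℝ)] a) (𝓝 0) := by
      have : Continuous fun c : ℝ × ℝ => c.2 * ((∫ z, |heatK0 1 z|) * M) := by fun_prop
      have := this.tendsto a
      rw [← h, zero_mul] at this
      exact this.mono_left nhdsWithin_le_nhds
    refine squeeze_zero_norm' ?_ hlim
    filter_upwards [self_mem_nhdsWithin] with c hc
    have hc0 : 0 ≤ c.2 := hc.2
    have := hf.abs_duhamel_le (ω := fun _ => 1) gaussBdd_heatK0 hi1 c.1 c.2 hc0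
    simpa using this

/-- Data extended by odd reflection across the endpoints. -/
lemma exists_odd_extension {u0 : ℝ → ℝ} (hu0 : ContDiffOn ℝ 1 u0 (Icc (-1 : ℝ) 1))
    (hl : u0 (-1) = 0) (hr : u0 1 = 0) :
    ∃ h g : ℝ → ℝ, (∀ x, HasDerivAt h (g x) x) ∧ Continuous g ∧ (∃ G, ∀ x, |g x| ≤ G) ∧
      (∃ G, ∀ x, |h x| ≤ G) ∧ (∀ x ∈ Icc (-1 : ℝ) 1, h x = u0 x) ∧
      (∀ x, h (2 - x) = -h x) ∧ ∀ x, h (-2 - x) = -h x := by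
  set d := derivWithin u0 (Icc (-1 : ℝ) 1)
  have hd : ContinuousOn d (Icc (-1 : ℝ) 1) :=
    hu0.continuousOn_derivWithin (uniqueDiffOn_Icc (by norm_num)) le_rfl
  set g : ℝ → ℝ := fun x => d (foldMap x)
  have hg : Continuous g := hd.comp_continuous continuous_foldMap foldMap_mem
  obtain ⟨G, hG⟩ := isCompact_Icc.exists_bound_of_continuousOn hd
  set h : ℝ → ℝ := fun x => ∫ s in (-1 : ℝ)..x, g s
  have hh : ∀ x, HasDerivAt h (g x) x := fun x =>
    intervalIntegral.integral_hasDerivAt_right (hg.intervalIntegrable _ _)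
      (hg.stronglyMeasurableAtFilter _ _) hg.continuousAt
  have heq : ∀ x ∈ Icc (-1 : ℝ) 1, h x = u0 x := by
    intro x hx
    have : h x = u0 x - u0 (-1) := by
      refine intervalIntegral.integral_eq_sub_of_hasDerivAt_of_le hx.1
        (hu0.continuousOn.mono (Icc_subset_Icc_right hx.2)) (fun y hy => ?_)
        (hg.intervalIntegrable _ _)
      have hy' : y ∈ Ioo (-1 : ℝ) 1 := ⟨hy.1, hy.2.trans_le hx.2⟩
      have h1 := ((hu0.differentiableOn one_ne_zero y (Ioo_subset_Icc_self hy')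
        ).hasDerivWithinAt).hasDerivAt (Icc_mem_nhds hy'.1 hy'.2)
      simpa only [g, foldMap_of_mem (Ioo_subset_Icc_self hy')] using h1
    rw [this, hl, sub_zero]
  have hodd : ∀ c, (∀ x, g (2 * c - x) = g x) → h c = 0 → ∀ x, h (2 * c - x) = -h x := by
    intro c hc h0 x
    have hder : ∀ x, HasDerivAt (fun x => h (2 * c - x) + h x) 0 x := fun x => by
      have h1 := (hh (2 * c - x)).comp x ((hasDerivAt_id x).const_sub (2 * c))
      refine (h1.add (hh x)).congr_deriv ?_
      simp [hc x]
    have hconst := is_const_of_deriv_eq_zero (fun x => (hder x).differentiableAt)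
      (fun x => (hder x).deriv) x c
    simp only [show 2 * c - c = c by ring, h0] at hconst
    linarith
  have h1 : h 1 = 0 := by rw [heq 1 (by norm_num), hr]
  have hm1 : h (-1) = 0 := by rw [heq (-1) (by norm_num), hl]
  have ho1 : ∀ x, h (2 - x) = -h x := by
    have := hodd 1 (fun x => by simp only [g]; rw [mul_one, foldMap_two_sub]) h1
    simpa using this
  have ho2 : ∀ x, h (-2 - x) = -h x := by
    have := hodd (-1) (fun x => by
      simp only [g]; rw [show (2 : ℝ) * -1 = -2 by norm_num, foldMap_neg_two_sub]) hm1
    intro x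
    rw [← this x]; norm_num
  have hc : Continuous h := continuous_iff_continuousAt.2 fun y => (hh y).continuousAt
  have hper : Function.Periodic h 4 := fun x => by
    have := ho1 (-2 - x)
    rw [ho2, neg_neg, show 2 - (-2 - x) = x + 4 by ring] at this
    exact this
  refine ⟨h, g, hh, hg, ⟨G, fun x => hG _ (foldMap_mem x)⟩, ?_, heq, ho1, ho2⟩
  obtain ⟨C, hC⟩ := isCompact_Icc.exists_bound_of_continuousOn (s := Icc (0:ℝ) 4) hc.continuousOn
  refine ⟨C, fun x => ?_⟩
  obtain ⟨y, hy, hxy⟩ := hper.exists_mem_Ico₀ (by norm_num) x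
  rw [hxy]
  exact hC y (Ico_subset_Icc_self hy)

/-- Global solvability for bounded Lipschitz nonlinearities. -/
theorem exists_evol_of_lipschitz {F : ℝ → ℝ} {L M : ℝ} (hL : ∀ a b, |F a - F b| ≤ L * |a - b|)
    (hM : ∀ a, |F a| ≤ M) {u0 : ℝ → ℝ} (hu0 : ContDiffOn ℝ 1 u0 (Icc (-1 : ℝ) 1))
    (hl : u0 (-1) = 0) (hr : u0 1 = 0) :
    ∃ u w a, Evol F u w a ∧ ∀ x ∈ Icc (-1 : ℝ) 1, u x 0 = u0 x := by
  have hL0 : 0 ≤ L := by have := (abs_nonneg _).trans (hL 1 0); simpa using this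
  have hFc : Continuous F := by
    refine (LipschitzWith.of_dist_le_mul (K := ⟨L, hL0⟩) fun a b => ?_).continuous
    simp only [Real.dist_eq]; exact hL a b
  have hM0 : 0 ≤ M := (abs_nonneg _).trans (hM 0)
  obtain ⟨h, g, hh, hg, ⟨G, hG⟩, ⟨G', hG'⟩, heq, ho1, ho2⟩ := exists_odd_extension hu0 hl hr
  have hG0 : 0 ≤ G := (abs_nonneg _).trans (hG 0)
  have hhc : Continuous h := continuous_iff_continuousAt.2 fun y => (hh y).continuousAt
  obtain ⟨w, hw, hweq⟩ := exists_mild hL hM hg hG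
  set f := oddSource F w
  have hfm : ∀ x ∈ Ioo (-1 : ℝ) 1, ∀ s, f x s = F (w x s) := fun x hx s => oddSource_of_mem hx s
  have hf : IsSource f M := isSource_oddSource hFc hM hw
  have hfx : ∀ x ∈ Ioo (-1 : ℝ) 1, ∀ s, ContinuousAt (fun q : ℝ × ℝ => f q.1 q.2) (x, s) :=
    fun x hx s => continuousAt_oddSource hFc hw hx s
  have hH : LocHolder f := by
    intro δ hδ T
    obtain ⟨A, hA0, hA⟩ := hf.duhamel_holder
    set H₁ : ℝ := √(2 * ((∫ z, |heatK0 1 z|) * G) * ((√δ)⁻¹ * ((∫ z, |heatK1 1 z|) * G))) +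
      A * |T| ^ (1 / 4 : ℝ)
    have hH₁ : 0 ≤ H₁ := by positivity
    refine ⟨L * H₁ + 2 * M / √δ, by positivity, fun s hs x hx y => ?_⟩
    have hs0 : 0 < s := hδ.trans_le hs.1
    by_cases hy : y ∈ Ioo (-1 : ℝ) 1
    · have hx' : x ∈ Ioo (-1 : ℝ) 1 := ⟨by linarith [hx.1], by linarith [hx.2]⟩
      have hwh : |w y s - w x s| ≤ H₁ * √|x - y| := by
        rw [abs_sub_comm, hweq x s hs0.le, hweq y s hs0.le, add_sub_add_comm]
        refine (abs_add_le _ _).trans ?_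
        have h1 := heatK0_holder hg.measurable hG hs0 x y
        have h2 := hA s hs0.le x y
        have h3 : (√s)⁻¹ ≤ (√δ)⁻¹ := by
          have := Real.sqrt_pos.2 hδ
          have := Real.sqrt_le_sqrt hs.1
          gcongr
        have h4 : s ≤ |T| := hs.2.trans (le_abs_self T)
        have i0 : 0 ≤ ∫ z, |heatK0 1 z| := integral_nonneg fun z => abs_nonneg _
        have i1 : 0 ≤ ∫ z, |heatK1 1 z| := integral_nonneg fun z => abs_nonneg _
        rw [add_mul]
        refine add_le_add (h1.trans ?_) (h2.trans ?_) <;> gcongr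
      rw [hfm y hy, hfm x hx']
      calc _ ≤ L * (H₁ * √|x - y|) := (hL _ _).trans (by gcongr)
        _ = L * H₁ * √|x - y| := by ring
        _ ≤ _ := by
          gcongr
          exact le_add_of_nonneg_right (by positivity)
    · have hd : δ ≤ |x - y| := by
        rw [mem_Ioo, not_and_or, not_lt, not_lt] at hy
        rcases hy with h | h
        · exact le_trans (by linarith [hx.1]) (le_abs_self _)
        · exact le_trans (by linarith [hx.2]) (neg_le_abs _)
      have h1 : |f y s - f x s| ≤ 2 * M :=
        (abs_sub _ _).trans (by linarith [hf.bdd y s, hf.bdd x s])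
      have hsd := Real.sqrt_pos.2 hδ
      calc _ ≤ 2 * M / √δ * √δ := by rwa [div_mul_cancel₀ _ hsd.ne']
        _ ≤ 2 * M / √δ * √|x - y| := by gcongr
        _ ≤ _ := by
          gcongr
          exact le_add_of_nonneg_left (by positivity)
  have hsc : ∀ {η k : ℝ → ℝ} {N : ℝ}, GaussBdd η → Continuous k → (∀ y, |k y| ≤ N) →
      Continuous fun q : ℝ × ℝ => scaleAvg η √q.2 k q.1 := fun hη hk hN =>
    (continuous_scaleAvg hη hk hN).comp (f := fun c : ℝ × ℝ => (√c.2, c.1)) (by fun_prop)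
  refine ⟨fun x t => scaleAvg (heatK0 1) √t h x + duhamel (fun _ => 1) (heatK0 1) f x t, w,
    fun x t => (√t)⁻¹ * scaleAvg (heatK1 1) √t g x + duhamel (fun τ => τ⁻¹) (heatK2 1) f x t,
    ⟨?_, hw.continuousOn, ?_, ?_, ?_, ?_, ?_⟩, ?_⟩
  · exact (hsc gaussBdd_heatK0 hhc hG').continuousOn.add
      (hf.continuousOn_duhamel_one.mono (prod_mono_left (subset_univ _)))
  · rintro ⟨x, t⟩ ⟨hx, ht⟩
    refine ContinuousAt.continuousWithinAt (ContinuousAt.add (ContinuousAt.mul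
      (ContinuousAt.inv₀ (by fun_prop) (Real.sqrt_pos.2 ht).ne')
      (hsc gaussBdd_heatK1 hg hG).continuousAt) (hf.continuousAt_duhamel2 hH hx ht))
  · intro x hx t ht
    rw [hweq x t ht]
    exact (hasDerivAt_scaleAvg_data gaussBdd_heatK0 hh hG' hg hG √t x).add
      (hf.hasDerivAt_duhamel x ht)
  · intro x hx t ht
    obtain ⟨B, s, hs, hB0, hB⟩ := hf.local_bound hH hx ht
    have e : (fun y => w y t) = fun y => scaleAvg (heatK0 1) √t g y +
        duhamel (fun τ => (√τ)⁻¹) (heatK1 1) f y t := funext fun y => hweq y t ht.le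
    rw [e]
    exact (hasDerivAt_heat_space hg.measurable hG ht x).add
      (hf.hasDerivAt_duhamel' ht.le hs fun y hy τ hτ =>
        hB y hy t ⟨by linarith, by linarith⟩ τ hτ)
  · intro x hx t ht
    refine ((hasDerivAt_heat_time hhc.measurable hG' ht x).add
      (hf.hasDerivAt_duhamel_time hH hx ht (hfx x hx))).congr_deriv ?_
    rw [heat_second_deriv_eq hh hG' hg hG ht, hfm x hx]
    ring
  · intro t ht
    have hodd : ∀ c, (∀ x, h (2 * c - x) = -h x) → (∀ x s, f (2 * c - x) s = -f x s) →
        scaleAvg (heatK0 1) √t h c + duhamel (fun _ => 1) (heatK0 1) f c t = 0 := by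
      intro c h1 h2
      rw [scaleAvg_eq_zero_of_odd heatK0_neg h1, zero_add]
      have h3 : ∀ τ, scaleAvg (heatK0 1) √τ (fun y => f y (t - τ)) c = 0 := fun τ =>
        scaleAvg_eq_zero_of_odd (g := fun y => f y (t - τ)) heatK0_neg (fun y => h2 y _) _
      simp [duhamel, h3]
    constructor
    · refine hodd (-1) (fun x => ?_) fun x s => ?_ <;> rw [show (2 : ℝ) * -1 = -2 by norm_num]
      · exact ho2 x
      · simp only [f, oddSource]
        rw [foldSign_neg_two_sub, foldMap_neg_two_sub, neg_mul]
    · refine hodd 1 (fun x => ?_) fun x s => ?_ <;> rw [mul_one]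
      · exact ho1 x
      · simp only [f, oddSource]
        rw [foldSign_two_sub, foldMap_two_sub, neg_mul]
  · intro x hx
    simp only [Real.sqrt_zero, scaleAvg_heatK0_zero]
    simp [duhamel, heq x hx]

lemma IsLocalMax.second_deriv_nonpos {f f' : ℝ → ℝ} {f'' x : ℝ} (hm : IsLocalMax f x)
    (h1 : ∀ᶠ y in 𝓝 x, HasDerivAt f (f' y) y) (h2 : HasDerivAt f' f'' x) : f'' ≤ 0 := by
  by_contra! h
  have e : deriv f =ᶠ[𝓝 x] f' := h1.mono fun y hy => hy.deriv
  have e2 : deriv (deriv f) x = f'' := by rw [e.deriv_eq, h2.deriv]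
  have hmin : IsLocalMin f x := isLocalMin_of_deriv_deriv_pos (by rwa [e2]) hm.deriv_eq_zero
    h1.self_of_nhds.continuousAt
  have hc : f =ᶠ[𝓝 x] fun _ => f x := by
    filter_upwards [hm, hmin] with y h3 h4 using le_antisymm h3 h4
  have : deriv (deriv f) x = 0 := by
    rw [hc.deriv.deriv_eq]; simp
  linarith

lemma deriv_nonneg_of_left_max {g : ℝ → ℝ} {g' s t : ℝ} (hst : s < t) (hg : HasDerivAt g g' t)
    (hm : ∀ r ∈ Icc s t, g r ≤ g t) : 0 ≤ g' := by
  have h := (hasDerivWithinAt_iff_tendsto_slope' (s := Iio t) (by simp)).1 hg.hasDerivWithinAt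
  refine ge_of_tendsto h ?_
  filter_upwards [Ioo_mem_nhdsLT hst] with r hr
  rw [slope_def_field]
  exact div_nonneg_of_nonpos (by linarith [hm r ⟨hr.1.le, hr.2.le⟩]) (by linarith [hr.2])

/-- A weak maximum principle on a rectangle: a function that is nonpositive on the parabolic
boundary, and satisfies `z_t ≤ z_xx` wherever it is positive with `z_x = 0`, is nonpositive. -/
theorem parabolic_max_principle {z : ℝ → ℝ → ℝ} {a b T : ℝ}
    (hz : ContinuousOn (fun q : ℝ × ℝ => z q.1 q.2) (Icc a b ×ˢ Icc 0 T))
    (h0 : ∀ x ∈ Icc a b, z x 0 ≤ 0) (hbd : ∀ t ∈ Icc 0 T, z a t ≤ 0 ∧ z b t ≤ 0)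
    (hpde : ∀ x ∈ Ioo a b, ∀ t ∈ Ioc 0 T, 0 < z x t → ∃ (zx : ℝ → ℝ) (zxx zt : ℝ),
      (∀ᶠ y in 𝓝 x, HasDerivAt (fun y => z y t) (zx y) y) ∧ HasDerivAt zx zxx x ∧
      HasDerivAt (fun s => z x s) zt t ∧ (zx x = 0 → zt ≤ zxx)) :
    ∀ x ∈ Icc a b, ∀ t ∈ Icc 0 T, z x t ≤ 0 := by
  intro x₀ hx₀ t₀ ht₀
  by_contra! hpos
  have hT : 0 ≤ T := ht₀.1.trans ht₀.2
  set ε := z x₀ t₀ / (2 * (T + 1))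
  have hε : 0 < ε := by positivity
  have hεT : ε * T < z x₀ t₀ := by
    have h1 : ε * (2 * (T + 1)) = z x₀ t₀ := div_mul_cancel₀ _ (by positivity)
    nlinarith
  obtain ⟨⟨x, t⟩, ⟨hx, ht⟩, hmax⟩ := (isCompact_Icc.prod isCompact_Icc).exists_isMaxOn
    (⟨(x₀, t₀), hx₀, ht₀⟩ : (Icc a b ×ˢ Icc 0 T).Nonempty)
    (hz.sub (g := fun q : ℝ × ℝ => ε * q.2) (by fun_prop))
  have hM : ∀ y ∈ Icc a b, ∀ s ∈ Icc 0 T, z y s - ε * s ≤ z x t - ε * t :=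
    fun y hy s hs => hmax (show (y, s) ∈ _ from ⟨hy, hs⟩)
  simp only at hx ht
  have h1 := hM x₀ hx₀ t₀ ht₀
  have hzp : 0 < z x t := by nlinarith [ht₀.2, ht.1]
  have htp : 0 < t := lt_of_le_of_ne ht.1 fun h => by
    have := h0 x hx; rw [h] at this; linarith
  have hxa : a < x := lt_of_le_of_ne hx.1 fun h => by
    have := (hbd t ht).1; rw [h] at this; linarith
  have hxb : x < b := lt_of_le_of_ne hx.2 fun h => by
    have := (hbd t ht).2; rw [← h] at this; linarith
  obtain ⟨zx, zxx, zt, d1, d2, d3, d4⟩ := hpde x ⟨hxa, hxb⟩ t ⟨htp, ht.2⟩ hzp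
  have hloc : IsLocalMax (fun y => z y t) x := by
    filter_upwards [Icc_mem_nhds hxa hxb] with y hy
    linarith [hM y hy t ht]
  have hzx : zx x = 0 := hloc.hasDerivAt_eq_zero d1.self_of_nhds
  have h2 := hloc.second_deriv_nonpos d1 d2
  have h3 : 0 ≤ zt - ε * 1 := deriv_nonneg_of_left_max htp
    (d3.sub ((hasDerivAt_id t).const_mul ε)) fun r hr => by
      simpa using hM x hx r ⟨hr.1, hr.2.trans ht.2⟩
  linarith [d4 hzx]

namespace Evol

variable {F G : ℝ → ℝ} {u w a u' w' a' : ℝ → ℝ → ℝ}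

lemma cont_slab (h : Evol F u w a) (T : ℝ) :
    ContinuousOn (fun q : ℝ × ℝ => u q.1 q.2) (Icc (-1 : ℝ) 1 ×ˢ Icc 0 T) :=
  h.cont_u.mono (prod_mono_right Icc_subset_Ici_self)

lemma ev_deriv (h : Evol F u w a) {x : ℝ} (hx : x ∈ Ioo (-1 : ℝ) 1) {t : ℝ} (ht : 0 ≤ t) :
    ∀ᶠ y in 𝓝 x, HasDerivAt (fun y => u y t) (w y t) y := by
  filter_upwards [isOpen_Ioo.mem_nhds hx] with y hy using h.deriv_u y hy t ht

/-- Multiples of a subsolution stay below a supersolution. -/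
lemma comparison_mul (h : Evol F u w a) (h' : Evol G u' w' a') {l T : ℝ}
    (hFG : ∀ x ∈ Ioo (-1 : ℝ) 1, ∀ t ∈ Ioc 0 T, w' x t = l * w x t →
      l * F (w x t) ≤ G (l * w x t))
    (h0 : ∀ x ∈ Icc (-1 : ℝ) 1, l * u x 0 ≤ u' x 0) :
    ∀ x ∈ Icc (-1 : ℝ) 1, ∀ t ∈ Icc 0 T, l * u x t ≤ u' x t := by
  have := parabolic_max_principle (z := fun x t => l * u x t - u' x t) (a := -1) (b := 1) (T := T)
    (((h.cont_slab T).const_smul l).sub (h'.cont_slab T)) (fun x hx => by linarith [h0 x hx])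
    (fun t ht => by
      simp [(h.bc t ht.1).1, (h.bc t ht.1).2, (h'.bc t ht.1).1, (h'.bc t ht.1).2])
    (fun x hx t ht _ => ⟨fun y => l * w y t - w' y t, l * a x t - a' x t,
      l * (a x t + F (w x t)) - (a' x t + G (w' x t)), ?_,
      ((h.deriv_w x hx t ht.1).const_mul l).sub (h'.deriv_w x hx t ht.1),
      ((h.deriv_t x hx t ht.1).const_mul l).sub (h'.deriv_t x hx t ht.1), fun he => ?_⟩)
  · exact fun x hx t ht => by linarith [this x hx t ht]
  · filter_upwards [h.ev_deriv hx ht.1.le, h'.ev_deriv hx ht.1.le] with y h1 h2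
    exact (h1.const_mul l).sub h2
  · have e : w' x t = l * w x t := by simp only at he; linarith
    have := hFG x hx t ht e
    rw [e]; linarith

lemma comparison (h : Evol F u w a) (h' : Evol G u' w' a') {T : ℝ}
    (hFG : ∀ x ∈ Ioo (-1 : ℝ) 1, ∀ t ∈ Ioc 0 T, w' x t = w x t → F (w x t) ≤ G (w x t))
    (h0 : ∀ x ∈ Icc (-1 : ℝ) 1, u x 0 ≤ u' x 0) :
    ∀ x ∈ Icc (-1 : ℝ) 1, ∀ t ∈ Icc 0 T, u x t ≤ u' x t := by
  have := h.comparison_mul h' (l := 1) (T := T) (by simpa using hFG) (by simpa using h0)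
  simpa using this

lemma shift (h : Evol F u w a) {s : ℝ} (hs : 0 ≤ s) :
    Evol F (fun x t => u x (s + t)) (fun x t => w x (s + t)) (fun x t => a x (s + t)) where
  cont_u := h.cont_u.comp (f := fun q : ℝ × ℝ => (q.1, s + q.2)) (by fun_prop)
    fun q hq => ⟨hq.1, add_nonneg hs hq.2⟩
  cont_w := h.cont_w.comp (f := fun q : ℝ × ℝ => (q.1, s + q.2)) (by fun_prop)
    fun q hq => ⟨hq.1, add_nonneg hs hq.2⟩
  cont_a := h.cont_a.comp (f := fun q : ℝ × ℝ => (q.1, s + q.2)) (by fun_prop)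
    fun q hq => ⟨hq.1, add_pos_of_nonneg_of_pos hs hq.2⟩
  deriv_u x hx t ht := h.deriv_u x hx _ (add_nonneg hs ht)
  deriv_w x hx t ht := h.deriv_w x hx _ (add_pos_of_nonneg_of_pos hs ht)
  deriv_t x hx t ht := by
    have := (h.deriv_t x hx _ (add_pos_of_nonneg_of_pos hs ht)).comp_const_add s t
    exact this
  bc t ht := h.bc _ (add_nonneg hs ht)

lemma zero (hF : F 0 = 0) : Evol F (fun _ _ => 0) (fun _ _ => 0) (fun _ _ => 0) where
  cont_u := continuousOn_const
  cont_w := continuousOn_const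
  cont_a := continuousOn_const
  deriv_u x _ _ _ := hasDerivAt_const x _
  deriv_w x _ _ _ := hasDerivAt_const x _
  deriv_t x _ t _ := by rw [hF, add_zero]; exact hasDerivAt_const t _
  bc _ _ := ⟨rfl, rfl⟩

lemma nonneg (h : Evol F u w a) (hF : F 0 = 0) (h0 : ∀ x ∈ Icc (-1 : ℝ) 1, 0 ≤ u x 0) :
    ∀ x ∈ Icc (-1 : ℝ) 1, ∀ t, 0 ≤ t → 0 ≤ u x t := fun x hx t ht =>
  (zero hF).comparison h (T := t) (fun _ _ _ _ _ => le_rfl) h0 x hx t ⟨ht, le_rfl⟩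

lemma le_of_init_le (h : Evol F u w a) (hF : F 0 = 0) {M : ℝ} (hM : 0 ≤ M)
    (h0 : ∀ x ∈ Icc (-1 : ℝ) 1, u x 0 ≤ M) :
    ∀ x ∈ Icc (-1 : ℝ) 1, ∀ t, 0 ≤ t → u x t ≤ M := by
  intro x hx t ht
  have := parabolic_max_principle (z := fun x t => u x t - M) (a := -1) (b := 1) (T := t)
    ((h.cont_slab t).sub continuousOn_const) (fun x hx => by linarith [h0 x hx])
    (fun t ht => by simp [(h.bc t ht.1).1, (h.bc t ht.1).2, hM])
    (fun x hx t ht _ => ⟨fun y => w y t, a x t, a x t + F (w x t), ?_, h.deriv_w x hx t ht.1,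
      (h.deriv_t x hx t ht.1).sub_const M, fun he => ?_⟩) x hx t ⟨ht, le_rfl⟩
  · linarith
  · filter_upwards [h.ev_deriv hx ht.1.le] with y h1 using h1.sub_const M
  · simp only at he
    rw [he, hF, add_zero]

/-- The boundary gradient bound propagates to the interior. -/
lemma abs_grad_le (h : Evol F u w a) {N T : ℝ}
    (hb : ∀ x ∈ Icc (-1 : ℝ) 1, ∀ t ∈ Icc 0 T, |u x t| ≤ N * (1 + x) ∧ |u x t| ≤ N * (1 - x))
    (h0 : ∀ x ∈ Icc (-1 : ℝ) 1, ∀ y ∈ Icc (-1 : ℝ) 1, |u x 0 - u y 0| ≤ N * |x - y|) :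
    ∀ x ∈ Icc (-1 : ℝ) 1, ∀ t ∈ Icc 0 T, |w x t| ≤ N := by
  have key : ∀ l ∈ ({1, -1} : Set ℝ), ∀ k, 0 < k → k < 2 → ∀ x ∈ Icc (-1 : ℝ) (1 - k),
      ∀ t ∈ Icc 0 T, l * (u (x + k) t - u x t) - N * k ≤ 0 := by
    intro l hl k hk hk2
    have hl1 : |l| = 1 := by rcases hl with rfl | rfl <;> simp
    have hl2 : ∀ r : ℝ, l * r ≤ |r| := fun r => (le_abs_self _).trans (by rw [abs_mul, hl1, one_mul])
    refine parabolic_max_principle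
      (z := fun x t => l * (u (x + k) t - u x t) - N * k) ?_ ?_ ?_ ?_
    · refine ContinuousOn.sub (ContinuousOn.mul continuousOn_const (ContinuousOn.sub
        ((h.cont_slab T).comp (f := fun q : ℝ × ℝ => (q.1 + k, q.2)) (by fun_prop) ?_)
        ((h.cont_slab T).mono ?_))) continuousOn_const
      · exact fun q hq => ⟨⟨by linarith [hq.1.1], by linarith [hq.1.2]⟩, hq.2⟩
      · exact fun q hq => ⟨⟨by linarith [hq.1.1], by linarith [hq.1.2]⟩, hq.2⟩
    · intro x hx
      have := h0 (x + k) ⟨by linarith [hx.1], by linarith [hx.2]⟩ x ⟨hx.1, by linarith [hx.2]⟩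
      rw [add_sub_cancel_left, abs_of_pos hk] at this
      linarith [hl2 (u (x + k) 0 - u x 0)]
    · intro t ht
      constructor
      · have := (hb (-1 + k) ⟨by linarith, by linarith⟩ t ht).1
        rw [(h.bc t ht.1).1, sub_zero]
        linarith [hl2 (u (-1 + k) t)]
      · have := (hb (1 - k) ⟨by linarith, by linarith⟩ t ht).2
        rw [sub_add_cancel, (h.bc t ht.1).2, zero_sub]
        have h3 := hl2 (-u (1 - k) t)
        rw [abs_neg] at h3
        linarith
    · intro x hx t ht _
      have hx1 : x ∈ Ioo (-1 : ℝ) 1 := ⟨hx.1, by linarith [hx.2]⟩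
      have hx2 : x + k ∈ Ioo (-1 : ℝ) 1 := ⟨by linarith [hx.1], by linarith [hx.2]⟩
      refine ⟨fun y => l * (w (y + k) t - w y t), l * (a (x + k) t - a x t),
        l * ((a (x + k) t + F (w (x + k) t)) - (a x t + F (w x t))), ?_, ?_, ?_, fun he => ?_⟩
      · filter_upwards [isOpen_Ioo.mem_nhds hx] with y hy
        have hy1 : y ∈ Ioo (-1 : ℝ) 1 := ⟨hy.1, by linarith [hy.2]⟩
        have hy2 : y + k ∈ Ioo (-1 : ℝ) 1 := ⟨by linarith [hy.1], by linarith [hy.2]⟩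
        exact ((((h.deriv_u _ hy2 t ht.1.le).comp_add_const y k).sub
          (h.deriv_u y hy1 t ht.1.le)).const_mul l).sub_const _
      · exact (((h.deriv_w _ hx2 t ht.1).comp_add_const x k).sub
          (h.deriv_w x hx1 t ht.1)).const_mul l
      · exact (((h.deriv_t _ hx2 t ht.1).sub (h.deriv_t x hx1 t ht.1)).const_mul l).sub_const _
      · have hl0 : l ≠ 0 := by rintro rfl; simp at hl1
        have : w (x + k) t = w x t := by
          have := (mul_eq_zero.1 he).resolve_left hl0
          linarith
        rw [this]; apply le_of_eq; ring
  have hint : ∀ t ∈ Icc 0 T, ∀ x ∈ Ioo (-1 : ℝ) 1, |w x t| ≤ N := by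
    intro t ht x hx
    have hd := (hasDerivWithinAt_iff_tendsto_slope' (s := Ioi x) (by simp)).1
      (h.deriv_u x hx t ht.1).hasDerivWithinAt
    refine le_of_tendsto hd.abs ?_
    filter_upwards [Ioo_mem_nhdsGT hx.2] with y hy
    have hk : 0 < y - x := sub_pos.2 hy.1
    have hxk : x ∈ Icc (-1 : ℝ) (1 - (y - x)) := ⟨hx.1.le, by linarith [hy.2]⟩
    have k1 := key 1 (by simp) (y - x) hk (by linarith [hx.1, hy.2]) x hxk t ht
    have k2 := key (-1) (by simp) (y - x) hk (by linarith [hx.1, hy.2]) x hxk t ht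
    rw [add_sub_cancel] at k1 k2
    rw [slope_def_field, abs_div, abs_of_pos hk, div_le_iff₀ hk, abs_le]
    constructor <;> linarith
  intro x hx t ht
  have hc : ContinuousOn (fun y => |w y t|) (Icc (-1 : ℝ) 1) :=
    (h.cont_w.comp (f := fun y : ℝ => (y, t)) (by fun_prop) fun y hy => ⟨hy, ht.1⟩).abs
  rw [← closure_Ioo (by norm_num : (-1 : ℝ) ≠ 1)] at hx hc
  exact le_on_closure (hint t ht) hc continuousOn_const hx

end Evol

section

variable {p : ℝ} {j : ℕ}

lemma Fj1_nonneg (p : ℝ) (j : ℕ) (ξ : ℝ) : 0 ≤ Fj1 p j ξ := by unfold Fj1; positivity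

lemma Fj1_zero (hp : 2 < p) (j : ℕ) : Fj1 p j 0 = 0 := by
  simp [Fj1, Real.zero_rpow (by linarith : p ≠ 0)]

lemma Fj1_abs (p : ℝ) (j : ℕ) (ξ : ℝ) : Fj1 p j |ξ| = Fj1 p j ξ := by simp [Fj1]

lemma Fj1_neg (p : ℝ) (j : ℕ) (ξ : ℝ) : Fj1 p j (-ξ) = Fj1 p j ξ := by simp [Fj1]

lemma Fj1_le_sq (p : ℝ) (j : ℕ) (ξ : ℝ) : Fj1 p j ξ ≤ (j : ℝ) ^ (p - 2) * ξ ^ 2 := min_le_right _ _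

lemma Fj1_le_rpow (p : ℝ) (j : ℕ) (ξ : ℝ) : Fj1 p j ξ ≤ |ξ| ^ p := min_le_left _ _

lemma Fj1_eq (hp : 2 < p) {ξ : ℝ} (h : |ξ| ≤ j) : Fj1 p j ξ = |ξ| ^ p := by
  refine min_eq_left ?_
  rcases eq_or_ne ξ 0 with rfl | h0
  · simp [Real.zero_rpow (by linarith : p ≠ 0)]
  · have : |ξ| ^ p = |ξ| ^ (p - 2) * ξ ^ 2 := by
      rw [← sq_abs, ← Real.rpow_natCast, ← Real.rpow_add (abs_pos.2 h0)]; norm_num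
    rw [this]
    gcongr

lemma Fj1_mono (hp : 2 < p) {r s : ℝ} (hr : 0 ≤ r) (h : r ≤ s) : Fj1 p j r ≤ Fj1 p j s := by
  unfold Fj1
  rw [abs_of_nonneg hr, abs_of_nonneg (hr.trans h)]
  gcongr

lemma mul_Fj1_le (hp : 2 < p) {l : ℝ} (hl : 1 ≤ l) (ξ : ℝ) : l * Fj1 p j ξ ≤ Fj1 p j (l * ξ) := by
  have h0 : 0 < l := by linarith
  have h1 : l ≤ l ^ p := by
    conv_lhs => rw [← Real.rpow_one l]
    exact Real.rpow_le_rpow_of_exponent_le hl (by linarith)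
  have h2 : l ≤ l ^ 2 := by nlinarith
  unfold Fj1
  rw [mul_min_of_nonneg _ _ h0.le, abs_mul, abs_of_pos h0, Real.mul_rpow h0.le (abs_nonneg _), mul_pow,
    mul_left_comm]
  gcongr

lemma abs_rpow_sub_rpow_le {q : ℝ} (hq : 1 ≤ q) {R r s : ℝ} (hr : r ∈ Icc 0 R) (hs : s ∈ Icc 0 R) :
    |r ^ q - s ^ q| ≤ q * R ^ (q - 1) * |r - s| := by
  have := (convex_Icc 0 R).norm_image_sub_le_of_norm_hasDerivWithin_le (f := fun x : ℝ => x ^ q)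
    (f' := fun x => q * x ^ (q - 1)) (C := q * R ^ (q - 1))
    (fun x hx => (Real.hasDerivAt_rpow_const (Or.inr hq)).hasDerivWithinAt) (fun x hx => ?_) hs hr
  · simpa using this
  · have := hx.1
    rw [Real.norm_of_nonneg (by positivity)]
    have := hx.2
    gcongr

/-- A Lipschitz constant for the regularized Hamiltonian on `[-R, R]`. -/
def FjLip (p : ℝ) (j : ℕ) (R : ℝ) : ℝ := p * R ^ (p - 1) + (j : ℝ) ^ (p - 2) * (2 * R)

lemma FjLip_nonneg (hp : 2 < p) {R : ℝ} (hR : 0 ≤ R) : 0 ≤ FjLip p j R := by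
  unfold FjLip; positivity

lemma Fj1_lipschitz_nonneg (hp : 2 < p) {R r s : ℝ} (hr : r ∈ Icc 0 R) (hs : s ∈ Icc 0 R) :
    |Fj1 p j r - Fj1 p j s| ≤ FjLip p j R * |r - s| := by
  have hR : 0 ≤ R := hr.1.trans hr.2
  have h1 := abs_rpow_sub_rpow_le (q := p) (by linarith) hr hs
  have h2 : |(j : ℝ) ^ (p - 2) * r ^ 2 - (j : ℝ) ^ (p - 2) * s ^ 2| ≤
      (j : ℝ) ^ (p - 2) * (2 * R) * |r - s| := by
    rw [← mul_sub, abs_mul, abs_of_nonneg (by positivity), mul_assoc,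
      show r ^ 2 - s ^ 2 = (r + s) * (r - s) by ring, abs_mul, abs_of_nonneg (add_nonneg hr.1 hs.1)]
    gcongr
    linarith [hr.2, hs.2]
  unfold Fj1
  rw [abs_of_nonneg hr.1, abs_of_nonneg hs.1]
  refine (abs_min_sub_min_le_max _ _ _ _).trans ?_
  have h3 : 0 ≤ p * R ^ (p - 1) * |r - s| := by positivity
  have h4 : 0 ≤ (j : ℝ) ^ (p - 2) * (2 * R) * |r - s| := by positivity
  rw [FjLip, add_mul]
  exact max_le (by linarith) (by linarith)

lemma Fj1_lipschitz (hp : 2 < p) {R a b : ℝ} (ha : |a| ≤ R) (hb : |b| ≤ R) :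
    |Fj1 p j a - Fj1 p j b| ≤ FjLip p j R * |a - b| := by
  rw [← Fj1_abs p j a, ← Fj1_abs p j b]
  refine (Fj1_lipschitz_nonneg hp ⟨abs_nonneg _, ha⟩ ⟨abs_nonneg _, hb⟩).trans ?_
  exact mul_le_mul_of_nonneg_left (abs_abs_sub_abs_le a b)
    (FjLip_nonneg hp ((abs_nonneg a).trans ha))

lemma MemX1.exists_lipschitz {v : ℝ → ℝ} (hv : MemX1 v) :
    ∃ N, 0 < N ∧ ∀ x ∈ Icc (-1 : ℝ) 1, ∀ y ∈ Icc (-1 : ℝ) 1, |v x - v y| ≤ N * |x - y| := by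
  obtain ⟨K, hK⟩ := hv.1.exists_lipschitzOnWith one_ne_zero (convex_Icc _ _) isCompact_Icc
  refine ⟨K + 1, by positivity, fun x hx y hy => ?_⟩
  have := hK.dist_le_mul x hx y hy
  rw [Real.dist_eq, Real.dist_eq] at this
  linarith [abs_nonneg (x - y)]

namespace Evol

variable {F G : ℝ → ℝ} {u w a : ℝ → ℝ → ℝ}

lemma congr (h : Evol F u w a)
    (he : ∀ x ∈ Ioo (-1 : ℝ) 1, ∀ t, 0 < t → F (w x t) = G (w x t)) : Evol G u w a :=
  ⟨h.cont_u, h.cont_w, h.cont_a, h.deriv_u, h.deriv_w,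
    fun x hx t ht => he x hx t ht ▸ h.deriv_t x hx t ht, h.bc⟩

lemma reflect (h : Evol F u w a) (hF : ∀ ξ, F (-ξ) = F ξ) :
    Evol F (fun x t => u (-x) t) (fun x t => -w (-x) t) (fun x t => a (-x) t) := by
  have hm : ∀ x ∈ Ioo (-1 : ℝ) 1, -x ∈ Ioo (-1 : ℝ) 1 := fun x hx =>
    ⟨by linarith [hx.2], by linarith [hx.1]⟩
  have hm' : ∀ x ∈ Icc (-1 : ℝ) 1, -x ∈ Icc (-1 : ℝ) 1 := fun x hx =>
    ⟨by linarith [hx.2], by linarith [hx.1]⟩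
  refine ⟨?_, ?_, ?_, ?_, ?_, ?_, ?_⟩
  · exact h.cont_u.comp (f := fun q : ℝ × ℝ => (-q.1, q.2)) (by fun_prop)
      fun q hq => ⟨hm' _ hq.1, hq.2⟩
  · exact (h.cont_w.comp (f := fun q : ℝ × ℝ => (-q.1, q.2)) (by fun_prop)
      fun q hq => ⟨hm' _ hq.1, hq.2⟩).neg
  · exact h.cont_a.comp (f := fun q : ℝ × ℝ => (-q.1, q.2)) (by fun_prop)
      fun q hq => ⟨hm _ hq.1, hq.2⟩
  · intro x hx t ht
    exact ((h.deriv_u _ (hm x hx) t ht).scomp x (hasDerivAt_neg x)).congr_deriv (by simp)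
  · intro x hx t ht
    exact ((h.deriv_w _ (hm x hx) t ht).scomp x (hasDerivAt_neg x)).neg.congr_deriv (by simp)
  · intro x hx t ht
    exact (h.deriv_t _ (hm x hx) t ht).congr_deriv (by rw [hF])
  · intro t ht
    simpa [and_comm] using h.bc t ht

/-- The logarithmic barrier at the left endpoint. -/
lemma le_mul_of_quadratic (h : Evol F u w a) {K N : ℝ} (hK : 0 < K) (hN : 0 ≤ N)
    (hF : ∀ ξ, F ξ ≤ K * ξ ^ 2)
    (h0 : ∀ x ∈ Icc (-1 : ℝ) 1, u x 0 ≤ N * (1 + x)) :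
    ∀ x ∈ Icc (-1 : ℝ) 1, ∀ t, 0 ≤ t →
      u x t ≤ (Real.exp (2 * K * N) - 1) / (2 * K) * (1 + x) := by
  set A := (Real.exp (2 * K * N) - 1) / 2 with hA
  have hA0 : 0 ≤ A := by
    have : 1 ≤ Real.exp (2 * K * N) := Real.one_le_exp (by positivity)
    rw [hA]; linarith
  have hlog : Real.log (1 + 2 * A) = 2 * K * N := by
    rw [hA, show 1 + 2 * ((Real.exp (2 * K * N) - 1) / 2) = Real.exp (2 * K * N) by ring, Real.log_exp]
  have hpos : ∀ x, -1 ≤ x → 0 < 1 + A * (1 + x) := fun x hx => by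
    have : 0 ≤ A * (1 + x) := mul_nonneg hA0 (by linarith)
    linarith
  have hB1 : ∀ x, -1 < x → HasDerivAt (fun x => K⁻¹ * Real.log (1 + A * (1 + x)))
      (K⁻¹ * (A / (1 + A * (1 + x)))) x := fun x hx => by
    refine HasDerivAt.const_mul _ (HasDerivAt.log ?_ (hpos x hx.le).ne')
    exact ((((hasDerivAt_id x).const_add 1).const_mul A).const_add 1).congr_deriv (by simp)
  have hB2 : ∀ x, -1 < x → HasDerivAt (fun x => K⁻¹ * (A / (1 + A * (1 + x))))
      (-(K * (K⁻¹ * (A / (1 + A * (1 + x)))) ^ 2)) x := fun x hx => by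
    have hd : HasDerivAt (fun x => 1 + A * (1 + x)) A x :=
      ((((hasDerivAt_id x).const_add 1).const_mul A).const_add 1).congr_deriv (by simp)
    refine (((hasDerivAt_const x A).div hd (hpos x hx.le).ne').const_mul K⁻¹).congr_deriv ?_
    have := (hpos x hx.le).ne'
    field_simp
    ring
  have hcB : ContinuousOn (fun x => K⁻¹ * Real.log (1 + A * (1 + x))) (Icc (-1) 1) :=
    continuousOn_const.mul (ContinuousOn.log (by fun_prop) fun x hx => (hpos x hx.1).ne')
  intro x hx t ht
  have key := parabolic_max_principle
    (z := fun x t => u x t - K⁻¹ * Real.log (1 + A * (1 + x))) (a := -1) (b := 1) (T := t)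
    ((h.cont_slab t).sub (hcB.comp continuousOn_fst fun q hq => hq.1)) (fun x hx => ?_)
    (fun t ht => ?_)
    (fun x hx t ht _ => ⟨fun y => w y t - K⁻¹ * (A / (1 + A * (1 + y))),
      a x t - -(K * (K⁻¹ * (A / (1 + A * (1 + x)))) ^ 2), a x t + F (w x t), ?_,
      (h.deriv_w x hx t ht.1).sub (hB2 x hx.1), (h.deriv_t x hx t ht.1).sub_const _,
      fun he => ?_⟩) x hx t ⟨ht, le_rfl⟩
  · have h1 : Real.log (1 + A * (1 + x)) ≤ A * (1 + x) := by
      linarith [Real.log_le_sub_one_of_pos (hpos x hx.1)]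
    have h2 : K⁻¹ * Real.log (1 + A * (1 + x)) ≤ K⁻¹ * (A * (1 + x)) := by gcongr
    have e : (Real.exp (2 * K * N) - 1) / (2 * K) * (1 + x) = K⁻¹ * (A * (1 + x)) := by
      rw [hA]; field_simp
    rw [e]
    linarith
  · have hc := strictConcaveOn_log_Ioi.concaveOn.2 (show (1 : ℝ) ∈ Ioi 0 by simp)
      (show 1 + 2 * A ∈ Ioi (0 : ℝ) by simp; linarith) (show 0 ≤ (1 - x) / 2 by linarith [hx.2])
      (show 0 ≤ (1 + x) / 2 by linarith [hx.1]) (by ring)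
    simp only [smul_eq_mul, Real.log_one, hlog] at hc
    rw [show (1 - x) / 2 * 1 + (1 + x) / 2 * (1 + 2 * A) = 1 + A * (1 + x) by ring] at hc
    have h3 : N * (1 + x) ≤ K⁻¹ * Real.log (1 + A * (1 + x)) := by
      rw [inv_mul_eq_div, le_div_iff₀ hK]; linarith
    linarith [h0 x hx]
  · rw [(h.bc t ht.1).1, (h.bc t ht.1).2]
    have : 0 ≤ K⁻¹ * Real.log (1 + A * (1 + 1)) :=
      mul_nonneg (inv_nonneg.2 hK.le) (Real.log_nonneg (by linarith))
    constructor
    · simp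
    · linarith
  · filter_upwards [isOpen_Ioo.mem_nhds hx] with y hy
    exact (h.deriv_u y hy t ht.1.le).sub (hB1 y hy.1)
  · have e : w x t = K⁻¹ * (A / (1 + A * (1 + x))) := by simp only at he; linarith
    rw [← e]
    linarith [hF (w x t)]

end Evol

lemma MemX1.le_dist {v : ℝ → ℝ} (hv : MemX1 v) {N : ℝ}
    (hN : ∀ x ∈ Icc (-1 : ℝ) 1, ∀ y ∈ Icc (-1 : ℝ) 1, |v x - v y| ≤ N * |x - y|) :
    ∀ x ∈ Icc (-1 : ℝ) 1, v x ≤ N * (1 + x) ∧ v x ≤ N * (1 - x) := by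
  intro x hx
  have h1 := hN x hx (-1) (by simp)
  have h2 := hN x hx 1 (by simp)
  rw [hv.2.2.1, sub_zero, sub_neg_eq_add, abs_of_nonneg (show 0 ≤ x + 1 by linarith [hx.1])] at h1
  rw [hv.2.2.2, sub_zero, abs_of_nonpos (show x - 1 ≤ 0 by linarith [hx.2])] at h2
  have := le_abs_self (v x)
  constructor <;> linarith

/-- Global solvability of the regularized problems, with bounded gradient. -/
theorem exists_evol_Fj1 (hp : 2 < p) (hj : 1 ≤ j) {v : ℝ → ℝ} (hv : MemX1 v) :
    ∃ u w a R, Evol (Fj1 p j) u w a ∧ (∀ x ∈ Icc (-1 : ℝ) 1, u x 0 = v x) ∧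
      (∀ x ∈ Icc (-1 : ℝ) 1, ∀ t, 0 ≤ t → 0 ≤ u x t) ∧
      ∀ x ∈ Icc (-1 : ℝ) 1, ∀ t, 0 ≤ t → |w x t| ≤ R := by
  obtain ⟨N, hN0, hN⟩ := hv.exists_lipschitz
  set K : ℝ := (j : ℝ) ^ (p - 2) with hKdef
  have hK : 0 < K := Real.rpow_pos_of_pos (by exact_mod_cast hj) _
  set R := max N ((Real.exp (2 * K * N) - 1) / (2 * K))
  have hR : 0 ≤ R := hN0.le.trans (le_max_left _ _)
  set T : ℝ → ℝ := fun ξ => Fj1 p j (min |ξ| R) with hT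
  have hmin : ∀ ξ : ℝ, min |ξ| R ∈ Icc 0 R := fun ξ => ⟨le_min (abs_nonneg _) hR, min_le_right _ _⟩
  have hTL : ∀ a b, |T a - T b| ≤ FjLip p j R * |a - b| := fun a b => by
    refine (Fj1_lipschitz_nonneg hp (hmin a) (hmin b)).trans ?_
    refine mul_le_mul_of_nonneg_left ?_ (FjLip_nonneg hp hR)
    refine (abs_min_sub_min_le_max |a| R |b| R).trans ?_
    simpa using abs_abs_sub_abs_le a b
  have hTM : ∀ a, |T a| ≤ Fj1 p j R := fun a => by
    rw [abs_of_nonneg (Fj1_nonneg _ _ _)]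
    exact Fj1_mono hp (hmin a).1 (hmin a).2
  have hTneg : ∀ ξ, T (-ξ) = T ξ := fun ξ => by simp [hT]
  have hT0 : T 0 = 0 := by simp [hT, hR, Fj1_zero hp]
  have hTK : ∀ ξ, T ξ ≤ K * ξ ^ 2 := fun ξ => by
    refine (Fj1_mono hp (hmin ξ).1 (min_le_left _ _)).trans ?_
    rw [Fj1_abs]
    exact Fj1_le_sq _ _ _
  obtain ⟨u, w, a, hE, hi⟩ := exists_evol_of_lipschitz hTL hTM hv.1 hv.2.2.1 hv.2.2.2
  have hnn := hE.nonneg hT0 fun x hx => by rw [hi x hx]; exact hv.2.1 x hx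
  have hd := hv.le_dist hN
  have hl := hE.le_mul_of_quadratic hK hN0.le hTK fun x hx => by
    rw [hi x hx]; exact (hd x hx).1
  have hr := (hE.reflect hTneg).le_mul_of_quadratic hK hN0.le hTK fun x hx => by
    have hx' : -x ∈ Icc (-1 : ℝ) 1 := ⟨by linarith [hx.2], by linarith [hx.1]⟩
    rw [hi _ hx']
    simpa using (hd _ hx').2
  have hw : ∀ x ∈ Icc (-1 : ℝ) 1, ∀ t, 0 ≤ t → |w x t| ≤ R := fun x hx t ht => by
    refine hE.abs_grad_le (N := R) (T := t) (fun y hy s hs => ?_) (fun y hy z hz => ?_) x hx t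
      ⟨ht, le_rfl⟩
    · rw [abs_of_nonneg (hnn y hy s hs.1)]
      have hRle := le_max_right N ((Real.exp (2 * K * N) - 1) / (2 * K))
      constructor
      · exact (hl y hy s hs.1).trans (mul_le_mul_of_nonneg_right hRle (by linarith [hy.1]))
      · have := hr (-y) ⟨by linarith [hy.2], by linarith [hy.1]⟩ s hs.1
        rw [neg_neg, ← sub_eq_add_neg] at this
        exact this.trans (mul_le_mul_of_nonneg_right hRle (by linarith [hy.2]))
    · rw [hi y hy, hi z hz]
      exact (hN y hy z hz).trans (mul_le_mul_of_nonneg_right (le_max_left _ _) (abs_nonneg _))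
  refine ⟨u, w, a, R, hE.congr fun x hx t ht => ?_, hi, hnn, hw⟩
  simp only [hT]
  rw [min_eq_left (hw x (Ioo_subset_Icc_self hx) t ht.le), Fj1_abs]

end

section

variable {p : ℝ} {j : ℕ}

lemma contDiffOn_one_of_hasDerivAt {f f' : ℝ → ℝ} {s : Set ℝ} (hs : IsOpen s)
    (hd : ∀ x ∈ s, HasDerivAt f (f' x) x) (hc : ContinuousOn f' s) : ContDiffOn ℝ 1 f s := by
  rw [show (1 : WithTop ℕ∞) = 0 + 1 by norm_num, contDiffOn_succ_iff_deriv_of_isOpen hs]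
  refine ⟨fun x hx => (hd x hx).differentiableAt.differentiableWithinAt, by simp, ?_⟩
  exact (contDiffOn_zero.2 hc).congr fun x hx => (hd x hx).deriv

lemma contDiffOn_two_of_hasDerivAt {f f' f'' : ℝ → ℝ} {s : Set ℝ} (hs : IsOpen s)
    (hd : ∀ x ∈ s, HasDerivAt f (f' x) x) (hd' : ∀ x ∈ s, HasDerivAt f' (f'' x) x)
    (hc : ContinuousOn f'' s) : ContDiffOn ℝ 2 f s := by
  rw [show (2 : WithTop ℕ∞) = 1 + 1 by norm_num, contDiffOn_succ_iff_deriv_of_isOpen hs]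
  refine ⟨fun x hx => (hd x hx).differentiableAt.differentiableWithinAt, by simp, ?_⟩
  exact (contDiffOn_one_of_hasDerivAt hs hd' hc).congr fun x hx => (hd x hx).deriv

lemma continuous_Fj1 (hp : 2 < p) (j : ℕ) : Continuous (Fj1 p j) := by
  unfold Fj1
  exact (continuous_abs.rpow_const fun _ => Or.inr (by linarith)).min (by fun_prop)

namespace Evol

variable {F G : ℝ → ℝ} {u w a u' w' a' : ℝ → ℝ → ℝ}

lemma time_reg (h : Evol F u w a) (hF : Continuous F) {x : ℝ} (hx : x ∈ Ioo (-1 : ℝ) 1) :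
    ContDiffOn ℝ 1 (fun s => u x s) (Ioi (0 : ℝ)) := by
  refine contDiffOn_one_of_hasDerivAt isOpen_Ioi (fun t ht => h.deriv_t x hx t ht) ?_
  refine (h.cont_a.comp (f := fun s : ℝ => (x, s)) (by fun_prop) fun s hs => ⟨hx, hs⟩).add
    (hF.comp_continuousOn (h.cont_w.comp (f := fun s : ℝ => (x, s)) (by fun_prop)
      fun s hs => ⟨Ioo_subset_Icc_self hx, Ioi_subset_Ici_self hs⟩))

lemma space_reg (h : Evol F u w a) {t : ℝ} (ht : 0 < t) :
    ContDiffOn ℝ 2 (fun y => u y t) (Ioo (-1 : ℝ) 1) :=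
  contDiffOn_two_of_hasDerivAt isOpen_Ioo (fun x hx => h.deriv_u x hx t ht.le)
    (fun x hx => h.deriv_w x hx t ht)
    (h.cont_a.comp (f := fun y : ℝ => (y, t)) (by fun_prop) fun y hy => ⟨hy, ht⟩)

lemma eqn (h : Evol F u w a) {x : ℝ} (hx : x ∈ Ioo (-1 : ℝ) 1) {t : ℝ} (ht : 0 < t) :
    deriv (fun s => u x s) t
      = deriv (deriv (fun y => u y t)) x + F (deriv (fun y => u y t) x) := by
  have e : deriv (fun y => u y t) =ᶠ[𝓝 x] fun y => w y t :=
    (h.ev_deriv hx ht.le).mono fun y hy => hy.deriv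
  rw [(h.deriv_t x hx t ht).deriv, e.deriv_eq, (h.deriv_w x hx t ht).deriv,
    (h.deriv_u x hx t ht.le).deriv]

lemma isRegSol1 (hp : 2 < p) (h : Evol (Fj1 p j) u w a) {v : ℝ → ℝ}
    (hi : ∀ x ∈ Icc (-1 : ℝ) 1, u x 0 = v x)
    (hn : ∀ x ∈ Icc (-1 : ℝ) 1, ∀ t, 0 ≤ t → 0 ≤ u x t) : IsRegSol1 p j v u where
  cont := h.cont_u
  nonneg := hn
  time_reg _ hx := h.time_reg (continuous_Fj1 hp j) hx
  space_reg _ ht := h.space_reg ht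
  eqn _ hx _ ht := h.eqn hx ht
  bc t ht := h.bc t (le_of_lt ht)
  ic := hi

lemma isClassicalSol1Global (hp : 2 < p) (h : Evol (fun ξ => |ξ| ^ p) u w a) {v : ℝ → ℝ}
    (hi : ∀ x ∈ Icc (-1 : ℝ) 1, u x 0 = v x) : IsClassicalSol1Global p v u where
  cont := h.cont_u
  deriv_cont := ⟨fun q => w q.1 q.2, h.cont_w, fun x hx t ht =>
    (h.deriv_u x hx t (le_of_lt ht)).deriv.symm⟩
  time_reg _ hx := h.time_reg (continuous_abs.rpow_const fun _ => Or.inr (by linarith)) hx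
  space_reg _ ht := h.space_reg ht
  eqn _ hx _ ht := h.eqn hx ht
  bc t ht := h.bc t ht
  ic := hi

lemma grad_eq (h : Evol F u w a) (h' : Evol G u' w' a') {t : ℝ} (ht : 0 ≤ t)
    (he : ∀ x ∈ Icc (-1 : ℝ) 1, u x t = u' x t) : ∀ x ∈ Icc (-1 : ℝ) 1, w x t = w' x t := by
  have hI : EqOn (fun x => w x t) (fun x => w' x t) (Ioo (-1 : ℝ) 1) := fun x hx => by
    have e : (fun y => u y t) =ᶠ[𝓝 x] fun y => u' y t := by
      filter_upwards [isOpen_Ioo.mem_nhds hx] with y hy using he y (Ioo_subset_Icc_self hy)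
    exact (h.deriv_u x hx t ht).unique ((h'.deriv_u x hx t ht).congr_of_eventuallyEq e)
  have hc : ∀ {F u w a}, Evol F u w a → ContinuousOn (fun x => w x t) (Icc (-1 : ℝ) 1) :=
    fun h => h.cont_w.comp (f := fun y : ℝ => (y, t)) (by fun_prop) fun y hy => ⟨hy, ht⟩
  exact hI.of_subset_closure (hc h) (hc h') Ioo_subset_Icc_self
    (by rw [closure_Ioo (by norm_num : (-1 : ℝ) ≠ 1)])

lemma second_deriv_eq (h : Evol F u w a) (h' : Evol G u' w' a') {t : ℝ} (ht : 0 < t)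
    (he : ∀ x ∈ Icc (-1 : ℝ) 1, u x t = u' x t) : ∀ x ∈ Ioo (-1 : ℝ) 1, a x t = a' x t := by
  intro x hx
  have e : (fun y => w y t) =ᶠ[𝓝 x] fun y => w' y t := by
    filter_upwards [isOpen_Ioo.mem_nhds hx] with y hy
      using h.grad_eq h' ht.le he y (Ioo_subset_Icc_self hy)
  exact (h.deriv_w x hx t ht).unique ((h'.deriv_w x hx t ht).congr_of_eventuallyEq e)

/-- Uniqueness, for equations that agree along the gradients of one of the solutions. -/
lemma unique (h : Evol F u w a) (h' : Evol G u' w' a') {T : ℝ}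
    (hFG : ∀ x ∈ Ioo (-1 : ℝ) 1, ∀ t ∈ Ioc 0 T, w x t = w' x t → F (w x t) = G (w x t))
    (h0 : ∀ x ∈ Icc (-1 : ℝ) 1, u x 0 = u' x 0) :
    ∀ x ∈ Icc (-1 : ℝ) 1, ∀ t ∈ Icc 0 T, u x t = u' x t := fun x hx t ht =>
  le_antisymm
    (h.comparison h' (fun x hx t ht e => (hFG x hx t ht e.symm).le) (fun x hx => (h0 x hx).le)
      x hx t ht)
    (h'.comparison h (fun x hx t ht e => e ▸ (hFG x hx t ht e).ge) (fun x hx => (h0 x hx).ge)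
      x hx t ht)

end Evol

lemma continuousOn_of_eventually_nat {f : ℝ → ℝ → ℝ} {f' : ℕ → ℝ → ℝ → ℝ} {s I : Set ℝ}
    (hc : ∀ n, ContinuousOn (fun q : ℝ × ℝ => f' n q.1 q.2) (s ×ˢ I))
    (he : ∀ n : ℕ, ∀ x ∈ s, ∀ t ∈ I, t ≤ n → f x t = f' n x t) :
    ContinuousOn (fun q : ℝ × ℝ => f q.1 q.2) (s ×ˢ I) := by
  rintro ⟨x, t⟩ ⟨hx, ht⟩
  obtain ⟨n, hn⟩ := exists_nat_gt t
  refine (hc n (x, t) ⟨hx, ht⟩).congr_of_eventuallyEq ?_ (he n x hx t ht hn.le)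
  have : ∀ᶠ q : ℝ × ℝ in 𝓝 (x, t), q.2 < n := continuous_snd.continuousAt.eventually_lt_const hn
  filter_upwards [self_mem_nhdsWithin, nhdsWithin_le_nhds this] with q hq hq2
  exact he n _ hq.1 _ hq.2 hq2.le

/-- Regularized solutions whose gradients stay below the truncation level on arbitrarily long time
intervals produce a global classical solution. -/
theorem exists_classical_of_local (hp : 2 < p) {v : ℝ → ℝ}
    (H : ∀ T : ℝ, ∃ (j : ℕ) (u w a : ℝ → ℝ → ℝ), Evol (Fj1 p j) u w a ∧
      (∀ x ∈ Icc (-1 : ℝ) 1, u x 0 = v x) ∧ ∀ x ∈ Icc (-1 : ℝ) 1, ∀ t ∈ Icc 0 T, |w x t| ≤ j) :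
    ∃ u, IsClassicalSol1Global p v u := by
  choose j u w a hE hi hw using fun n : ℕ => H n
  have hu : ∀ n m : ℕ, n ≤ m → ∀ x ∈ Icc (-1 : ℝ) 1, ∀ t ∈ Icc (0 : ℝ) n,
      u n x t = u m x t := by
    intro n m hnm
    have hnm' : (n : ℝ) ≤ m := by exact_mod_cast hnm
    refine (hE n).unique (hE m) (fun x hx t ht e => ?_) fun x hx => by rw [hi n x hx, hi m x hx]
    have hx' := Ioo_subset_Icc_self hx
    rw [Fj1_eq hp (hw n x hx' t ⟨ht.1.le, ht.2⟩),
      Fj1_eq hp (e ▸ hw m x hx' t ⟨ht.1.le, ht.2.trans hnm'⟩)]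
  set k : ℝ → ℕ := fun t => ⌈t⌉₊
  have hk : ∀ t, t ≤ k t := Nat.le_ceil
  have hkn : ∀ {t : ℝ} {n : ℕ}, t ≤ n → k t ≤ n := fun h => Nat.ceil_le.2 h
  have eu : ∀ n : ℕ, ∀ x ∈ Icc (-1 : ℝ) 1, ∀ t ∈ Ici (0 : ℝ), t ≤ n →
      u (k t) x t = u n x t := fun n x hx t ht htn =>
    hu _ _ (hkn htn) x hx t ⟨ht, hk t⟩
  have ew : ∀ n : ℕ, ∀ x ∈ Icc (-1 : ℝ) 1, ∀ t ∈ Ici (0 : ℝ), t ≤ n →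
      w (k t) x t = w n x t := fun n x hx t ht htn =>
    (hE _).grad_eq (hE n) ht (fun y hy => eu n y hy t ht htn) x hx
  have ea : ∀ n : ℕ, ∀ x ∈ Ioo (-1 : ℝ) 1, ∀ t ∈ Ioi (0 : ℝ), t ≤ n →
      a (k t) x t = a n x t := fun n x hx t ht htn =>
    (hE _).second_deriv_eq (hE n) ht (fun y hy => eu n y hy t (Ioi_subset_Ici_self ht) htn) x hx
  refine ⟨fun x t => u (k t) x t, Evol.isClassicalSol1Global hp
    (w := fun x t => w (k t) x t) (a := fun x t => a (k t) x t) ?_ fun x hx => hi _ x hx⟩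
  refine ⟨continuousOn_of_eventually_nat (fun n => (hE n).cont_u) eu,
    continuousOn_of_eventually_nat (fun n => (hE n).cont_w) ew,
    continuousOn_of_eventually_nat (fun n => (hE n).cont_a) ea,
    fun x hx t ht => (hE _).deriv_u x hx t ht, fun x hx t ht => (hE _).deriv_w x hx t ht,
    fun x hx t ht => ?_, fun t ht => (hE _).bc t ht⟩
  have hx' := Ioo_subset_Icc_self hx
  obtain ⟨n, hn⟩ := exists_nat_gt t
  have hd := (hE n).deriv_t x hx t ht
  rw [Fj1_eq hp (hw n x hx' t ⟨ht.le, hn.le⟩), ← ea n x hx t ht hn.le,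
    ← ew n x hx' t ht.le hn.le] at hd
  refine hd.congr_of_eventuallyEq ?_
  filter_upwards [Ioo_mem_nhds ht hn] with s hs using eu n x hx' s hs.1.le hs.2.le

end

lemma hopf_barrier_ineq {κ A B L ρ0 ρ d q qt : ℝ} (hκ : 0 < κ) (hA : 0 ≤ A) (hL : 0 ≤ L)
    (hρ0 : 0 < ρ0) (hρ : ρ0 ≤ ρ) (hρ1 : ρ ≤ 1) (hq : q = ρ ^ 2 - d ^ 2) (hq0 : 0 < q)
    (hB : qt + 2 + 2 * L ≤ B) (h1 : B ≤ 2 * κ * ρ0 ^ 2)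
    (h2 : κ * B ≤ A * (1 - Real.exp (-(κ * ρ0 ^ 2 / 2)))) :
    -A * (Real.exp (κ * q) - 1) + Real.exp (κ * q) * (κ * qt) + L * (Real.exp (κ * q) * (κ * (2 * |d|)))
      ≤ Real.exp (κ * q) * (4 * κ ^ 2 * d ^ 2 - 2 * κ) := by
  set E := Real.exp (κ * q) with hE
  have hE0 : 0 < E := Real.exp_pos _
  have hE1 : 1 ≤ E := Real.one_le_exp (by positivity)
  have hd : |d| ≤ 1 := by
    rw [abs_le_one_iff_mul_self_le_one]; nlinarith
  have hLd : 2 * L * |d| ≤ 2 * L := by nlinarith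
  have key : κ * (qt + 2 + 2 * L * |d| - 4 * κ * d ^ 2) * E ≤ A * (E - 1) := by
    rcases le_total (ρ ^ 2 / 2) (d ^ 2) with h | h
    · have h3 : ρ0 ^ 2 ≤ ρ ^ 2 := by gcongr
      have h4 : 2 * κ * ρ0 ^ 2 ≤ 4 * κ * d ^ 2 := by nlinarith
      have h5 : qt + 2 + 2 * L * |d| - 4 * κ * d ^ 2 ≤ 0 := by linarith
      have h6 : κ * (qt + 2 + 2 * L * |d| - 4 * κ * d ^ 2) * E ≤ 0 :=
        mul_nonpos_of_nonpos_of_nonneg (mul_nonpos_of_nonneg_of_nonpos hκ.le h5) hE0.le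
      have h7 : 0 ≤ A * (E - 1) := mul_nonneg hA (by linarith)
      linarith
    · have h3 : ρ0 ^ 2 ≤ ρ ^ 2 := by gcongr
      have h4 : κ * ρ0 ^ 2 / 2 ≤ κ * q := by rw [hq]; nlinarith
      have h5 : Real.exp (-(κ * ρ0 ^ 2 / 2)) * E ≥ 1 := by
        rw [hE, ← Real.exp_add]; exact Real.one_le_exp (by linarith)
      have h6 : A * (1 - Real.exp (-(κ * ρ0 ^ 2 / 2))) * E ≤ A * (E - 1) := by
        rw [mul_assoc]; gcongr; linarith
      have h7 : κ * (qt + 2 + 2 * L * |d| - 4 * κ * d ^ 2) ≤ κ * B := by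
        gcongr
        have : 0 ≤ 4 * κ * d ^ 2 := by positivity
        linarith
      calc _ ≤ κ * B * E := by gcongr
        _ ≤ _ := (by gcongr : κ * B * E ≤ A * (1 - Real.exp (-(κ * ρ0 ^ 2 / 2))) * E).trans h6
  nlinarith

lemma hopf_speed_le {ρ ρ0 d c0 T : ℝ} (hT : 0 < T) (h0 : 0 ≤ ρ0) (hρ0 : 0 ≤ ρ) (hρ : ρ ≤ 1)
    (hd : |d| ≤ 1) (hc : |c0| ≤ 1) : 2 * ρ * ((1 - ρ0) / T) - 2 * d * (c0 / T) ≤ 4 / T := by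
  have h1 : -(d * c0) ≤ 1 := by
    refine (neg_le_abs _).trans ?_
    rw [abs_mul]
    exact mul_le_one₀ hd (abs_nonneg _) hc
  rw [show 2 * ρ * ((1 - ρ0) / T) - 2 * d * (c0 / T) = (2 * ρ * (1 - ρ0) + 2 * -(d * c0)) / T by ring]
  refine div_le_div_of_nonneg_right ?_ hT.le
  nlinarith

set_option maxHeartbeats 1000000 in
/-- A quantitative strong maximum principle with the Hopf boundary estimate. -/
theorem Evol.hopf {F : ℝ → ℝ} {u w a u' w' a' : ℝ → ℝ → ℝ} (h : Evol F u w a)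
    (h' : Evol F u' w' a') {L T : ℝ} (hT : 0 < T) (hL0 : 0 ≤ L)
    (hL : ∀ x ∈ Ioo (-1 : ℝ) 1, ∀ t ∈ Ioc 0 T, |F (w x t) - F (w' x t)| ≤ L * |w x t - w' x t|)
    (h0 : ∀ x ∈ Icc (-1 : ℝ) 1, u' x 0 ≤ u x 0) (hne : ∃ x ∈ Icc (-1 : ℝ) 1, u' x 0 < u x 0) :
    ∃ c > 0, ∀ x ∈ Icc (-1 : ℝ) 1, u' x T + c * (1 - x ^ 2) ≤ u x T := by
  obtain ⟨c0, hc0', hlt⟩ := hne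
  have hc0 : c0 ∈ Ioo (-1 : ℝ) 1 := by
    refine ⟨lt_of_le_of_ne hc0'.1 ?_, lt_of_le_of_ne hc0'.2 ?_⟩ <;> rintro rfl
    · rw [(h.bc 0 le_rfl).1, (h'.bc 0 le_rfl).1] at hlt; exact hlt.false
    · rw [(h.bc 0 le_rfl).2, (h'.bc 0 le_rfl).2] at hlt; exact hlt.false
  set ε0 := (u c0 0 - u' c0 0) / 2
  have hε0 : 0 < ε0 := by simp only [ε0]; linarith
  obtain ⟨ρ0, hρ0, hρ01, hρc, hball⟩ : ∃ ρ0 > 0, ρ0 ≤ 1 ∧ ρ0 ≤ 1 - |c0| ∧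
      ∀ x ∈ Icc (-1 : ℝ) 1, |x - c0| < ρ0 → ε0 ≤ u x 0 - u' x 0 := by
    have hcont : ContinuousOn (fun x => u x 0 - u' x 0) (Icc (-1 : ℝ) 1) :=
      (h.cont_u.comp (f := fun x : ℝ => (x, (0 : ℝ))) (by fun_prop) fun x hx => ⟨hx, self_mem_Ici⟩).sub
      (h'.cont_u.comp (f := fun x : ℝ => (x, (0 : ℝ))) (by fun_prop) fun x hx => ⟨hx, self_mem_Ici⟩)
    obtain ⟨δ, hδ, hδ'⟩ := Metric.continuousWithinAt_iff.1 (hcont c0 hc0') ε0 hε0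
    have hc1 : 0 < 1 - |c0| := by rw [sub_pos, abs_lt]; exact hc0
    refine ⟨min δ (1 - |c0|), lt_min hδ hc1, (min_le_right _ _).trans (by linarith [abs_nonneg c0]),
      min_le_right _ _, fun x hx hxd => ?_⟩
    have h1 := hδ' hx (hxd.trans_le (min_le_left _ _))
    rw [Real.dist_eq, abs_lt] at h1
    have : u c0 0 - u' c0 0 = 2 * ε0 := by simp only [ε0]; ring
    linarith [h1.1]
  set B := 4 / T + 2 + 2 * L with hB
  have hB0 : 0 < B := by positivity
  set κ := B / (2 * ρ0 ^ 2) with hκdef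
  have hκ : 0 < κ := by positivity
  have hκB : B ≤ 2 * κ * ρ0 ^ 2 := by rw [hκdef]; apply le_of_eq; field_simp
  have hexp : 0 < 1 - Real.exp (-(κ * ρ0 ^ 2 / 2)) := by
    rw [sub_pos, Real.exp_lt_one_iff]
    have : 0 < κ * ρ0 ^ 2 / 2 := by positivity
    linarith
  set A := κ * B / (1 - Real.exp (-(κ * ρ0 ^ 2 / 2))) with hAdef
  have hA : 0 < A := by positivity
  have hAB : κ * B ≤ A * (1 - Real.exp (-(κ * ρ0 ^ 2 / 2))) := by
    rw [hAdef, div_mul_cancel₀ _ hexp.ne']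
  set ε := ε0 * Real.exp (-κ)
  have hε : 0 < ε := by positivity
  set c : ℝ → ℝ := fun t => c0 * (1 - t / T)
  set ρ : ℝ → ℝ := fun t => ρ0 + (1 - ρ0) * (t / T)
  set q : ℝ → ℝ → ℝ := fun x t => ρ t ^ 2 - (x - c t) ^ 2 with hq
  set φ : ℝ → ℝ → ℝ := fun x t => ε * Real.exp (-A * t) * (Real.exp (κ * q x t) - 1) with hφ
  have hs : ∀ t ∈ Icc 0 T, 0 ≤ t / T ∧ t / T ≤ 1 := fun t ht =>
    ⟨div_nonneg ht.1 hT.le, (div_le_one hT).2 ht.2⟩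
  have hρb : ∀ t ∈ Icc 0 T, ρ0 ≤ ρ t ∧ ρ t ≤ 1 := fun t ht => by
    have := hs t ht
    constructor <;> simp only [ρ] <;> nlinarith
  have hφ0 : ∀ x t, q x t ≤ 0 → φ x t ≤ 0 := fun x t hxt => by
    have : Real.exp (κ * q x t) ≤ 1 :=
      Real.exp_le_one_iff.2 (mul_nonpos_of_nonneg_of_nonpos hκ.le hxt)
    exact mul_nonpos_of_nonneg_of_nonpos (by positivity) (by linarith)
  have hφc : Continuous fun z : ℝ × ℝ => φ z.1 z.2 := by
    simp only [hφ, hq, ρ, c]; fun_prop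
  have hcomp := h'.comparison h (T := T) (fun _ _ _ _ _ => le_rfl) h0
  have hdq : ∀ x t, HasDerivAt (fun y => q y t) (-2 * (x - c t)) x := fun x t =>
    ((((hasDerivAt_id x).sub_const (c t)).pow 2).const_sub (ρ t ^ 2)).congr_deriv (by
      simp only [id]; push_cast; ring)
  have hdE : ∀ x t, HasDerivAt (fun y => Real.exp (κ * q y t))
      (Real.exp (κ * q x t) * (κ * (-2 * (x - c t)))) x := fun x t =>
    ((hdq x t).const_mul κ).exp
  have hdφ : ∀ x t, HasDerivAt (fun y => φ y t)
      (ε * Real.exp (-A * t) * (Real.exp (κ * q x t) * (κ * (-2 * (x - c t))))) x := fun x t =>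
    ((hdE x t).sub_const 1).const_mul _
  have hdφ2 : ∀ x t, HasDerivAt
      (fun y => ε * Real.exp (-A * t) * (Real.exp (κ * q y t) * (κ * (-2 * (y - c t)))))
      (ε * Real.exp (-A * t) *
        (Real.exp (κ * q x t) * (4 * κ ^ 2 * (x - c t) ^ 2 - 2 * κ))) x := fun x t => by
    refine (((hdE x t).mul (((((hasDerivAt_id x).sub_const (c t)).const_mul (-2)).const_mul
      κ))).const_mul _).congr_deriv ?_
    simp only [id]; ring
  set qt : ℝ → ℝ → ℝ := fun x t => 2 * ρ t * ((1 - ρ0) / T) - 2 * (x - c t) * (c0 / T) with hqt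
  have hdt : ∀ x t, HasDerivAt (fun s => φ x s) (ε * Real.exp (-A * t) *
      (-A * (Real.exp (κ * q x t) - 1) + Real.exp (κ * q x t) * (κ * qt x t))) t := fun x t => by
    have d1 : HasDerivAt ρ ((1 - ρ0) / T) t :=
      ((((hasDerivAt_id t).div_const T).const_mul (1 - ρ0)).const_add ρ0).congr_deriv (by ring)
    have d2 : HasDerivAt c (-c0 / T) t :=
      ((((hasDerivAt_id t).div_const T).const_sub 1).const_mul c0).congr_deriv (by ring)
    have d3 : HasDerivAt (fun s => q x s) (qt x t) t :=
      ((d1.pow 2).sub ((d2.const_sub x).pow 2)).congr_deriv (by simp only [hqt]; push_cast; ring)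
    have d4 : HasDerivAt (fun s => ε * Real.exp (-A * s)) (ε * (Real.exp (-A * t) * -A)) t :=
      (((hasDerivAt_id t).const_mul (-A)).exp.const_mul ε).congr_deriv (by simp)
    exact (d4.mul (((d3.const_mul κ).exp).sub_const 1)).congr_deriv (by ring)
  have main := parabolic_max_principle (z := fun x t => φ x t - (u x t - u' x t))
    (a := -1) (b := 1) (T := T) (hφc.continuousOn.sub ((h.cont_slab T).sub (h'.cont_slab T)))
    (fun x hx => ?_) (fun t ht => ?_) (fun x hx t ht hpos => ⟨fun y =>
      ε * Real.exp (-A * t) * (Real.exp (κ * q y t) * (κ * (-2 * (y - c t)))) - (w y t - w' y t),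
      _, _, ?_, (hdφ2 x t).sub ((h.deriv_w x hx t ht.1).sub (h'.deriv_w x hx t ht.1)),
      (hdt x t).sub ((h.deriv_t x hx t ht.1).sub (h'.deriv_t x hx t ht.1)), fun he => ?_⟩)
  · refine ⟨ε * Real.exp (-A * T) * κ, by positivity, fun x hx => ?_⟩
    have h1 := main x hx T ⟨hT.le, le_rfl⟩
    have hqT : q x T = 1 - x ^ 2 := by simp [hq, ρ, c, hT.ne']
    have h2 : ε * Real.exp (-A * T) * (κ * (1 - x ^ 2)) ≤ φ x T := by
      simp only [hφ, hqT]
      gcongr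
      linarith [Real.add_one_le_exp (κ * (1 - x ^ 2))]
    linarith
  · have hu := h0 x hx
    rcases le_or_gt (q x 0) 0 with hq0 | hq0
    · linarith [hφ0 x 0 hq0]
    · have e : q x 0 = ρ0 ^ 2 - (x - c0) ^ 2 := by simp [hq, ρ, c]
      have hx1 : |x - c0| < ρ0 := abs_lt_of_sq_lt_sq (by linarith) hρ0.le
      have h1 := hball x hx hx1
      have h2 : κ * q x 0 ≤ κ := by
        have : q x 0 ≤ 1 := by rw [e]; nlinarith [sq_nonneg (x - c0)]
        nlinarith
      have h3 : φ x 0 ≤ ε0 := by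
        simp only [hφ, ε, mul_zero, Real.exp_zero, mul_one]
        have h4 : Real.exp (κ * q x 0) ≤ Real.exp κ := Real.exp_le_exp.2 h2
        have h5 : Real.exp (-κ) * Real.exp κ = 1 := by rw [← Real.exp_add]; simp
        calc ε0 * Real.exp (-κ) * (Real.exp (κ * q x 0) - 1)
            ≤ ε0 * Real.exp (-κ) * Real.exp κ := by gcongr; linarith
          _ = ε0 := by rw [mul_assoc, h5, mul_one]
      linarith
  · rw [(h.bc t ht.1).1, (h.bc t ht.1).2, (h'.bc t ht.1).1, (h'.bc t ht.1).2]
    have hst := hs t ht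
    have hcl : |c0| * (1 - t / T) ≤ (1 - ρ0) * (1 - t / T) := by
      gcongr
      · linarith
      · linarith
    have hc1 : |c t| ≤ 1 - ρ t := by
      simp only [c, ρ]
      rw [abs_mul, abs_of_nonneg (show 0 ≤ 1 - t / T by linarith)]
      linarith
    have hρt := hρb t ht
    rw [abs_le] at hc1
    have q1 : q (-1) t ≤ 0 := by simp only [hq]; nlinarith
    have q2 : q 1 t ≤ 0 := by simp only [hq]; nlinarith
    constructor <;> linarith [hφ0 _ _ q1, hφ0 _ _ q2]
  · filter_upwards [h.ev_deriv hx ht.1.le, h'.ev_deriv hx ht.1.le] with y h1 h2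
    exact (hdφ y t).sub (h1.sub h2)
  · have ht' : t ∈ Icc 0 T := ⟨ht.1.le, ht.2⟩
    have hx' := Ioo_subset_Icc_self hx
    have hq0 : 0 < q x t := by
      by_contra! hle
      linarith [hφ0 x t hle, hcomp x hx' t ht']
    have hρt := hρb t ht'
    have hd : |x - c t| ≤ 1 := by
      rw [abs_le_one_iff_mul_self_le_one]; simp only [hq] at hq0; nlinarith
    have hqtB : qt x t + 2 + 2 * L ≤ B := by
      have := hopf_speed_le hT hρ0.le (hρ0.le.trans hρt.1) hρt.2 hd (show |c0| ≤ 1 by linarith)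
      simp only [hqt]
      linarith
    have hin := hopf_barrier_ineq hκ hA.le hL0 hρ0 hρt.1 hρt.2 (d := x - c t) (q := q x t) rfl hq0 hqtB
      hκB hAB
    have hw : w x t - w' x t =
        ε * Real.exp (-A * t) * (Real.exp (κ * q x t) * (κ * (-2 * (x - c t)))) := by
      simp only at he; linarith
    have hFL := hL x hx t ht
    have hP : 0 < ε * Real.exp (-A * t) := by positivity
    rw [hw, abs_mul, abs_of_pos hP, abs_mul, abs_of_pos (Real.exp_pos _), abs_mul, abs_of_pos hκ,
      abs_mul, abs_neg, abs_two] at hFL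
    have hFL2 := (abs_le.1 hFL).1
    have hin2 := mul_le_mul_of_nonneg_left hin hP.le
    rw [mul_add] at hin2
    have : ε * Real.exp (-A * t) * (L * (Real.exp (κ * q x t) * (κ * (2 * |x - c t|)))) =
      L * (ε * Real.exp (-A * t) * (Real.exp (κ * q x t) * (κ * (2 * |x - c t|)))) := by ring
    linarith

lemma abs_sub_le_of_interior_deriv {f f' : ℝ → ℝ} {a b η : ℝ} (hc : ContinuousOn f (Icc a b))
    (hd : ∀ x ∈ Ioo a b, HasDerivAt f (f' x) x) (hη : ∀ x ∈ Ioo a b, |f' x| ≤ η) {x y : ℝ}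
    (hx : x ∈ Icc a b) (hy : y ∈ Icc a b) : |f y - f x| ≤ η * |y - x| := by
  wlog h : x < y generalizing x y
  · rcases eq_or_lt_of_le (not_lt.1 h) with rfl | h'
    · simp
    · rw [abs_sub_comm, abs_sub_comm y]; exact this hy hx h'
  obtain ⟨z, hz, he⟩ := exists_hasDerivAt_eq_slope f f' h (hc.mono (Icc_subset_Icc hx.1 hy.2))
    fun z hz => hd z ⟨hx.1.trans_lt hz.1, hz.2.trans_le hy.2⟩
  have hyx : 0 < y - x := sub_pos.2 h
  have := hη z ⟨hx.1.trans_lt hz.1, hz.2.trans_le hy.2⟩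
  rw [he, abs_div, div_le_iff₀ (abs_pos.2 hyx.ne')] at this
  exact this

/-- Between two functions that are separated by a multiple of the distance to the boundary there is
a smooth one, with room for a factor larger than one. -/
theorem exists_smooth_between {f f' g g' : ℝ → ℝ} {c J : ℝ} (hc : 0 < c) (hJ : 0 < J)
    (hf : ContinuousOn f (Icc (-1) 1)) (hf' : ContinuousOn f' (Icc (-1) 1))
    (hg : ContinuousOn g (Icc (-1) 1)) (hg' : ContinuousOn g' (Icc (-1) 1))
    (hdf : ∀ x ∈ Ioo (-1 : ℝ) 1, HasDerivAt f (f' x) x)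
    (hdg : ∀ x ∈ Ioo (-1 : ℝ) 1, HasDerivAt g (g' x) x)
    (hfb : f (-1) = 0 ∧ f 1 = 0) (hgb : g (-1) = 0 ∧ g 1 = 0)
    (hfg : ∀ x ∈ Icc (-1 : ℝ) 1, f x + c * (1 - x ^ 2) ≤ g x)
    (hgJ : ∀ x ∈ Icc (-1 : ℝ) 1, g x ≤ J * (1 - x ^ 2)) :
    ∃ l > 1, ∃ Q Q1 Q2 : ℝ → ℝ, (∀ x, HasDerivAt Q (Q1 x) x) ∧ (∀ x, HasDerivAt Q1 (Q2 x) x) ∧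
      Continuous Q2 ∧ Q (-1) = 0 ∧ Q 1 = 0 ∧ ∀ x ∈ Icc (-1 : ℝ) 1, f x ≤ Q x ∧ l * Q x ≤ g x := by
  set η := c / 8 with hη
  have hη0 : 0 < η := by positivity
  set m : ℝ → ℝ := fun x => (f x + g x) / 2
  have hm : ContinuousOn m (Icc (-1) 1) := (hf.add hg).div_const 2
  obtain ⟨q, hq⟩ := exists_polynomial_near_of_continuousOn (-1) 1 (fun x => (f' x + g' x) / 2)
    ((hf'.add hg').div_const 2) η hη0
  set P : ℝ → ℝ := fun x => ∫ s in (-1)..x, q.eval s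
  have hP : ∀ x, HasDerivAt P (q.eval x) x := fun x =>
    intervalIntegral.integral_hasDerivAt_right (q.continuous.intervalIntegrable _ _)
      q.continuous.aestronglyMeasurable.stronglyMeasurableAtFilter q.continuous.continuousAt
  have hP0 : P (-1) = 0 := intervalIntegral.integral_same
  have hm0 : m (-1) = 0 := by simp [m, hfb.1, hgb.1]
  have hm1 : m 1 = 0 := by simp [m, hfb.2, hgb.2]
  have hD : ∀ x ∈ Icc (-1 : ℝ) 1, ∀ y ∈ Icc (-1 : ℝ) 1,
      |(P y - m y) - (P x - m x)| ≤ η * |y - x| := fun x hx y hy =>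
    abs_sub_le_of_interior_deriv (f := fun x => P x - m x)
      (f' := fun x => q.eval x - (f' x + g' x) / 2)
      ((HasDerivAt.continuousOn fun x _ => hP x).sub hm)
      (fun x hx => (hP x).sub (((hdf x hx).add (hdg x hx)).div_const 2))
      (fun x hx => (hq x (Ioo_subset_Icc_self hx)).le) hx hy
  set k := P 1 / 2
  have hk : |k| ≤ η := by
    have := hD (-1) (by simp) 1 (by simp)
    rw [hP0, hm0, hm1, show |(1 : ℝ) - -1| = 2 by norm_num] at this
    simp only [k, abs_div, abs_two]
    simp only [sub_zero] at this
    linarith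
  have hclose : ∀ x ∈ Icc (-1 : ℝ) 1, |P x - k * (x + 1) - m x| ≤ 2 * η * (1 - x ^ 2) := by
    intro x hx
    have h1 := hD (-1) (by simp) x hx
    have h2 := hD 1 (by simp) x hx
    rw [hP0, hm0, sub_zero, sub_zero, sub_neg_eq_add,
      abs_of_nonneg (show 0 ≤ x + 1 by linarith [hx.1])] at h1
    rw [hm1, sub_zero, show P 1 = 2 * k by simp only [k]; ring,
      abs_of_nonpos (show x - 1 ≤ 0 by linarith [hx.2])] at h2
    rw [abs_le] at h1 h2 hk ⊢
    rcases le_total x 0 with h | h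
    · have e1 : 1 + x ≤ 1 - x ^ 2 := by nlinarith [hx.1]
      have e2 : 2 * η * (1 + x) ≤ 2 * η * (1 - x ^ 2) := by gcongr
      constructor <;> nlinarith [hx.1]
    · have e1 : 1 - x ≤ 1 - x ^ 2 := by nlinarith [hx.2]
      have e2 : 2 * η * (1 - x) ≤ 2 * η * (1 - x ^ 2) := by gcongr
      constructor <;> nlinarith [hx.2]
  refine ⟨1 + c / (4 * J), by simp only [gt_iff_lt, lt_add_iff_pos_right]; positivity,
    fun x => P x - k * (x + 1), fun x => q.eval x - k, fun x => q.derivative.eval x,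
    fun x => ?_, fun x => (q.hasDerivAt x).sub_const k, q.derivative.continuous, ?_, ?_,
    fun x hx => ?_⟩
  · exact ((hP x).sub (((hasDerivAt_id x).add_const 1).const_mul k)).congr_deriv (by simp)
  · simp [hP0]
  · simp only [k]; ring
  · have h1 := abs_le.1 (hclose x hx)
    have h2 := hfg x hx
    have h3 := hgJ x hx
    have h4 : 0 ≤ 1 - x ^ 2 := by nlinarith [hx.1, hx.2]
    have h5 : 0 ≤ c * (1 - x ^ 2) := by positivity
    have e : 2 * η * (1 - x ^ 2) = c * (1 - x ^ 2) / 4 := by rw [hη]; ring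
    rw [e] at h1
    simp only [m] at h1
    have h6 : P x - k * (x + 1) ≤ J * (1 - x ^ 2) := by linarith
    have h7 : c / (4 * J) * (P x - k * (x + 1)) ≤ c * (1 - x ^ 2) / 4 := by
      calc _ ≤ c / (4 * J) * (J * (1 - x ^ 2)) := by gcongr
        _ = _ := by field_simp
    constructor
    · linarith
    · rw [add_mul, one_mul]; linarith

/-- A nonnegative profile on `[0,2]`, with derivatives `g` and `h`, that solves `h + F g = 0` up to
an error bounded by `C`. -/
structure LayerProfile (F : ℝ → ℝ) (C M : ℝ) (f g h : ℝ → ℝ) : Prop where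
  cont : ContinuousOn f (Icc 0 2)
  deriv : ∀ x ∈ Ioo (0 : ℝ) 2, HasDerivAt f (g x) x
  deriv2 : ∀ x ∈ Ioo (0 : ℝ) 2, HasDerivAt g (h x) x
  bound : ∀ x ∈ Ioo (0 : ℝ) 2, |h x + F (g x)| ≤ C
  zero : f 0 = 0
  nonneg : ∀ x ∈ Icc (0 : ℝ) 2, 0 ≤ f x
  le : ∀ x ∈ Icc (0 : ℝ) 2, f x ≤ M

lemma hasDerivAt_shifted_rpow {κ s a e x : ℝ} (h : 0 < x - a + s) :
    HasDerivAt (fun y => κ * (y - a + s) ^ e) (κ * (e * (x - a + s) ^ (e - 1))) x := by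
  have h1 : HasDerivAt (fun y : ℝ => y - a + s) 1 x := ((hasDerivAt_id x).sub_const a).add_const s
  have := (h1.rpow_const (p := e) (Or.inl h.ne')).const_mul κ
  exact this.congr_deriv (by ring)

lemma barrier_rpow {κ ρ p β : ℝ} (hκ : 0 < κ) (hρ : 0 < ρ) (hβ : β * p = 1 + β) :
    (κ * ρ ^ (-β)) ^ p = κ ^ p * ρ ^ (-β - 1) := by
  rw [Real.mul_rpow hκ.le (by positivity), ← Real.rpow_mul hρ.le]
  congr 2
  linarith

section

variable {F : ℝ → ℝ} {C M p β κ ρ s a r : ℝ} {f g h : ℝ → ℝ}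

lemma barrier_mem (hκ : 0 < κ) (hs : 0 < s) (hβ : 0 < β) {x : ℝ} (hx : a ≤ x) :
    κ * (x - a + s) ^ (-β) ∈ Icc 0 (κ * s ^ (-β)) := by
  have h0 : 0 < x - a + s := by linarith
  refine ⟨by positivity, ?_⟩
  gcongr κ * ?_
  exact Real.rpow_le_rpow_of_nonpos hs (by linarith) (by linarith)

theorem LayerProfile.le_add (P : LayerProfile F C M f g h) (hκ : 0 < κ) (hs : 0 < s)
    (hβ0 : 0 < β) (hβ1 : β < 1) (hβ : β * p = 1 + β)
    (hρ : ∀ y ∈ Ioc 0 ρ, C < (κ ^ p - κ * β) * y ^ (-β - 1))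
    (hF : ∀ ξ ∈ Icc 0 (κ * s ^ (-β)), F ξ = ξ ^ p) (ha : 0 < a) (har : a ≤ r) (hr : r < 2)
    (hrs : r - a + s ≤ ρ) (hga : g a ≤ κ * s ^ (-β)) :
    f r ≤ f a + κ / (1 - β) * ((r - a + s) ^ (1 - β) - s ^ (1 - β)) := by
  have hmem : ∀ x ∈ Icc a r, x ∈ Ioo (0 : ℝ) 2 := fun x hx => ⟨by linarith [hx.1], by linarith [hx.2]⟩
  have hpos : ∀ x ∈ Icc a r, 0 < x - a + s := fun x hx => by linarith [hx.1]
  have hle : ∀ x ∈ Icc a r, g x ≤ κ * (x - a + s) ^ (-β) := by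
    refine fun x hx => image_le_of_deriv_right_lt_deriv_boundary' (f := g) (f' := h)
      (B' := fun x => κ * (-β * (x - a + s) ^ (-β - 1)))
      (HasDerivAt.continuousOn fun x hx => P.deriv2 x (hmem x hx))
      (fun x hx => (P.deriv2 x (hmem x (Ico_subset_Icc_self hx))).hasDerivWithinAt)
      (by simpa using hga)
      (HasDerivAt.continuousOn fun x hx => hasDerivAt_shifted_rpow (hpos x hx))
      (fun x hx => (hasDerivAt_shifted_rpow (hpos x (Ico_subset_Icc_self hx))).hasDerivWithinAt)
      (fun x hx he => ?_) hx
    have hx' := Ico_subset_Icc_self hx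
    have h1 := (abs_le.1 (P.bound x (hmem x hx'))).2
    rw [he, hF _ (barrier_mem hκ hs hβ0 hx.1), barrier_rpow hκ (hpos x hx') hβ] at h1
    have h2 := hρ (x - a + s) ⟨hpos x hx', by linarith [hx.2]⟩
    linarith
  have hanti := antitoneOn_of_deriv_nonpos (f := fun x => f x - κ / (1 - β) * (x - a + s) ^ (1 - β))
    (convex_Icc a r)
  have hd : ∀ x ∈ Icc a r, HasDerivAt (fun x => f x - κ / (1 - β) * (x - a + s) ^ (1 - β))
      (g x - κ * (x - a + s) ^ (-β)) x := fun x hx => by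
    refine ((P.deriv x (hmem x hx)).sub (hasDerivAt_shifted_rpow (hpos x hx))).congr_deriv ?_
    rw [show 1 - β - 1 = -β by ring]
    field_simp [show 1 - β ≠ 0 by linarith]
  have := hanti (HasDerivAt.continuousOn hd)
    (fun x hx => (hd x (interior_subset hx)).differentiableAt.differentiableWithinAt)
    (fun x hx => by rw [(hd x (interior_subset hx)).deriv]; linarith [hle x (interior_subset hx)])
    (left_mem_Icc.2 har) (right_mem_Icc.2 har) har
  simp only [sub_self, zero_add] at this
  linarith

theorem LayerProfile.add_le (P : LayerProfile F C M f g h) (hκ : 0 < κ) (hs : 0 < s)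
    (hβ0 : 0 < β) (hβ1 : β < 1) (hβ : β * p = 1 + β)
    (hρ : ∀ y ∈ Ioc 0 ρ, C < (κ * β - κ ^ p) * y ^ (-β - 1))
    (hF : ∀ ξ ∈ Icc 0 (κ * s ^ (-β)), F ξ = ξ ^ p) (ha : 0 < a) (har : a ≤ r) (hr : r < 2)
    (hrs : r - a + s ≤ ρ) (hga : κ * s ^ (-β) ≤ g a) :
    f a + κ / (1 - β) * ((r - a + s) ^ (1 - β) - s ^ (1 - β)) ≤ f r := by
  have hmem : ∀ x ∈ Icc a r, x ∈ Ioo (0 : ℝ) 2 := fun x hx => ⟨by linarith [hx.1], by linarith [hx.2]⟩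
  have hpos : ∀ x ∈ Icc a r, 0 < x - a + s := fun x hx => by linarith [hx.1]
  have hle : ∀ x ∈ Icc a r, κ * (x - a + s) ^ (-β) ≤ g x := by
    refine fun x hx => image_le_of_deriv_right_lt_deriv_boundary' (B := g) (B' := h)
      (f' := fun x => κ * (-β * (x - a + s) ^ (-β - 1)))
      (HasDerivAt.continuousOn fun x hx => hasDerivAt_shifted_rpow (hpos x hx))
      (fun x hx => (hasDerivAt_shifted_rpow (hpos x (Ico_subset_Icc_self hx))).hasDerivWithinAt)
      (by simpa using hga)
      (HasDerivAt.continuousOn fun x hx => P.deriv2 x (hmem x hx))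
      (fun x hx => (P.deriv2 x (hmem x (Ico_subset_Icc_self hx))).hasDerivWithinAt)
      (fun x hx he => ?_) hx
    have hx' := Ico_subset_Icc_self hx
    have h1 := (abs_le.1 (P.bound x (hmem x hx'))).1
    rw [← he, hF _ (barrier_mem hκ hs hβ0 hx.1), barrier_rpow hκ (hpos x hx') hβ] at h1
    have h2 := hρ (x - a + s) ⟨hpos x hx', by linarith [hx.2]⟩
    linarith
  have hmono := monotoneOn_of_deriv_nonneg (f := fun x => f x - κ / (1 - β) * (x - a + s) ^ (1 - β))
    (convex_Icc a r)
  have hd : ∀ x ∈ Icc a r, HasDerivAt (fun x => f x - κ / (1 - β) * (x - a + s) ^ (1 - β))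
      (g x - κ * (x - a + s) ^ (-β)) x := fun x hx => by
    refine ((P.deriv x (hmem x hx)).sub (hasDerivAt_shifted_rpow (hpos x hx))).congr_deriv ?_
    rw [show 1 - β - 1 = -β by ring]
    field_simp [show 1 - β ≠ 0 by linarith]
  have := hmono (HasDerivAt.continuousOn hd)
    (fun x hx => (hd x (interior_subset hx)).differentiableAt.differentiableWithinAt)
    (fun x hx => by rw [(hd x (interior_subset hx)).deriv]; linarith [hle x (interior_subset hx)])
    (left_mem_Icc.2 har) (right_mem_Icc.2 har) har
  simp only [sub_self, zero_add] at this
  linarith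

end

lemma exists_barrier_constants {p l : ℝ} (hp : 2 < p) (hl : 1 < l) :
    ∃ k K : ℝ, 0 < k ∧ 0 < K ∧ k ^ p < k * (1 / (p - 1)) ∧ K * (1 / (p - 1)) < K ^ p ∧
      K < l * k := by
  set β := 1 / (p - 1) with hβ
  have hp1 : 0 < p - 1 := by linarith
  have hβ0 : 0 < β := by positivity
  have hβ1 : β < 1 := by rw [hβ, div_lt_one hp1]; linarith
  have hβp : β * (p - 1) = 1 := by rw [hβ]; field_simp
  set μ := √l
  have hμ : 1 < μ := by simpa [μ] using Real.lt_sqrt_of_sq_lt (x := 1) (by simpa using hl)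
  have hμ0 : 0 < μ := by linarith
  have hμ2 : μ * μ = l := Real.mul_self_sqrt (by linarith)
  have key : ∀ b > 0, (b ^ β : ℝ) ^ p = b ^ β * b := fun b hb => by
    rw [← Real.rpow_mul hb.le, ← Real.rpow_add_one hb.ne']
    congr 1; linarith
  refine ⟨(β / μ) ^ β, (β * μ) ^ β, by positivity, by positivity, ?_, ?_, ?_⟩
  · rw [key _ (by positivity)]
    gcongr
    exact div_lt_self hβ0 hμ
  · rw [key _ (by positivity)]
    gcongr
    exact lt_mul_of_one_lt_right hβ0 hμ
  · have h1 : β * μ = l * (β / μ) := by rw [← hμ2]; field_simp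
    rw [h1, Real.mul_rpow (by positivity) (by positivity)]
    gcongr
    conv_rhs => rw [← Real.rpow_one l]
    exact Real.rpow_lt_rpow_of_exponent_lt hl hβ1

lemma exists_small_layer {d C : ℝ} (e : ℝ) (he : e ≤ -1) (hd : 0 < d) (hC : 0 ≤ C) :
    ∃ ρ ∈ Ioc (0 : ℝ) 1, ∀ y ∈ Ioc 0 ρ, C < d * y ^ e := by
  refine ⟨min 1 (d / (C + 1)), ⟨by positivity, min_le_left _ _⟩, fun y hy => ?_⟩
  have h1 : y ≤ 1 := hy.2.trans (min_le_left _ _)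
  have h2 : y ≤ d / (C + 1) := hy.2.trans (min_le_right _ _)
  rw [le_div_iff₀ (by positivity)] at h2
  have h3 : y ^ (-1 : ℝ) ≤ y ^ e := Real.rpow_le_rpow_of_exponent_ge hy.1 h1 he
  rw [Real.rpow_neg_one] at h3
  have h4 : C + 1 ≤ d * y⁻¹ := by
    rw [← div_eq_mul_inv, le_div_iff₀ hy.1]; linarith
  nlinarith

lemma mul_div_rpow_rpow_neg {κ j p : ℝ} (hκ : 0 < κ) (hj : 0 < j) (hp : 1 < p) :
    κ * ((κ / j) ^ (p - 1)) ^ (-(1 / (p - 1))) = j := by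
  have : p - 1 ≠ 0 := by linarith
  rw [← Real.rpow_mul (by positivity), show (p - 1) * -(1 / (p - 1)) = -1 by field_simp,
    Real.rpow_neg_one]
  field_simp

lemma tendsto_div_rpow_atTop (κ : ℝ) {e : ℝ} (he : 0 < e) :
    Tendsto (fun x : ℝ => (κ / x) ^ e) atTop (𝓝 0) := by
  have := (tendsto_const_nhds (x := κ)).div_atTop tendsto_id |>.rpow_const (p := e) (Or.inr he.le)
  simpa [Real.zero_rpow he.ne'] using this

/-- If a profile is small near zero, uniformly in the truncation level, then any profile that it
dominates with a factor larger than one at a suitable point lies below a fixed linear function. -/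
theorem exists_layer_linear_bound {p C M l : ℝ} (hp : 2 < p) (hC : 0 ≤ C)
    (hl : 1 < l) : ∃ r ∈ Ioo (0 : ℝ) 1, ∃ ε > 0, ∃ N : ℝ, 1 ≤ N ∧ ∀ r₀ ∈ Ioo 0 r, ∃ j₁ : ℕ,
      ∀ j ≥ j₁, ∀ f g h f' g' h' : ℝ → ℝ, LayerProfile (Fj1 p j) C M f g h →
        LayerProfile (Fj1 p j) C M f' g' h' → (∀ x ∈ Ioc 0 r₀, f x ≤ ε) → l * f' r ≤ f r →
        ∀ x ∈ Icc (0 : ℝ) 2, f' x ≤ N * x := by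
  obtain ⟨k, K, hk, hK, hkp, hKp, hKk⟩ := exists_barrier_constants hp hl
  set β := 1 / (p - 1) with hβd
  have hp1 : 0 < p - 1 := by linarith
  have hβ0 : 0 < β := by positivity
  have hβ1 : β < 1 := by rw [hβd, div_lt_one hp1]; linarith
  have hβ : β * p = 1 + β := by rw [hβd]; field_simp; ring
  have hα : 0 < 1 - β := by linarith
  obtain ⟨ρ1, hρ1, hb1⟩ := exists_small_layer (-β - 1) (by linarith) (sub_pos.2 hkp) hC
  obtain ⟨ρ2, hρ2, hb2⟩ := exists_small_layer (-β - 1) (by linarith) (sub_pos.2 hKp) hC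
  set ρ := min ρ1 ρ2
  have hρ : 0 < ρ := lt_min hρ1.1 hρ2.1
  have hρ' : ρ ≤ 1 := (min_le_left _ _).trans hρ1.2
  set r := ρ / 2
  have hr0 : 0 < r := by positivity
  have hr1 : r < 1 := by simp only [r]; linarith
  set ε := (l * k - K) / (2 * (1 - β)) * r ^ (1 - β)
  have hε : 0 < ε := mul_pos (div_pos (by linarith) (by linarith)) (by positivity)
  have hlim : Tendsto (fun N : ℝ =>
      l * (k / (1 - β) * ((r - M / N) ^ (1 - β) - ((k / N) ^ (p - 1)) ^ (1 - β)))) atTop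
      (𝓝 (l * (k / (1 - β) * ((r - 0) ^ (1 - β) - 0 ^ (1 - β))))) := by
    refine ((((tendsto_const_nhds.sub (tendsto_const_nhds.div_atTop tendsto_id)).rpow_const
      (Or.inr hα.le)).sub ((tendsto_div_rpow_atTop k hp1).rpow_const
      (Or.inr hα.le))).const_mul _).const_mul _
  have hlt : ε + K / (1 - β) * r ^ (1 - β) <
      l * (k / (1 - β) * ((r - 0) ^ (1 - β) - 0 ^ (1 - β))) := by
    rw [Real.zero_rpow hα.ne', sub_zero, sub_zero]
    have : l * (k / (1 - β) * r ^ (1 - β)) = 2 * ε + K / (1 - β) * r ^ (1 - β) := by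
      simp only [ε]; field_simp; ring
    linarith
  have hMN : Tendsto (fun N : ℝ => M / N) atTop (𝓝 0) := tendsto_const_nhds.div_atTop tendsto_id
  obtain ⟨N, hN, hNr, hNs, hN1⟩ := (((hlim.eventually_const_lt hlt).and
    ((hMN.eventually_lt_const hr0).and (((tendsto_div_rpow_atTop k hp1).eventually_lt_const
      hr0).and (eventually_ge_atTop 1)))).exists)
  have hN0 : 0 < N := by linarith
  refine ⟨r, ⟨hr0, hr1⟩, ε, hε, N, hN1, fun r₀ hr₀ => ?_⟩
  obtain ⟨j₁, hj₁⟩ := eventually_atTop.1 ((tendsto_natCast_atTop_atTop (R := ℝ)).eventually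
    (((tendsto_div_rpow_atTop K hp1).eventually_lt_const hr0).and
      ((eventually_ge_atTop N).and (eventually_ge_atTop (M / r₀)))))
  refine ⟨j₁, fun j hj f g h f' g' h' P P' hsm hfr x hx => ?_⟩
  obtain ⟨hjs, hjN, hjM⟩ := hj₁ j hj
  have hj0 : 0 < (j : ℝ) := by linarith
  have hF : ∀ ξ ∈ Icc 0 (j : ℝ), Fj1 p j ξ = ξ ^ p := fun ξ hξ => by
    rw [Fj1_eq hp (by rw [abs_of_nonneg hξ.1]; exact hξ.2), abs_of_nonneg hξ.1]
  have upper : f r ≤ ε + K / (1 - β) * r ^ (1 - β) := by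
    obtain ⟨a, ha, hga⟩ := exists_hasDerivAt_eq_slope f g hr₀.1
      (P.cont.mono (Icc_subset_Icc le_rfl (by linarith [hr₀.2])))
      (fun x hx => P.deriv x ⟨hx.1, by linarith [hx.2, hr₀.2]⟩)
    have hgj : g a ≤ j := by
      rw [hga, P.zero, sub_zero, sub_zero]
      refine le_trans ?_ hjM
      have := hr₀.1
      gcongr
      exact P.le _ ⟨hr₀.1.le, by linarith [hr₀.2]⟩
    set s := (K / (j : ℝ)) ^ (p - 1)
    have hs : 0 < s := by positivity
    have hsj : K * s ^ (-β) = j := mul_div_rpow_rpow_neg hK hj0 (by linarith)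
    have := P.le_add hK hs hβ0 hβ1 hβ
      (fun y hy => hb2 y ⟨hy.1, hy.2.trans (min_le_right ρ1 ρ2)⟩) (by rwa [hsj]) ha.1
      (ha.2.trans hr₀.2).le (by linarith) (show r - a + s ≤ ρ by
        have := ha.1; simp only [r] at *; linarith) (by rwa [hsj])
    have h1 := hsm a ⟨ha.1, ha.2.le⟩
    have har : 0 ≤ r - a := by linarith [ha.2, hr₀.2]
    have h2 := Real.rpow_add_le_add_rpow har hs.le hα.le (by linarith)
    have h3 : (r - a) ^ (1 - β) ≤ r ^ (1 - β) :=
      Real.rpow_le_rpow har (by linarith [ha.1]) hα.le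
    have h4 : K / (1 - β) * ((r - a + s) ^ (1 - β) - s ^ (1 - β)) ≤ K / (1 - β) * r ^ (1 - β) := by
      gcongr; linarith
    linarith
  by_contra! hcon
  have hx0 : 0 < x := lt_of_le_of_ne hx.1 (by rintro rfl; rw [P'.zero] at hcon; simp at hcon)
  have hxN : x < M / N := by
    rw [lt_div_iff₀ hN0]; linarith [P'.le x hx]
  obtain ⟨a, ha, hga⟩ := exists_hasDerivAt_eq_slope f' g' hx0
    (P'.cont.mono (Icc_subset_Icc le_rfl hx.2))
    (fun y hy => P'.deriv y ⟨hy.1, by linarith [hy.2, hx.2]⟩)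
  have hgN : N ≤ g' a := by
    rw [hga, P'.zero, sub_zero, sub_zero, le_div_iff₀ hx0]; exact hcon.le
  set s := (k / N) ^ (p - 1)
  have hs : 0 < s := by positivity
  have hsN : k * s ^ (-β) = N := mul_div_rpow_rpow_neg hk hN0 (by linarith)
  have := P'.add_le hk hs hβ0 hβ1 hβ
    (fun y hy => hb1 y ⟨hy.1, hy.2.trans (min_le_left ρ1 ρ2)⟩)
    (fun ξ hξ => hF ξ ⟨hξ.1, hξ.2.trans (hsN.trans_le hjN)⟩) ha.1
    (by linarith [ha.2] : a ≤ r) (by linarith) (show r - a + s ≤ ρ by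
      have := ha.1; simp only [r] at *; linarith) (by rwa [hsN])
  have h1 := P'.nonneg a ⟨ha.1.le, by linarith [ha.2, hx.2]⟩
  have h2 : (r - M / N) ^ (1 - β) ≤ (r - a + s) ^ (1 - β) :=
    Real.rpow_le_rpow (by linarith) (by linarith [ha.2]) hα.le
  have h3 : k / (1 - β) * ((r - M / N) ^ (1 - β) - s ^ (1 - β)) ≤ f' r := by
    refine le_trans ?_ (le_trans (le_add_of_nonneg_left h1) this)
    gcongr
  have h4 := mul_le_mul_of_nonneg_left h3 (by linarith : 0 ≤ l)
  linarith

namespace Evol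

variable {F : ℝ → ℝ} {u w a : ℝ → ℝ → ℝ} {C : ℝ}

lemma abs_sub_init_le (h : Evol F u w a) {Q Q1 Q2 : ℝ → ℝ} (hC : 0 ≤ C)
    (hQ : ∀ x ∈ Icc (-1 : ℝ) 1, u x 0 = Q x) (hd : ∀ x, HasDerivAt Q (Q1 x) x)
    (hd' : ∀ x, HasDerivAt Q1 (Q2 x) x)
    (hb : ∀ x ∈ Ioo (-1 : ℝ) 1, |Q2 x + F (Q1 x)| ≤ C) :
    ∀ x ∈ Icc (-1 : ℝ) 1, ∀ t, 0 ≤ t → |u x t - u x 0| ≤ C * t := by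
  have hQc : Continuous Q := continuous_iff_continuousAt.2 fun x => (hd x).continuousAt
  have key : ∀ l ∈ ({1, -1} : Set ℝ), ∀ x ∈ Icc (-1 : ℝ) 1, ∀ t, 0 ≤ t →
      l * (u x t - Q x) - C * t ≤ 0 := by
    intro l hl x hx t ht
    have hl1 : |l| = 1 := by rcases hl with rfl | rfl <;> simp
    refine parabolic_max_principle (z := fun x t => l * (u x t - Q x) - C * t) (a := -1) (b := 1)
      (T := t) ?_ (fun y hy => by simp [hQ y hy]) (fun s hs => ?_)
      (fun y hy s hs _ => ⟨fun y => l * (w y s - Q1 y), l * (a y s - Q2 y),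
        l * (a y s + F (w y s)) - C * 1, ?_, ((h.deriv_w y hy s hs.1).sub (hd' y)).const_mul l,
        (((h.deriv_t y hy s hs.1).sub_const _).const_mul l).sub ((hasDerivAt_id s).const_mul C),
        fun he => ?_⟩) x hx t ⟨ht, le_rfl⟩
    · exact (((h.cont_slab t).sub (by fun_prop)).const_smul l).sub (by fun_prop)
    · rw [(h.bc s hs.1).1, (h.bc s hs.1).2, ← hQ (-1) (by simp), ← hQ 1 (by simp),
        (h.bc 0 le_rfl).1, (h.bc 0 le_rfl).2]
      have := mul_nonneg hC hs.1
      simpa using this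
    · filter_upwards [h.ev_deriv hy hs.1.le] with x hx
      exact ((hx.sub (hd x)).const_mul l).sub_const _
    · have e : w y s = Q1 y := by
        rcases hl with rfl | rfl <;> simp only at he <;> linarith
      have h1 : l * (Q2 y + F (Q1 y)) ≤ C :=
        (le_abs_self _).trans (by rw [abs_mul, hl1, one_mul]; exact hb y hy)
      rw [e]; linarith
  intro x hx t ht
  have h1 := key 1 (by simp) x hx t ht
  have h2 := key (-1) (by simp) x hx t ht
  rw [hQ x hx, abs_le]
  constructor <;> linarith

lemma abs_shift_sub_le (h : Evol F u w a) (hC : 0 ≤ C)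
    (h0 : ∀ x ∈ Icc (-1 : ℝ) 1, ∀ t, 0 ≤ t → |u x t - u x 0| ≤ C * t) :
    ∀ x ∈ Icc (-1 : ℝ) 1, ∀ s, 0 ≤ s → ∀ t, 0 ≤ t → |u x (s + t) - u x t| ≤ C * s := by
  have key : ∀ l ∈ ({1, -1} : Set ℝ), ∀ s, 0 ≤ s → ∀ x ∈ Icc (-1 : ℝ) 1, ∀ t, 0 ≤ t →
      l * (u x (s + t) - u x t) - C * s ≤ 0 := by
    intro l hl s hs x hx t ht
    have hl1 : |l| = 1 := by rcases hl with rfl | rfl <;> simp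
    have h' := h.shift hs
    refine parabolic_max_principle (z := fun x t => l * (u x (s + t) - u x t) - C * s) (a := -1)
      (b := 1) (T := t) ?_ (fun y hy => ?_) (fun r hr => ?_)
      (fun y hy r hr _ => ⟨fun y => l * (w y (s + r) - w y r), l * (a y (s + r) - a y r),
        l * ((a y (s + r) + F (w y (s + r))) - (a y r + F (w y r))), ?_,
        ((h'.deriv_w y hy r hr.1).sub (h.deriv_w y hy r hr.1)).const_mul l,
        (((h'.deriv_t y hy r hr.1).sub (h.deriv_t y hy r hr.1)).const_mul l).sub_const _,
        fun he => ?_⟩) x hx t ⟨ht, le_rfl⟩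
    · exact (((h'.cont_slab t).sub (h.cont_slab t)).const_smul l).sub continuousOn_const
    · have : l * (u y s - u y 0) ≤ C * s := (le_abs_self _).trans (by
        rw [abs_mul, hl1, one_mul]; exact h0 y hy s hs)
      simpa using this
    · have := mul_nonneg hC hs
      have h1 := h'.bc r hr.1
      rw [h1.1, h1.2, (h.bc r hr.1).1, (h.bc r hr.1).2]
      simpa using this
    · filter_upwards [h'.ev_deriv hy hr.1.le, h.ev_deriv hy hr.1.le] with x h1 h2
      exact ((h1.sub h2).const_mul l).sub_const _
    · have e : w y (s + r) = w y r := by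
        rcases hl with rfl | rfl <;> simp only at he <;> linarith
      rw [e]; linarith
  intro x hx s hs t ht
  have h1 := key 1 (by simp) s hs x hx t ht
  have h2 := key (-1) (by simp) s hs x hx t ht
  rw [abs_le]
  constructor <;> linarith

lemma abs_sub_time_le (h : Evol F u w a) (hC : 0 ≤ C)
    (h0 : ∀ x ∈ Icc (-1 : ℝ) 1, ∀ t, 0 ≤ t → |u x t - u x 0| ≤ C * t) :
    ∀ x ∈ Icc (-1 : ℝ) 1, ∀ s, 0 ≤ s → ∀ t, 0 ≤ t → |u x s - u x t| ≤ C * |s - t| := by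
  intro x hx s hs t ht
  wlog hst : t ≤ s generalizing s t
  · rw [abs_sub_comm, abs_sub_comm s]; exact this t ht s hs (le_of_not_ge hst)
  have := h.abs_shift_sub_le hC h0 x hx (s - t) (by linarith) t ht
  rwa [sub_add_cancel, ← abs_of_nonneg (sub_nonneg.2 hst)] at this

lemma abs_deriv_time_le (h : Evol F u w a) (hC : 0 ≤ C)
    (h0 : ∀ x ∈ Icc (-1 : ℝ) 1, ∀ t, 0 ≤ t → |u x t - u x 0| ≤ C * t) :
    ∀ x ∈ Ioo (-1 : ℝ) 1, ∀ t, 0 < t → |a x t + F (w x t)| ≤ C := by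
  intro x hx t ht
  refine HasDerivAt.le_of_lip' (h.deriv_t x hx t ht) hC ?_
  filter_upwards [lt_mem_nhds ht] with s hs
  exact h.abs_sub_time_le hC h0 x (Ioo_subset_Icc_self hx) s hs.le t ht.le

/-- At positive times, the part of a solution near the left end is a boundary layer profile. -/
lemma layerProfile (h : Evol F u w a) (hC : 0 ≤ C)
    (h0 : ∀ x ∈ Icc (-1 : ℝ) 1, ∀ t, 0 ≤ t → |u x t - u x 0| ≤ C * t) {M t : ℝ} (ht : 0 < t)
    (hn : ∀ x ∈ Icc (-1 : ℝ) 1, 0 ≤ u x t) (hM : ∀ x ∈ Icc (-1 : ℝ) 1, u x t ≤ M) :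
    LayerProfile F C M (fun r => u (r - 1) t) (fun r => w (r - 1) t) (fun r => a (r - 1) t) where
  cont := h.cont_u.comp (f := fun r : ℝ => (r - 1, t)) (by fun_prop)
    fun r hr => ⟨⟨by linarith [hr.1], by linarith [hr.2]⟩, ht.le⟩
  deriv r hr := (h.deriv_u (r - 1) ⟨by linarith [hr.1], by linarith [hr.2]⟩ t ht.le).comp_sub_const
    r 1
  deriv2 r hr := (h.deriv_w (r - 1) ⟨by linarith [hr.1], by linarith [hr.2]⟩ t ht).comp_sub_const
    r 1
  bound r hr := h.abs_deriv_time_le hC h0 (r - 1) ⟨by linarith [hr.1], by linarith [hr.2]⟩ t ht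
  zero := by rw [zero_sub]; exact (h.bc t ht.le).1
  nonneg r hr := hn (r - 1) ⟨by linarith [hr.1], by linarith [hr.2]⟩
  le r hr := hM (r - 1) ⟨by linarith [hr.1], by linarith [hr.2]⟩

end Evol

/-- Pointwise in time smallness near the boundary is uniform on bounded time intervals for
families that are uniformly Lipschitz in time. -/
lemma eventually_forall_time_le {ι : Type*} {U : ι → ℝ → ℝ → ℝ} {G : ℝ → ℝ → ℝ} {C ε T : ℝ}
    {l : Filter ℝ} (hC : 0 ≤ C) (hε : 0 < ε)
    (hU : ∀ᶠ x in l, ∀ i, ∀ s, 0 ≤ s → ∀ t, 0 ≤ t → |U i x s - U i x t| ≤ C * |s - t|)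
    (hG : ∀ᶠ x in l, ∀ i, ∀ t, 0 < t → U i x t ≤ G x t)
    (hlim : ∀ t, 0 < t → Tendsto (fun x => G x t) l (𝓝 0)) :
    ∀ᶠ x in l, ∀ i, ∀ t ∈ Icc 0 T, U i x t ≤ ε := by
  set h := ε / (2 * (C + 1))
  have hh : 0 < h := by positivity
  have hCh : C * h ≤ ε / 2 := by
    have : h * (2 * (C + 1)) = ε := div_mul_cancel₀ _ (by positivity)
    nlinarith
  have hfin : ∀ᶠ x in l, ∀ k ∈ Finset.range (⌊T / h⌋₊ + 1), G x ((k + 1) * h) < ε / 2 :=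
    (Finset.eventually_all _).2 fun k _ =>
      (hlim ((k + 1) * h) (by positivity)).eventually_lt_const (by positivity)
  filter_upwards [hfin, hU, hG] with x h1 h2 h3 i t ht
  have hk : ⌊t / h⌋₊ ∈ Finset.range (⌊T / h⌋₊ + 1) := by
    rw [Finset.mem_range, Nat.lt_succ_iff]
    exact Nat.floor_le_floor (by have := ht.2; gcongr)
  have hle : ⌊t / h⌋₊ * h ≤ t := by
    rw [← le_div_iff₀ hh]; exact Nat.floor_le (div_nonneg ht.1 hh.le)
  have hlt : t < (⌊t / h⌋₊ + 1) * h := by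
    rw [← div_lt_iff₀ hh]; exact Nat.lt_floor_add_one _
  have hpos : 0 < (⌊t / h⌋₊ + 1) * h := by positivity
  have h4 := (le_abs_self _).trans (h2 i t ht.1 _ hpos.le)
  have h5 := h3 i _ hpos
  have h6 := h1 _ hk
  have h7 : |t - (⌊t / h⌋₊ + 1) * h| ≤ h := by
    rw [abs_le]; constructor <;> linarith
  have h8 := mul_le_mul_of_nonneg_left h7 hC
  linarith

/-- If a family of solutions does not lose the boundary condition at the left end, then any family
that it dominates with a factor larger than one has a uniform linear bound there. -/
theorem exists_left_linear_bound {p C M l T : ℝ} (hp : 2 < p) (hC : 0 ≤ C) (hl : 1 < l) {J : ℕ}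
    {u w a u' w' a' : ℕ → ℝ → ℝ → ℝ} {G : ℝ → ℝ → ℝ}
    (hE : ∀ j ≥ J, Evol (Fj1 p j) (u j) (w j) (a j))
    (hE' : ∀ j ≥ J, Evol (Fj1 p j) (u' j) (w' j) (a' j))
    (hL : ∀ j ≥ J, ∀ x ∈ Icc (-1 : ℝ) 1, ∀ t, 0 ≤ t → |u j x t - u j x 0| ≤ C * t)
    (hL' : ∀ j ≥ J, ∀ x ∈ Icc (-1 : ℝ) 1, ∀ t, 0 ≤ t → |u' j x t - u' j x 0| ≤ C * t)
    (hu : ∀ j ≥ J, ∀ x ∈ Icc (-1 : ℝ) 1, ∀ t, 0 ≤ t → u j x t ∈ Icc 0 M)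
    (hu' : ∀ j ≥ J, ∀ x ∈ Icc (-1 : ℝ) 1, ∀ t, 0 ≤ t → u' j x t ∈ Icc 0 M)
    (hdom : ∀ j ≥ J, ∀ x ∈ Icc (-1 : ℝ) 1, ∀ t, 0 ≤ t → l * u' j x t ≤ u j x t)
    (hG : ∀ j ≥ J, ∀ x ∈ Icc (-1 : ℝ) 1, ∀ t, 0 < t → u j x t ≤ G x t)
    (hlim : ∀ t, 0 < t → Tendsto (fun x => G x t) (𝓝[Ioo (-1) 1] (-1)) (𝓝 0)) :
    ∃ N : ℝ, ∃ j₁ : ℕ, ∀ j ≥ j₁, ∀ x ∈ Icc (-1 : ℝ) 1, ∀ t ∈ Ioc 0 T,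
      u' j x t ≤ N * (1 + x) := by
  obtain ⟨r, hr, ε, hε, N, -, H⟩ := exists_layer_linear_bound (M := M) hp hC hl
  have hmem : ∀ᶠ x in 𝓝[Ioo (-1 : ℝ) 1] (-1), x ∈ Icc (-1 : ℝ) 1 := by
    filter_upwards [self_mem_nhdsWithin] with x hx using Ioo_subset_Icc_self hx
  have hsm := eventually_forall_time_le (ι := {j // J ≤ j}) (U := fun j => u j) (G := G) (T := T)
    (l := 𝓝[Ioo (-1 : ℝ) 1] (-1)) hC hε
    (hmem.mono fun x hx j s hs t ht => (hE j j.2).abs_sub_time_le hC (hL j j.2) x hx s hs t ht)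
    (hmem.mono fun x hx j t ht => hG j j.2 x hx t ht) hlim
  rw [nhdsWithin_Ioo_eq_nhdsGT (by norm_num)] at hsm
  obtain ⟨d, hd, hdsub⟩ := mem_nhdsGT_iff_exists_Ioo_subset.1 hsm
  have hd1 : 0 < d + 1 := by simp only [mem_Ioi] at hd; linarith
  obtain ⟨j₁, hj₁⟩ := H (min r (d + 1) / 2) ⟨half_pos (lt_min hr.1 hd1),
    (half_lt_self (lt_min hr.1 hd1)).trans_le (min_le_left _ _)⟩
  refine ⟨N, max J j₁, fun j hj x hx t ht => ?_⟩
  have hjJ : J ≤ j := (le_max_left _ _).trans hj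
  have := hj₁ j ((le_max_right _ _).trans hj) _ _ _ _ _ _
    ((hE j hjJ).layerProfile hC (hL j hjJ) ht.1 (fun x hx => (hu j hjJ x hx t ht.1.le).1)
      fun x hx => (hu j hjJ x hx t ht.1.le).2)
    ((hE' j hjJ).layerProfile hC (hL' j hjJ) ht.1 (fun x hx => (hu' j hjJ x hx t ht.1.le).1)
      fun x hx => (hu' j hjJ x hx t ht.1.le).2)
    (fun y hy => hdsub (a := y - 1) ⟨by linarith [hy.1], by
      have := (half_lt_self (lt_min hr.1 hd1)).trans_le (min_le_right r (d + 1))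
      linarith [hy.2]⟩ ⟨j, hjJ⟩ t ⟨ht.1.le, ht.2⟩)
    (hdom j hjJ _ ⟨by linarith [hr.1], by linarith [hr.2]⟩ t ht.1.le)
    (x + 1) ⟨by linarith [hx.1], by linarith [hx.2]⟩
  simpa [add_comm] using this

theorem exists_linear_bound {p C M l T : ℝ} (hp : 2 < p) (hC : 0 ≤ C) (hl : 1 < l) {J : ℕ}
    {u w a u' w' a' : ℕ → ℝ → ℝ → ℝ} {G : ℝ → ℝ → ℝ}
    (hE : ∀ j ≥ J, Evol (Fj1 p j) (u j) (w j) (a j))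
    (hE' : ∀ j ≥ J, Evol (Fj1 p j) (u' j) (w' j) (a' j))
    (hL : ∀ j ≥ J, ∀ x ∈ Icc (-1 : ℝ) 1, ∀ t, 0 ≤ t → |u j x t - u j x 0| ≤ C * t)
    (hL' : ∀ j ≥ J, ∀ x ∈ Icc (-1 : ℝ) 1, ∀ t, 0 ≤ t → |u' j x t - u' j x 0| ≤ C * t)
    (hu : ∀ j ≥ J, ∀ x ∈ Icc (-1 : ℝ) 1, ∀ t, 0 ≤ t → u j x t ∈ Icc 0 M)
    (hu' : ∀ j ≥ J, ∀ x ∈ Icc (-1 : ℝ) 1, ∀ t, 0 ≤ t → u' j x t ∈ Icc 0 M)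
    (hdom : ∀ j ≥ J, ∀ x ∈ Icc (-1 : ℝ) 1, ∀ t, 0 ≤ t → l * u' j x t ≤ u j x t)
    (hG : ∀ j ≥ J, ∀ x ∈ Icc (-1 : ℝ) 1, ∀ t, 0 < t → u j x t ≤ G x t)
    (hlim : ∀ t, 0 < t → Tendsto (fun x => G x t) (𝓝[Ioo (-1) 1] (-1)) (𝓝 0) ∧
      Tendsto (fun x => G x t) (𝓝[Ioo (-1) 1] 1) (𝓝 0)) :
    ∃ N : ℝ, ∃ j₁ : ℕ, ∀ j ≥ j₁, ∀ x ∈ Icc (-1 : ℝ) 1, ∀ t ∈ Ioc 0 T,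
      u' j x t ≤ N * (1 + x) ∧ u' j x t ≤ N * (1 - x) := by
  have hneg : ∀ x ∈ Icc (-1 : ℝ) 1, -x ∈ Icc (-1 : ℝ) 1 := fun x hx =>
    ⟨by linarith [hx.2], by linarith [hx.1]⟩
  have hmap : Tendsto (fun x : ℝ => -x) (𝓝[Ioo (-1) 1] (-1)) (𝓝[Ioo (-1) 1] 1) := by
    refine tendsto_nhdsWithin_iff.2 ⟨?_, ?_⟩
    · have : Tendsto (fun x : ℝ => -x) (𝓝 (-1)) (𝓝 (- -1)) := continuous_neg.tendsto _
      rw [neg_neg] at this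
      exact this.mono_left nhdsWithin_le_nhds
    · filter_upwards [self_mem_nhdsWithin] with x hx
      exact ⟨by linarith [hx.2], by linarith [hx.1]⟩
  obtain ⟨N, j₁, h₁⟩ := exists_left_linear_bound (T := T) hp hC hl hE hE' hL hL' hu hu' hdom hG
    fun t ht => (hlim t ht).1
  obtain ⟨N', j₂, h₂⟩ := exists_left_linear_bound (T := T) (G := fun x => G (-x)) hp hC hl
    (fun j hj => (hE j hj).reflect (Fj1_neg p j)) (fun j hj => (hE' j hj).reflect (Fj1_neg p j))
    (fun j hj x hx => hL j hj (-x) (hneg x hx)) (fun j hj x hx => hL' j hj (-x) (hneg x hx))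
    (fun j hj x hx => hu j hj (-x) (hneg x hx)) (fun j hj x hx => hu' j hj (-x) (hneg x hx))
    (fun j hj x hx => hdom j hj (-x) (hneg x hx)) (fun j hj x hx => hG j hj (-x) (hneg x hx))
    fun t ht => (hlim t ht).2.comp hmap
  refine ⟨max N N', max j₁ j₂, fun j hj x hx t ht => ⟨?_, ?_⟩⟩
  · exact (h₁ j ((le_max_left _ _).trans hj) x hx t ht).trans
      (mul_le_mul_of_nonneg_right (le_max_left _ _) (by linarith [hx.1]))
  · have := h₂ j ((le_max_right _ _).trans hj) (-x) (hneg x hx) t ht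
    rw [neg_neg, ← sub_eq_add_neg] at this
    exact this.trans (mul_le_mul_of_nonneg_right (le_max_right _ _) (by linarith [hx.2]))

lemma exists_evol_family {p : ℝ} (hp : 2 < p) {v : ℝ → ℝ} (hv : MemX1 v) :
    ∃ u w a : ℕ → ℝ → ℝ → ℝ, ∀ j, 1 ≤ j → Evol (Fj1 p j) (u j) (w j) (a j) ∧
      (∀ x ∈ Icc (-1 : ℝ) 1, u j x 0 = v x) ∧
      ∀ x ∈ Icc (-1 : ℝ) 1, ∀ t, 0 ≤ t → 0 ≤ u j x t := by
  have : ∀ j : ℕ, ∃ u w a : ℝ → ℝ → ℝ, 1 ≤ j → Evol (Fj1 p j) u w a ∧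
      (∀ x ∈ Icc (-1 : ℝ) 1, u x 0 = v x) ∧ ∀ x ∈ Icc (-1 : ℝ) 1, ∀ t, 0 ≤ t → 0 ≤ u x t := by
    intro j
    by_cases hj : 1 ≤ j
    · obtain ⟨u, w, a, R, hE, hi, hn, -⟩ := exists_evol_Fj1 hp hj hv
      exact ⟨u, w, a, fun _ => ⟨hE, hi, hn⟩⟩
    · exact ⟨0, 0, 0, fun h => absurd h hj⟩
  choose u w a h using this
  exact ⟨u, w, a, h⟩

namespace Evol

variable {F : ℝ → ℝ} {u w a : ℝ → ℝ → ℝ}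

lemma cont_u_slice (h : Evol F u w a) {t : ℝ} (ht : 0 ≤ t) :
    ContinuousOn (fun x => u x t) (Icc (-1) 1) :=
  h.cont_u.comp (f := fun y : ℝ => (y, t)) (by fun_prop) fun _ hy => ⟨hy, ht⟩

lemma cont_w_slice (h : Evol F u w a) {t : ℝ} (ht : 0 ≤ t) :
    ContinuousOn (fun x => w x t) (Icc (-1) 1) :=
  h.cont_w.comp (f := fun y : ℝ => (y, t)) (by fun_prop) fun _ hy => ⟨hy, ht⟩

lemma le_dist_of_grad_le (h : Evol F u w a) {t J : ℝ} (ht : 0 ≤ t)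
    (hb : ∀ x ∈ Icc (-1 : ℝ) 1, |w x t| ≤ J) :
    ∀ x ∈ Icc (-1 : ℝ) 1, u x t ≤ J * (1 + x) ∧ u x t ≤ J * (1 - x) := by
  intro x hx
  have key := fun y hy => (le_abs_self _).trans (abs_sub_le_of_interior_deriv (h.cont_u_slice ht)
    (fun x hx => h.deriv_u x hx t ht) (fun x hx => hb x (Ioo_subset_Icc_self hx)) (x := y) hy hx)
  have h1 := key (-1) (by simp)
  have h2 := key 1 (by simp)
  rw [(h.bc t ht).1, sub_zero, sub_neg_eq_add,
    abs_of_nonneg (show 0 ≤ x + 1 by linarith [hx.1]), add_comm x] at h1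
  rw [(h.bc t ht).2, sub_zero, abs_of_nonpos (show x - 1 ≤ 0 by linarith [hx.2]), neg_sub] at h2
  exact ⟨h1, h2⟩

lemma exists_time_grad_le (h : Evol F u w a) {N J : ℝ} (hNJ : N < J)
    (hN : ∀ x ∈ Icc (-1 : ℝ) 1, ∀ y ∈ Icc (-1 : ℝ) 1, |u x 0 - u y 0| ≤ N * |x - y|) :
    ∃ τ > 0, ∀ x ∈ Icc (-1 : ℝ) 1, ∀ t ∈ Icc 0 τ, |w x t| ≤ J := by
  have h0 : ∀ x ∈ Icc (-1 : ℝ) 1, |w x 0| ≤ N := fun x hx => by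
    refine h.abs_grad_le (T := 0) (fun x hx t ht => ?_) hN x hx 0 ⟨le_rfl, le_rfl⟩
    obtain rfl : t = 0 := le_antisymm ht.2 ht.1
    have h1 := hN x hx (-1) (by simp)
    have h2 := hN x hx 1 (by simp)
    rw [(h.bc 0 le_rfl).1, sub_zero, sub_neg_eq_add,
      abs_of_nonneg (show 0 ≤ x + 1 by linarith [hx.1]), add_comm x] at h1
    rw [(h.bc 0 le_rfl).2, sub_zero, abs_of_nonpos (show x - 1 ≤ 0 by linarith [hx.2]),
      neg_sub] at h2
    exact ⟨h1, h2⟩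
  have hev : ∀ᶠ t in 𝓝 (0 : ℝ), ∀ x ∈ Icc (-1 : ℝ) 1, x ∈ Icc (-1 : ℝ) 1 → 0 ≤ t → |w x t| < J := by
    refine isCompact_Icc.eventually_forall_of_forall_eventually fun x hx => ?_
    have hc : ContinuousWithinAt (fun q : ℝ × ℝ => |w q.2 q.1|) (Ici 0 ×ˢ Icc (-1) 1) (0, x) :=
      (h.cont_w.comp (f := fun q : ℝ × ℝ => (q.2, q.1)) (by fun_prop)
        (fun q hq => ⟨hq.2, hq.1⟩)).abs (0, x) ⟨mem_Ici.2 le_rfl, hx⟩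
    have := hc.tendsto.eventually_lt_const ((h0 x hx).trans_lt hNJ)
    rw [eventually_nhdsWithin_iff] at this
    filter_upwards [this] with q hq h1 h2 using hq ⟨h2, h1⟩
  obtain ⟨τ, hτ, hb⟩ := Metric.eventually_nhds_iff.1 hev
  refine ⟨τ / 2, half_pos hτ, fun x hx t ht => (hb ?_ x hx hx ht.1).le⟩
  rw [Real.dist_eq, sub_zero, abs_of_nonneg ht.1]
  linarith [ht.2]

end Evol

lemma memX1_of_hasDerivAt {Q Q1 Q2 : ℝ → ℝ} (hd : ∀ x, HasDerivAt Q (Q1 x) x)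
    (hd' : ∀ x, HasDerivAt Q1 (Q2 x) x) (hQ : ∀ x ∈ Icc (-1 : ℝ) 1, 0 ≤ Q x) (h1 : Q (-1) = 0)
    (h2 : Q 1 = 0) : MemX1 Q :=
  ⟨(contDiffOn_one_of_hasDerivAt isOpen_univ (fun x _ => hd x)
    (HasDerivAt.continuousOn fun x _ => hd' x)).mono (subset_univ _), hQ, h1, h2⟩

/-- Solutions that start below a smooth function `Q` satisfy a uniform linear bound at the boundary
if solutions that start above a larger multiple of `Q` do not lose the boundary condition. -/
theorem exists_linear_bound_of_smooth {p l T : ℝ} (hp : 2 < p) (hl : 1 < l) {J : ℕ} (hJ : 1 ≤ J)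
    {u w a u' w' a' : ℕ → ℝ → ℝ → ℝ} {G : ℝ → ℝ → ℝ} {Q Q1 Q2 : ℝ → ℝ}
    (hd : ∀ x, HasDerivAt Q (Q1 x) x) (hd' : ∀ x, HasDerivAt Q1 (Q2 x) x) (hQc : Continuous Q2)
    (hQ : ∀ x ∈ Icc (-1 : ℝ) 1, 0 ≤ Q x) (hQl : Q (-1) = 0) (hQr : Q 1 = 0)
    (hE : ∀ j ≥ J, Evol (Fj1 p j) (u j) (w j) (a j))
    (hE' : ∀ j ≥ J, Evol (Fj1 p j) (u' j) (w' j) (a' j))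
    (hu : ∀ j ≥ J, ∀ x ∈ Icc (-1 : ℝ) 1, l * Q x ≤ u j x 0)
    (hu' : ∀ j ≥ J, ∀ x ∈ Icc (-1 : ℝ) 1, u' j x 0 ≤ Q x)
    (hG : ∀ j ≥ J, ∀ x ∈ Icc (-1 : ℝ) 1, ∀ t, 0 < t → u j x t ≤ G x t)
    (hlim : ∀ t, 0 < t → Tendsto (fun x => G x t) (𝓝[Ioo (-1) 1] (-1)) (𝓝 0) ∧
      Tendsto (fun x => G x t) (𝓝[Ioo (-1) 1] 1) (𝓝 0)) :
    ∃ N : ℝ, ∃ j₁ ≥ J, ∀ j ≥ j₁, ∀ x ∈ Icc (-1 : ℝ) 1, ∀ t ∈ Ioc 0 T,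
      u' j x t ≤ N * (1 + x) ∧ u' j x t ≤ N * (1 - x) := by
  have hl0 : 0 < l := by linarith
  have hdl : ∀ x, HasDerivAt (fun x => l * Q x) (l * Q1 x) x := fun x => (hd x).const_mul l
  have hdl' : ∀ x, HasDerivAt (fun x => l * Q1 x) (l * Q2 x) x := fun x => (hd' x).const_mul l
  obtain ⟨U, W, A, hU⟩ := exists_evol_family hp (memX1_of_hasDerivAt hdl hdl'
    (fun x hx => mul_nonneg hl0.le (hQ x hx)) (by simp [hQl]) (by simp [hQr]))
  obtain ⟨V, W', A', hV⟩ := exists_evol_family hp (memX1_of_hasDerivAt hd hd' hQ hQl hQr)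
  obtain ⟨M, hM⟩ := (isCompact_Icc (a := (-1 : ℝ)) (b := 1)).exists_bound_of_continuousOn
    (HasDerivAt.continuousOn fun x _ => hdl x)
  obtain ⟨B, hB⟩ := (isCompact_Icc (a := (-1 : ℝ)) (b := 1)).exists_bound_of_continuousOn
    (HasDerivAt.continuousOn fun x _ => hdl' x)
  obtain ⟨D, hD⟩ := (isCompact_Icc (a := (-1 : ℝ)) (b := 1)).exists_bound_of_continuousOn
    (hQc.const_mul l).continuousOn
  simp only [Real.norm_eq_abs] at hM hB hD
  have hz : (0 : ℝ) ∈ Icc (-1 : ℝ) 1 := by simp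
  have hM0 : 0 ≤ M := (abs_nonneg _).trans (hM 0 hz)
  have hB0 : 0 ≤ B := (abs_nonneg _).trans (hB 0 hz)
  have hD0 : 0 ≤ D := (abs_nonneg _).trans (hD 0 hz)
  set C := D + B ^ p
  have hC : 0 ≤ C := by positivity
  have hbound : ∀ (j : ℕ) (ξ η : ℝ), |ξ| ≤ D → |η| ≤ B → |ξ + Fj1 p j η| ≤ C := fun j ξ η h1 h2 => by
    refine (abs_add_le _ _).trans (add_le_add h1 ?_)
    rw [abs_of_nonneg (Fj1_nonneg p j η)]
    exact (Fj1_le_rpow p j η).trans (Real.rpow_le_rpow (abs_nonneg _) h2 (by linarith))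
  have hle : ∀ ξ B : ℝ, |l * ξ| ≤ B → |ξ| ≤ B := fun ξ B h => by
    rw [abs_mul, abs_of_pos hl0] at h
    nlinarith [abs_nonneg ξ]
  obtain ⟨N, j₁, H⟩ := exists_linear_bound (T := T) (M := M) (C := C) (l := l) (G := G) (J := J)
    (u := U) (u' := V) hp hC hl
    (fun j hj => (hU j (hJ.trans hj)).1) (fun j hj => (hV j (hJ.trans hj)).1)
    (fun j hj => (hU j (hJ.trans hj)).1.abs_sub_init_le hC (hU j (hJ.trans hj)).2.1 hdl hdl'
      fun x hx => hbound j _ _ (hD x (Ioo_subset_Icc_self hx)) (hB x (Ioo_subset_Icc_self hx)))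
    (fun j hj => (hV j (hJ.trans hj)).1.abs_sub_init_le hC (hV j (hJ.trans hj)).2.1 hd hd'
      fun x hx => hbound j _ _ (hle _ _ (hD x (Ioo_subset_Icc_self hx)))
        (hle _ _ (hB x (Ioo_subset_Icc_self hx))))
    (fun j hj x hx t ht => ⟨(hU j (hJ.trans hj)).2.2 x hx t ht,
      (hU j (hJ.trans hj)).1.le_of_init_le (Fj1_zero hp j) hM0 (fun x hx => by
        rw [(hU j (hJ.trans hj)).2.1 x hx]; exact (le_abs_self _).trans (hM x hx)) x hx t ht⟩)
    (fun j hj x hx t ht => ⟨(hV j (hJ.trans hj)).2.2 x hx t ht,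
      (hV j (hJ.trans hj)).1.le_of_init_le (Fj1_zero hp j) hM0 (fun x hx => by
        rw [(hV j (hJ.trans hj)).2.1 x hx]; exact (le_abs_self _).trans (hle _ _ (hM x hx)))
        x hx t ht⟩)
    (fun j hj x hx t ht => (hV j (hJ.trans hj)).1.comparison_mul (hU j (hJ.trans hj)).1 (T := t)
      (fun _ _ _ _ _ => mul_Fj1_le hp hl.le _) (fun x hx => by
        rw [(hU j (hJ.trans hj)).2.1 x hx, (hV j (hJ.trans hj)).2.1 x hx]) x hx t ⟨ht, le_rfl⟩)
    (fun j hj x hx t ht => ((hU j (hJ.trans hj)).1.comparison (hE j hj) (T := t)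
      (fun _ _ _ _ _ => le_rfl) (fun x hx => by
        rw [(hU j (hJ.trans hj)).2.1 x hx]; exact hu j hj x hx) x hx t ⟨ht.le, le_rfl⟩).trans
      (hG j hj x hx t ht))
    hlim
  refine ⟨N, max J j₁, le_max_left _ _, fun j hj x hx t ht => ?_⟩
  have hjJ : J ≤ j := (le_max_left _ _).trans hj
  have h1 := (hE' j hjJ).comparison (hV j (hJ.trans hjJ)).1 (T := t)
    (fun _ _ _ _ _ => le_rfl) (fun x hx => by
      rw [(hV j (hJ.trans hjJ)).2.1 x hx]; exact hu' j hjJ x hx) x hx t ⟨ht.1.le, le_rfl⟩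
  have h2 := H j ((le_max_right _ _).trans hj) x hx t ht
  exact ⟨h1.trans h2.1, h1.trans h2.2⟩

/-- **Theorem 3(ii) of Porretta–Souplet.** In dimension one with `Ω = (-1,1)`: if `u₀ ∈ X` is
such that gradient blowup occurs (`T*(u₀) < ∞`) but the global viscosity solution with data
`u₀` never loses the boundary conditions, then for any `v₀ ∈ X` with `v₀ ≤ u₀`, `v₀ ≢ u₀`,
the classical solution with data `v₀` is global: `T*(v₀) = ∞`. -/
theorem threshold_below_global_existence (p : ℝ) (hp : 2 < p) (u0 : ℝ → ℝ) (hu0 : MemX1 u0)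
    (hblow : ¬ ∃ u : ℝ → ℝ → ℝ, IsClassicalSol1Global p u0 u)
    (hnoloss : ∀ u : ℕ → ℝ → ℝ → ℝ, (∀ j, 1 ≤ j → IsRegSol1 p j u0 (u j)) →
      ∀ t > (0:ℝ),
        Tendsto (fun x => Usup1 u x t) (nhdsWithin (-1) (Ioo (-1:ℝ) 1)) (nhds 0) ∧
        Tendsto (fun x => Usup1 u x t) (nhdsWithin 1 (Ioo (-1:ℝ) 1)) (nhds 0))
    (v0 : ℝ → ℝ) (hv0 : MemX1 v0)
    (hle : ∀ x ∈ Icc (-1:ℝ) 1, v0 x ≤ u0 x)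
    (hne : ¬ ∀ x ∈ Icc (-1:ℝ) 1, v0 x = u0 x) :
    ∃ u : ℝ → ℝ → ℝ, IsClassicalSol1Global p v0 u := by
  obtain ⟨u, w, a, hu⟩ := exists_evol_family hp hu0
  obtain ⟨v, w', a', hv⟩ := exists_evol_family hp hv0
  have hlim := hnoloss u fun j hj => (hu j hj).1.isRegSol1 hp (hu j hj).2.1 (hu j hj).2.2
  obtain ⟨Nu, hNu0, hNu⟩ := hu0.exists_lipschitz
  obtain ⟨Nv, hNv0, hNv⟩ := hv0.exists_lipschitz
  obtain ⟨J, hJN⟩ := exists_nat_gt (max Nu Nv)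
  have hJ0 : 0 < (J : ℝ) := (hNu0.trans_le (le_max_left _ _)).trans hJN
  have hJ : 1 ≤ J := by exact_mod_cast hJ0
  -- On a short time interval the solutions do not depend on the truncation level.
  have hshort : ∃ τ > 0, ∀ x ∈ Icc (-1 : ℝ) 1, ∀ t ∈ Icc 0 τ, |w J x t| ≤ J ∧ |w' J x t| ≤ J := by
    obtain ⟨τ, hτ, h1⟩ := (hu J hJ).1.exists_time_grad_le ((le_max_left _ _).trans_lt hJN)
      fun x hx y hy => by rw [(hu J hJ).2.1 x hx, (hu J hJ).2.1 y hy]; exact hNu x hx y hy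
    obtain ⟨τ', hτ', h2⟩ := (hv J hJ).1.exists_time_grad_le ((le_max_right _ _).trans_lt hJN)
      fun x hx y hy => by rw [(hv J hJ).2.1 x hx, (hv J hJ).2.1 y hy]; exact hNv x hx y hy
    exact ⟨min τ τ', lt_min hτ hτ', fun x hx t ht =>
      ⟨h1 x hx t ⟨ht.1, ht.2.trans (min_le_left _ _)⟩,
        h2 x hx t ⟨ht.1, ht.2.trans (min_le_right _ _)⟩⟩⟩
  obtain ⟨τ, hτ, hgrad⟩ := hshort
  have hFeq : ∀ j ≥ J, ∀ ξ : ℝ, |ξ| ≤ J → Fj1 p J ξ = Fj1 p j ξ := fun j hj ξ h => by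
    rw [Fj1_eq hp h, Fj1_eq hp (h.trans (by exact_mod_cast hj))]
  have huJ : ∀ j ≥ J, ∀ x ∈ Icc (-1 : ℝ) 1, ∀ t ∈ Icc 0 τ, u J x t = u j x t := fun j hj =>
    (hu J hJ).1.unique (hu j (hJ.trans hj)).1 (fun x hx t ht _ =>
      hFeq j hj _ (hgrad x (Ioo_subset_Icc_self hx) t (Ioc_subset_Icc_self ht)).1)
      fun x hx => by rw [(hu J hJ).2.1 x hx, (hu j (hJ.trans hj)).2.1 x hx]
  have hvJ : ∀ j ≥ J, ∀ x ∈ Icc (-1 : ℝ) 1, ∀ t ∈ Icc 0 τ, v J x t = v j x t := fun j hj =>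
    (hv J hJ).1.unique (hv j (hJ.trans hj)).1 (fun x hx t ht _ =>
      hFeq j hj _ (hgrad x (Ioo_subset_Icc_self hx) t (Ioc_subset_Icc_self ht)).2)
      fun x hx => by rw [(hv J hJ).2.1 x hx, (hv j (hJ.trans hj)).2.1 x hx]
  have hττ : τ ∈ Icc 0 τ := ⟨hτ.le, le_rfl⟩
  obtain ⟨c, hc, hsep⟩ := (hu J hJ).1.hopf (hv J hJ).1 hτ (FjLip_nonneg hp hJ0.le)
    (fun x hx t ht => Fj1_lipschitz hp
      (hgrad x (Ioo_subset_Icc_self hx) t (Ioc_subset_Icc_self ht)).1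
      (hgrad x (Ioo_subset_Icc_self hx) t (Ioc_subset_Icc_self ht)).2)
    (fun x hx => by rw [(hu J hJ).2.1 x hx, (hv J hJ).2.1 x hx]; exact hle x hx)
    (by
      push Not at hne
      obtain ⟨x, hx, h⟩ := hne
      refine ⟨x, hx, ?_⟩
      rw [(hu J hJ).2.1 x hx, (hv J hJ).2.1 x hx]
      exact lt_of_le_of_ne (hle x hx) h)
  have huq : ∀ x ∈ Icc (-1 : ℝ) 1, u J x τ ≤ J * (1 - x ^ 2) := fun x hx => by
    obtain ⟨h1, h2⟩ := (hu J hJ).1.le_dist_of_grad_le hτ.le (fun x hx => (hgrad x hx τ hττ).1) x hx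
    rcases le_total x 0 with h | h
    · exact h1.trans (mul_le_mul_of_nonneg_left (by nlinarith [hx.1]) hJ0.le)
    · exact h2.trans (mul_le_mul_of_nonneg_left (by nlinarith [hx.2]) hJ0.le)
  obtain ⟨l, hl, Q, Q1, Q2, hd, hd', hQc, hQl, hQr, hQ⟩ := exists_smooth_between hc hJ0
    ((hv J hJ).1.cont_u_slice hτ.le) ((hv J hJ).1.cont_w_slice hτ.le)
    ((hu J hJ).1.cont_u_slice hτ.le) ((hu J hJ).1.cont_w_slice hτ.le)
    (fun x hx => (hv J hJ).1.deriv_u x hx τ hτ.le) (fun x hx => (hu J hJ).1.deriv_u x hx τ hτ.le)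
    ((hv J hJ).1.bc τ hτ.le) ((hu J hJ).1.bc τ hτ.le) hsep huq
  obtain ⟨M, hM⟩ := (isCompact_Icc (a := (-1 : ℝ)) (b := 1)).exists_bound_of_continuousOn
    hu0.1.continuousOn
  have hM0 : 0 ≤ M := (norm_nonneg _).trans (hM 0 (by simp))
  have hsup : ∀ j ≥ J, ∀ x ∈ Icc (-1 : ℝ) 1, ∀ t, 0 < t → u j x (τ + t) ≤ Usup1 u x (τ + t) :=
    fun j hj x hx t ht => by
      refine le_ciSup (f := fun j : {j : ℕ // 1 ≤ j} => u j.1 x (τ + t)) ⟨M, ?_⟩ ⟨j, hJ.trans hj⟩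
      rintro _ ⟨i, rfl⟩
      refine (hu i i.2).1.le_of_init_le (Fj1_zero hp i) hM0 (fun x hx => ?_) x hx _ (by positivity)
      rw [(hu i i.2).2.1 x hx]
      exact (le_abs_self _).trans (hM x hx)
  refine exists_classical_of_local hp fun T => ?_
  obtain ⟨N, j₁, hj₁, hN⟩ := exists_linear_bound_of_smooth (T := T) (J := J) hp hl hJ hd hd' hQc
    (fun x hx => ((hv J hJ).2.2 x hx τ hτ.le).trans (hQ x hx).1) hQl hQr
    (fun j hj => (hu j (hJ.trans hj)).1.shift hτ.le)
    (fun j hj => (hv j (hJ.trans hj)).1.shift hτ.le)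
    (fun j hj x hx => by rw [add_zero, ← huJ j hj x hx τ hττ]; exact (hQ x hx).2)
    (fun j hj x hx => by rw [add_zero, ← hvJ j hj x hx τ hττ]; exact (hQ x hx).1)
    hsup (fun t ht => hlim (τ + t) (by positivity))
  set N' := max N (max J Nv)
  have hN'J : J ≤ N' := (le_max_left _ _).trans (le_max_right _ _)
  set j := max j₁ ⌈N'⌉₊
  have hjJ : J ≤ j := hj₁.trans (le_max_left _ _)
  have hj : 1 ≤ j := hJ.trans hjJ
  refine ⟨j, v j, w' j, a' j, (hv j hj).1, (hv j hj).2.1, fun x hx t ht => ?_⟩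
  refine le_trans ?_ ((Nat.le_ceil N').trans (by exact_mod_cast le_max_right _ _))
  refine (hv j hj).1.abs_grad_le (T := T) (fun y hy s hs => ?_) (fun y hy z hz => ?_) x hx t ht
  · rw [abs_of_nonneg ((hv j hj).2.2 y hy s hs.1)]
    have hy1 : 0 ≤ 1 + y := by linarith [hy.1]
    have hy2 : 0 ≤ 1 - y := by linarith [hy.2]
    rcases le_or_gt s τ with h | h
    · rw [← hvJ j hjJ y hy s ⟨hs.1, h⟩]
      obtain ⟨h1, h2⟩ := (hv J hJ).1.le_dist_of_grad_le hs.1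
        (fun x hx => (hgrad x hx s ⟨hs.1, h⟩).2) y hy
      exact ⟨h1.trans (mul_le_mul_of_nonneg_right hN'J hy1),
        h2.trans (mul_le_mul_of_nonneg_right hN'J hy2)⟩
    · have := hN j (le_max_left _ _) y hy (s - τ) ⟨by linarith, by linarith [hs.2]⟩
      rw [add_sub_cancel] at this
      exact ⟨this.1.trans (mul_le_mul_of_nonneg_right (le_max_left _ _) hy1),
        this.2.trans (mul_le_mul_of_nonneg_right (le_max_left _ _) hy2)⟩
  · rw [(hv j hj).2.1 y hy, (hv j hj).2.1 z hz]
    exact (hNv y hy z hz).trans (mul_le_mul_of_nonneg_right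
      ((le_max_right _ _).trans (le_max_right _ _)) (abs_nonneg _))

end
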